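/- Upper bound with almost optimal second order constant for weak coupling (Erdős–Schlein–Yau): Let Ṽ:ℝ³→[0,∞) be smooth, radial, compactly supported and not identically zero. There exist constants C>0 and λ₀>0 such that for every λ∈(0,λ₀), denoting by a_λ the scattering length of λṼ, one has limsup_{ρ→0⁺} ( e₃⁺(ρ;λṼ) − 4πa_λρ² ) / ( 4πa_λρ²·√(ρa_λ³) ) ≤ (1+Cλ)·128/(15√π). -/

import Mathlib

open MeasureTheory Filter Real
open scoped ENNReal NNReal

noncomputable section

abbrev Vec (d : ℕ) := Fin d → ℝ

def box (d N : ℕ) (T : ℝ) : Set (Fin N → Vec d) :=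
  {x | ∀ i k, x i k ∈ Set.Icc (-T/2) (T/2)}

def periodize (d : ℕ) (V : Vec d → ℝ≥0∞) (T : ℝ) (z : Vec d) : ℝ≥0∞ :=
  ∑' n : Fin d → ℤ, V (fun k => z k + T * n k)

def kineticE (d N : ℕ) (T : ℝ) (ψ : (Fin N → Vec d) → ℂ) : ℝ≥0∞ :=
  ∑ i : Fin N, ∑ k : Fin d,
    ∫⁻ x in box d N T, (‖fderiv ℝ ψ x (Pi.single i (Pi.single k 1))‖₊ : ℝ≥0∞) ^ 2

def interE (d N : ℕ) (T : ℝ) (V : Vec d → ℝ≥0∞) (ψ : (Fin N → Vec d) → ℂ) : ℝ≥0∞ :=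
  ∑ i : Fin N, ∑ j : Fin N,
    if i < j then
      ∫⁻ x in box d N T, periodize d V T (fun k => x i k - x j k) * (‖ψ x‖₊ : ℝ≥0∞) ^ 2
    else 0

def IsTrialState (d N : ℕ) (T : ℝ) (ψ : (Fin N → Vec d) → ℂ) : Prop :=
  ContDiff ℝ (⊤ : ℕ∞) ψ ∧
  (∀ (x : Fin N → Vec d) (v : Fin N → Fin d → ℤ), ψ (fun i k => x i k + T * v i k) = ψ x) ∧
  (∀ (σ : Equiv.Perm (Fin N)) (x : Fin N → Vec d), ψ (x ∘ σ) = ψ x) ∧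
  ∫⁻ x in box d N T, (‖ψ x‖₊ : ℝ≥0∞) ^ 2 = 1

def gsEnergy (d N : ℕ) (T : ℝ) (V : Vec d → ℝ≥0∞) : ℝ :=
  sInf {e : ℝ | ∃ ψ, IsTrialState d N T ψ ∧
        kineticE d N T ψ + interE d N T V ψ ≠ ⊤ ∧
        (kineticE d N T ψ + interE d N T V ψ).toReal = e}

/-- side length of the thermodynamic box -/
def sideLength (d : ℕ) (ρ : ℝ) (N : ℕ) : ℝ := ((N : ℝ) / ρ) ^ ((1 : ℝ) / d)

def eMinus (d : ℕ) (V : Vec d → ℝ≥0∞) (ρ : ℝ) : ℝ :=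
  liminf (fun N : ℕ => gsEnergy d N (sideLength d ρ N) V / (sideLength d ρ N) ^ d) atTop

def ePlus (d : ℕ) (V : Vec d → ℝ≥0∞) (ρ : ℝ) : ℝ :=
  limsup (fun N : ℕ => gsEnergy d N (sideLength d ρ N) V / (sideLength d ρ N) ^ d) atTop

def scatSet3 (V : Vec 3 → ℝ≥0∞) : Set ℝ≥0∞ :=
  {E | ∃ f : Vec 3 → ℝ, ContDiff ℝ (⊤ : ℕ∞) f ∧ HasCompactSupport (fun x => f x - 1) ∧
       E = ∫⁻ x, ((∑ k, ((‖fderiv ℝ f x (Pi.single k 1)‖₊ : ℝ≥0∞)) ^ 2)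
             + V x * (‖f x‖₊ : ℝ≥0∞) ^ 2 / 2)}

namespace LHY

open Topology

section
open ProbabilityTheory

lemma integrable_gaussianReal_iff {c : ℝ≥0} (hc : c ≠ 0) {f : ℝ → ℝ} :
    Integrable f (gaussianReal 0 c) ↔ Integrable (fun t => gaussianPDFReal 0 c t * f t) := by
  rw [gaussianReal_of_var_ne_zero _ hc, integrable_withDensity_iff_integrable_smul₀']
  · simp [toReal_gaussianPDF]
  · exact (measurable_gaussianPDF 0 c).aemeasurable
  · exact ae_of_all _ fun x => gaussianPDF_lt_top

lemma integrable_abs_pow_mul_exp_gaussianReal {c : ℝ≥0} (hc : c ≠ 0) (hc1 : c < 1) (j : ℕ) :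
    Integrable (fun t : ℝ => |t| ^ j * exp (t ^ 2 / 2)) (gaussianReal 0 c) := by
  rw [integrable_gaussianReal_iff hc]
  have hc0 : (0 : ℝ) < c := by positivity
  have hc1' : (c : ℝ) < 1 := by exact_mod_cast hc1
  have hb : 0 < (1 / (2 * (c : ℝ)) - 1 / 2) := by
    rw [sub_pos]; apply one_div_lt_one_div_of_lt <;> linarith
  have h := ((integrable_rpow_mul_exp_neg_mul_sq hb (s := j)
    (by have : (0 : ℝ) ≤ j := by positivity
        linarith)).norm).const_mul ((√(2 * π * c))⁻¹)
  refine h.congr (ae_of_all _ fun t => ?_)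
  simp only [gaussianPDFReal, sub_zero, Real.rpow_natCast, norm_mul, norm_pow, Real.norm_eq_abs,
    Real.abs_exp]
  have : rexp (-(1 / (2 * (c : ℝ)) - 1 / 2) * t ^ 2) =
      rexp (-t ^ 2 / (2 * c)) * rexp (t ^ 2 / 2) := by
    rw [← Real.exp_add]; congr 1; field_simp; ring
  rw [this]
  ring

lemma integrable_pow_mul_exp_gaussianReal {c : ℝ≥0} (hc : c ≠ 0) (hc1 : c < 1) (j : ℕ) (a : ℝ) :
    Integrable (fun t : ℝ => t ^ j * exp (a * t)) (gaussianReal 0 c) := by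
  refine ((integrable_abs_pow_mul_exp_gaussianReal hc hc1 j).const_mul (exp (a ^ 2 / 2))).mono'
    (by fun_prop) (ae_of_all _ fun t => ?_)
  rw [norm_mul, norm_pow, Real.norm_eq_abs, Real.norm_eq_abs, Real.abs_exp, mul_left_comm,
    ← Real.exp_add]
  gcongr
  nlinarith [sq_nonneg (a - t)]

lemma gaussianReal_stein {c : ℝ≥0} (hc : c ≠ 0) (hc1 : c < 1) (j : ℕ) (a : ℝ) :
    ∫ t, t ^ (j + 1) * exp (a * t) ∂(gaussianReal 0 c) =
      c * (j * ∫ t, t ^ (j - 1) * exp (a * t) ∂(gaussianReal 0 c)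
        + a * ∫ t, t ^ j * exp (a * t) ∂(gaussianReal 0 c)) := by
  have hc0 : (0 : ℝ) < c := by positivity
  have I := fun j => (integrable_gaussianReal_iff hc).1
    (integrable_pow_mul_exp_gaussianReal hc hc1 j a)
  simp only [integral_gaussianReal_eq_integral_smul hc, smul_eq_mul]
  rw [← integral_const_mul, ← integral_const_mul, ← integral_add, ← integral_const_mul,
    ← sub_eq_zero, ← integral_sub]
  rotate_left
  · exact I _
  · exact (((I (j-1)).const_mul _).add ((I j).const_mul _)).const_mul _
  · exact (I (j-1)).const_mul _
  · exact (I j).const_mul _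
  have hd : ∀ t : ℝ, HasDerivAt
      (fun t => -c * (gaussianPDFReal 0 c t * (t ^ j * exp (a * t))))
      (gaussianPDFReal 0 c t * (t ^ (j + 1) * rexp (a * t)) -
      ↑c * (↑j * (gaussianPDFReal 0 c t * (t ^ (j - 1) * rexp (a * t))) +
        a * (gaussianPDFReal 0 c t * (t ^ j * rexp (a * t))))) t := by
    intro t
    unfold gaussianPDFReal
    have h1 : HasDerivAt (fun t : ℝ => exp (-(t - 0) ^ 2 / (2 * c)))
        (exp (-(t - 0) ^ 2 / (2 * c)) * (-(t / c))) t := by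
      apply HasDerivAt.exp
      have := (((hasDerivAt_id t).sub_const 0).pow 2).neg.div_const (2 * (c : ℝ))
      refine this.congr_deriv ?_
      simp; field_simp
    have h2 : HasDerivAt (fun t : ℝ => exp (a * t)) (exp (a * t) * a) t := by
      apply HasDerivAt.exp
      simpa using (hasDerivAt_id t).const_mul a
    have h3 := hasDerivAt_pow j t
    refine (((h1.const_mul ((√(2 * π * c))⁻¹)).mul (h3.mul h2)).const_mul (-(c : ℝ))).congr_deriv ?_
    simp only [Pi.mul_apply]
    field_simp
    ring
  refine integral_eq_zero_of_hasDerivAt_of_integrable hd ?_ ?_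
  · exact (I _).sub ((((I (j-1)).const_mul _).add ((I j).const_mul _)).const_mul _)
  · exact (I j).const_mul _

/-- The moments `∫∫ s^j t^j' e^{st}` of two independent Gaussians. -/
def biMoment (c : ℝ≥0) (j j' : ℕ) : ℝ :=
  ∫ s, s ^ j * ∫ t, t ^ j' * exp (s * t) ∂(gaussianReal 0 c) ∂(gaussianReal 0 c)

lemma integrable_biMoment {c : ℝ≥0} (hc : c ≠ 0) (hc1 : c < 1) (j j' : ℕ) :
    Integrable (fun z : ℝ × ℝ => z.1 ^ j * (z.2 ^ j' * exp (z.1 * z.2)))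
      ((gaussianReal 0 c).prod (gaussianReal 0 c)) := by
  refine ((integrable_abs_pow_mul_exp_gaussianReal hc hc1 j).mul_prod
    (integrable_abs_pow_mul_exp_gaussianReal hc hc1 j')).mono' (by fun_prop)
    (ae_of_all _ fun z => ?_)
  simp only [norm_mul, norm_pow, Real.norm_eq_abs, Real.abs_exp]
  have : exp (z.1 * z.2) ≤ exp (z.1 ^ 2 / 2) * exp (z.2 ^ 2 / 2) := by
    rw [← Real.exp_add]; gcongr; nlinarith [sq_nonneg (z.1 - z.2)]
  calc _ ≤ |z.1| ^ j * (|z.2| ^ j' * (exp (z.1 ^ 2 / 2) * exp (z.2 ^ 2 / 2))) := by gcongr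
    _ = _ := by ring

lemma biMoment_comm {c : ℝ≥0} (hc : c ≠ 0) (hc1 : c < 1) (j j' : ℕ) :
    biMoment c j j' = biMoment c j' j := by
  have := integral_integral_swap (f := fun s t : ℝ => s ^ j * (t ^ j' * exp (s * t)))
    (integrable_biMoment hc hc1 j j')
  unfold biMoment
  simp only [← integral_const_mul]
  rw [this]
  congr 1; ext t; congr 1; ext s
  rw [mul_comm t s]; ring

lemma biMoment_succ_left_aux {c : ℝ≥0} (hc : c ≠ 0) (hc1 : c < 1) (j j' : ℕ) :
    biMoment c j' (j + 1) = c * (j * biMoment c j' (j - 1) + biMoment c (j' + 1) j) := by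
  have I := fun i i' => (integrable_biMoment hc hc1 i i').integral_prod_left
  simp only [integral_const_mul] at I
  unfold biMoment
  simp only [gaussianReal_stein hc hc1]
  rw [← integral_const_mul, ← integral_add ((I _ _).const_mul _) (I _ _), ← integral_const_mul]
  congr 1; ext s; ring

lemma biMoment_succ_left {c : ℝ≥0} (hc : c ≠ 0) (hc1 : c < 1) (j j' : ℕ) :
    biMoment c (j + 1) j' = c / (1 - c ^ 2) * (j * biMoment c (j - 1) j')
      + c ^ 2 / (1 - c ^ 2) * (j' * biMoment c j (j' - 1)) := by
  have h1 := biMoment_succ_left_aux hc hc1 j j'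
  have h2 := biMoment_succ_left_aux hc hc1 j' j
  rw [biMoment_comm hc hc1 j' (j + 1), biMoment_comm hc hc1 j' (j - 1),
    biMoment_comm hc hc1 (j' + 1) j] at h1
  have hc1' : (c : ℝ) < 1 := by exact_mod_cast hc1
  have hc0 : (0 : ℝ) < c := by positivity
  have : (1 - (c : ℝ) ^ 2) ≠ 0 := by nlinarith
  field_simp
  rw [h2] at h1
  linear_combination h1

lemma biMoment_zero_pos {c : ℝ≥0} (hc : c ≠ 0) (hc1 : c < 1) : 0 < biMoment c 0 0 := by
  unfold biMoment
  simp only [pow_zero, one_mul]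
  have I := (integrable_biMoment hc hc1 0 0)
  simp only [pow_zero, one_mul] at I
  have := integral_prod _ I
  simp only at this
  rw [← this]
  exact integral_exp_pos I

end

section
open ProbabilityTheory

variable {ι : Type*} [Fintype ι]

/-- Product of centered Gaussians with variances `c k`. -/
def gaussPi (c : ι → ℝ≥0) : Measure (ι → ℝ) := Measure.pi fun k => gaussianReal 0 (c k)

instance (c : ι → ℝ≥0) : IsProbabilityMeasure (gaussPi c) := by unfold gaussPi; infer_instance

/-- Evaluation of a polynomial in two families of real variables. -/
def polyEval (p : MvPolynomial (ι ⊕ ι) ℂ) (z : (ι → ℝ) × (ι → ℝ)) : ℂ :=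
  MvPolynomial.eval (Sum.elim (fun k => (z.1 k : ℂ)) (fun k => (z.2 k : ℂ))) p

lemma polyEval_monomial (s : ι ⊕ ι →₀ ℕ) (a : ℂ) (z : (ι → ℝ) × (ι → ℝ)) :
    polyEval (MvPolynomial.monomial s a) z =
      a * ((∏ k, z.1 k ^ s (Sum.inl k) : ℝ) * (∏ k, z.2 k ^ s (Sum.inr k) : ℝ)) := by
  unfold polyEval
  rw [MvPolynomial.eval_monomial, Finsupp.prod_fintype _ _ (by simp), Fintype.prod_sum_type]
  push_cast
  rfl

omit [Fintype ι] in
lemma continuous_polyEval (p : MvPolynomial (ι ⊕ ι) ℂ) : Continuous (polyEval p) := by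
  unfold polyEval
  refine (MvPolynomial.continuous_eval p).comp (continuous_pi fun i => ?_)
  cases i <;> simp <;> fun_prop

/-- The unnormalised Gaussian expectation with the coupling weight `e^{∑ s_k t_k}`. -/
def wick (c : ι → ℝ≥0) (p : MvPolynomial (ι ⊕ ι) ℂ) : ℂ :=
  ∫ z, polyEval p z * (exp (∑ k, z.1 k * z.2 k) : ℝ) ∂((gaussPi c).prod (gaussPi c))

variable {c : ι → ℝ≥0}

lemma integrable_polyEval (hc : ∀ k, c k ≠ 0 ∧ c k < 1) (p : MvPolynomial (ι ⊕ ι) ℂ) :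
    Integrable (fun z => ‖polyEval p z‖ * exp (∑ k, |z.1 k * z.2 k|))
      ((gaussPi c).prod (gaussPi c)) := by
  have hm : ∀ p : MvPolynomial (ι ⊕ ι) ℂ, AEStronglyMeasurable
      (fun z => ‖polyEval p z‖ * exp (∑ k, |z.1 k * z.2 k|)) ((gaussPi c).prod (gaussPi c)) := by
    intro p
    have := continuous_polyEval p
    exact Continuous.aestronglyMeasurable (by fun_prop)
  induction p using MvPolynomial.induction_on' with
  | monomial s a =>
    have h1 : Integrable (fun x : ι → ℝ => ∏ k, (|x k| ^ s (Sum.inl k) * exp (x k ^ 2 / 2)))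
        (gaussPi c) := Integrable.fintype_prod (fun k =>
          integrable_abs_pow_mul_exp_gaussianReal (hc k).1 (hc k).2 _)
    have h2 : Integrable (fun x : ι → ℝ => ∏ k, (|x k| ^ s (Sum.inr k) * exp (x k ^ 2 / 2)))
        (gaussPi c) := Integrable.fintype_prod (fun k =>
          integrable_abs_pow_mul_exp_gaussianReal (hc k).1 (hc k).2 _)
    refine ((h1.mul_prod h2).const_mul ‖a‖).mono' (hm _) (ae_of_all _ fun z => ?_)
    rw [polyEval_monomial]
    simp only [norm_mul, abs_norm, abs_abs, Complex.norm_real, norm_prod, norm_pow, Real.norm_eq_abs,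
      Real.abs_exp, Finset.prod_mul_distrib]
    have : exp (∑ k, |z.1 k * z.2 k|) ≤ (∏ k, exp (z.1 k ^ 2 / 2)) * ∏ k, exp (z.2 k ^ 2 / 2) := by
      rw [← Real.exp_sum, ← Real.exp_sum, ← Real.exp_add, ← Finset.sum_add_distrib]
      gcongr with k
      rw [abs_mul]
      nlinarith [sq_nonneg (|z.1 k| - |z.2 k|), sq_abs (z.1 k), sq_abs (z.2 k)]
    calc _ ≤ ‖a‖ * ((∏ k, |z.1 k| ^ s (Sum.inl k)) * ∏ k, |z.2 k| ^ s (Sum.inr k)) *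
          ((∏ k, exp (z.1 k ^ 2 / 2)) * ∏ k, exp (z.2 k ^ 2 / 2)) := by
            gcongr
      _ = _ := by ring
  | add p q hp hq =>
    refine (hp.add hq).mono' (hm _) (ae_of_all _ fun z => ?_)
    simp only [norm_mul, abs_norm, Real.norm_eq_abs, Real.abs_exp, Pi.add_apply, ← add_mul]
    gcongr
    simp only [polyEval, map_add]
    exact norm_add_le _ _

lemma integrable_wick (hc : ∀ k, c k ≠ 0 ∧ c k < 1) (p : MvPolynomial (ι ⊕ ι) ℂ) :
    Integrable (fun z => polyEval p z * (exp (∑ k, z.1 k * z.2 k) : ℝ))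
      ((gaussPi c).prod (gaussPi c)) := by
  refine (integrable_polyEval hc p).mono' ?_ (ae_of_all _ fun z => ?_)
  · have := continuous_polyEval p
    exact Continuous.aestronglyMeasurable (by fun_prop)
  · rw [norm_mul, Complex.norm_real, Real.norm_eq_abs, Real.abs_exp]
    gcongr
    exact le_abs_self _

lemma wick_add (hc : ∀ k, c k ≠ 0 ∧ c k < 1) (p q : MvPolynomial (ι ⊕ ι) ℂ) :
    wick c (p + q) = wick c p + wick c q := by
  unfold wick
  rw [← integral_add (integrable_wick hc p) (integrable_wick hc q)]
  simp only [polyEval, map_add, add_mul]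

lemma wick_C_mul (a : ℂ) (p : MvPolynomial (ι ⊕ ι) ℂ) :
    wick c (MvPolynomial.C a * p) = a * wick c p := by
  unfold wick
  rw [← integral_const_mul]
  simp only [polyEval, map_mul, MvPolynomial.eval_C, mul_assoc]

lemma wick_zero : wick c 0 = 0 := by simp [wick, polyEval]

lemma wick_sum (hc : ∀ k, c k ≠ 0 ∧ c k < 1) {κ : Type*} (s : Finset κ)
    (p : κ → MvPolynomial (ι ⊕ ι) ℂ) : wick c (∑ i ∈ s, p i) = ∑ i ∈ s, wick c (p i) := by
  classical
  induction s using Finset.induction_on with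
  | empty => simp [wick_zero]
  | insert i s hi ih => rw [Finset.sum_insert hi, Finset.sum_insert hi, wick_add hc, ih]

lemma wick_monomial (hc : ∀ k, c k ≠ 0 ∧ c k < 1) (s : ι ⊕ ι →₀ ℕ) (a : ℂ) :
    wick c (MvPolynomial.monomial s a) =
      a * (∏ k, biMoment (c k) (s (Sum.inl k)) (s (Sum.inr k)) : ℝ) := by
  unfold wick
  have I := integrable_wick hc (MvPolynomial.monomial s 1)
  have e : ∀ z : (ι → ℝ) × (ι → ℝ), polyEval (MvPolynomial.monomial s 1) z *
      (exp (∑ k, z.1 k * z.2 k) : ℝ) = ((∏ k, z.1 k ^ s (Sum.inl k)) *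
        ∏ k, (z.2 k ^ s (Sum.inr k) * exp (z.1 k * z.2 k)) : ℝ) := by
    intro z
    rw [polyEval_monomial, Real.exp_sum, Finset.prod_mul_distrib]
    push_cast; ring
  simp only [e] at I
  have e2 : ∀ z : (ι → ℝ) × (ι → ℝ), polyEval (MvPolynomial.monomial s a) z *
      (exp (∑ k, z.1 k * z.2 k) : ℝ) = a * ((∏ k, z.1 k ^ s (Sum.inl k)) *
        ∏ k, (z.2 k ^ s (Sum.inr k) * exp (z.1 k * z.2 k)) : ℝ) := by
    intro z
    rw [← e z, polyEval_monomial, polyEval_monomial]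
    ring
  simp only [e2]
  rw [integral_const_mul, integral_complex_ofReal]
  have I' := I.re
  simp only [RCLike.re_to_complex, Complex.ofReal_re] at I'
  rw [integral_prod _ I']
  congr 2
  simp only [integral_const_mul]
  unfold gaussPi biMoment
  rw [← integral_fintype_prod_eq_prod]
  congr 1; ext x
  rw [Finset.prod_mul_distrib]
  congr 1
  exact integral_fintype_prod_eq_prod (fun k t => t ^ s (Sum.inr k) * rexp (x k * t))

lemma wick_one_pos (hc : ∀ k, c k ≠ 0 ∧ c k < 1) : ∃ Z : ℝ, 0 < Z ∧ wick c 1 = Z := by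
  refine ⟨∏ k, biMoment (c k) 0 0, Finset.prod_pos fun k _ =>
    biMoment_zero_pos (hc k).1 (hc k).2, ?_⟩
  have := wick_monomial hc 0 1
  simpa using this

/-- diagonal and off-diagonal covariances of the coupled Gaussians -/
def covA (c : ℝ≥0) : ℝ := c / (1 - c ^ 2)
def covG (c : ℝ≥0) : ℝ := c ^ 2 / (1 - c ^ 2)

open MvPolynomial in
lemma wick_X_inl_mul (hc : ∀ k, c k ≠ 0 ∧ c k < 1) (k : ι) (p : MvPolynomial (ι ⊕ ι) ℂ) :
    wick c (X (Sum.inl k) * p) = covA (c k) * wick c (pderiv (Sum.inl k) p)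
      + covG (c k) * wick c (pderiv (Sum.inr k) p) := by
  classical
  induction p using MvPolynomial.induction_on' with
  | monomial s a =>
    rw [X, monomial_mul, one_mul, pderiv_monomial, pderiv_monomial, wick_monomial hc,
      wick_monomial hc, wick_monomial hc,
      ← Finset.mul_prod_erase _ _ (Finset.mem_univ k),
      ← Finset.mul_prod_erase _ _ (Finset.mem_univ k),
      ← Finset.mul_prod_erase _ _ (Finset.mem_univ k)]
    have e1 : ∀ i ∈ Finset.univ.erase k, biMoment (c i)
        ((Finsupp.single (Sum.inl k) 1 + s : ι ⊕ ι →₀ ℕ) (Sum.inl i))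
        ((Finsupp.single (Sum.inl k) 1 + s : ι ⊕ ι →₀ ℕ) (Sum.inr i)) =
        biMoment (c i) (s (Sum.inl i)) (s (Sum.inr i)) := by
      intro i hi
      have := (Finset.ne_of_mem_erase hi).symm
      simp [this]
    have e2 : ∀ i ∈ Finset.univ.erase k, biMoment (c i)
        ((s - Finsupp.single (Sum.inl k) 1 : ι ⊕ ι →₀ ℕ) (Sum.inl i))
        ((s - Finsupp.single (Sum.inl k) 1 : ι ⊕ ι →₀ ℕ) (Sum.inr i)) =
        biMoment (c i) (s (Sum.inl i)) (s (Sum.inr i)) := by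
      intro i hi
      have := (Finset.ne_of_mem_erase hi).symm
      simp [this]
    have e3 : ∀ i ∈ Finset.univ.erase k, biMoment (c i)
        ((s - Finsupp.single (Sum.inr k) 1 : ι ⊕ ι →₀ ℕ) (Sum.inl i))
        ((s - Finsupp.single (Sum.inr k) 1 : ι ⊕ ι →₀ ℕ) (Sum.inr i)) =
        biMoment (c i) (s (Sum.inl i)) (s (Sum.inr i)) := by
      intro i hi
      have := (Finset.ne_of_mem_erase hi).symm
      simp [this]
    rw [Finset.prod_congr rfl e1, Finset.prod_congr rfl e2, Finset.prod_congr rfl e3]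
    have h := biMoment_succ_left (hc k).1 (hc k).2 (s (Sum.inl k)) (s (Sum.inr k))
    simp only [Finsupp.add_apply, Finsupp.single_apply, Finsupp.tsub_apply]
    simp only [reduceCtorEq, if_true, if_false, zero_add, tsub_zero]
    rw [add_comm 1, h]
    unfold covA covG
    push_cast
    ring
  | add p q hp hq =>
    rw [mul_add, wick_add hc, hp, hq, map_add, map_add, wick_add hc, wick_add hc]
    ring

open MvPolynomial in
lemma wick_X_inr_mul (hc : ∀ k, c k ≠ 0 ∧ c k < 1) (k : ι) (p : MvPolynomial (ι ⊕ ι) ℂ) :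
    wick c (X (Sum.inr k) * p) = covA (c k) * wick c (pderiv (Sum.inr k) p)
      + covG (c k) * wick c (pderiv (Sum.inl k) p) := by
  have hs : ∀ q : MvPolynomial (ι ⊕ ι) ℂ, wick c (rename Sum.swap q) = wick c q := by
    intro q
    induction q using MvPolynomial.induction_on' with
    | monomial s a =>
      rw [rename_monomial, wick_monomial hc, wick_monomial hc]
      congr 3
      ext i
      rw [biMoment_comm (hc i).1 (hc i).2]
      have h1 := Finsupp.mapDomain_apply (Equiv.sumComm ι ι).injective s (Sum.inl i)
      have h2 := Finsupp.mapDomain_apply (Equiv.sumComm ι ι).injective s (Sum.inr i)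
      simp only [Equiv.sumComm_apply, Sum.swap_inl, Sum.swap_inr] at h1 h2
      rw [h1, h2]
    | add p q hp hq => rw [map_add, wick_add hc, wick_add hc, hp, hq]
  have h := wick_X_inl_mul hc k (rename Sum.swap p)
  have inj : Function.Injective (Sum.swap : ι ⊕ ι → ι ⊕ ι) := (Equiv.sumComm ι ι).injective
  have d1 := pderiv_rename inj (Sum.inr k) p
  have d2 := pderiv_rename inj (Sum.inl k) p
  simp only [Sum.swap_inl, Sum.swap_inr] at d1 d2
  rw [d1, d2, hs, hs] at h
  rw [← h, ← hs (X _ * p), map_mul, rename_X, Sum.swap_inr]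

end

section
open ProbabilityTheory MvPolynomial

variable {ι : Type*} [Fintype ι] {c : ι → ℝ≥0}

/-- The affine polynomial `κ + ∑ a_i X_i`. -/
def aff (κ : ℂ) (a : ι ⊕ ι → ℂ) : MvPolynomial (ι ⊕ ι) ℂ := C κ + ∑ i, C (a i) * X i

/-- The covariance form of the coupled Gaussians. -/
def covB (c : ι → ℝ≥0) (a b : ι ⊕ ι → ℂ) : ℂ :=
  ∑ k, (covA (c k) * (a (Sum.inl k) * b (Sum.inl k) + a (Sum.inr k) * b (Sum.inr k)) +
    covG (c k) * (a (Sum.inl k) * b (Sum.inr k) + a (Sum.inr k) * b (Sum.inl k)))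

/-- The derivation dual to multiplication by a linear form. -/
def covD (c : ι → ℝ≥0) (a : ι ⊕ ι → ℂ) :
    Derivation ℂ (MvPolynomial (ι ⊕ ι) ℂ) (MvPolynomial (ι ⊕ ι) ℂ) :=
  mkDerivation ℂ (Sum.elim
    (fun k => C (covA (c k) * a (Sum.inl k) + covG (c k) * a (Sum.inr k)))
    (fun k => C (covA (c k) * a (Sum.inr k) + covG (c k) * a (Sum.inl k))))

lemma covD_aff (κ : ℂ) (a b : ι ⊕ ι → ℂ) : covD c a (aff κ b) = C (covB c a b) := by
  unfold aff covB covD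
  simp only [map_add, map_sum, Derivation.leibniz, mkDerivation_X, derivation_C, smul_eq_mul,
    mul_zero, add_zero, zero_add, Fintype.sum_sum_type, Sum.elim_inl, Sum.elim_inr]
  rw [← Finset.sum_add_distrib]
  refine Finset.sum_congr rfl fun k _ => ?_
  simp only [map_mul, map_add]
  ring

lemma covD_eq (a : ι ⊕ ι → ℂ) (p : MvPolynomial (ι ⊕ ι) ℂ) :
    covD c a p = ∑ k, (C (a (Sum.inl k)) * (C (covA (c k) : ℂ) * pderiv (Sum.inl k) p +
      C (covG (c k) : ℂ) * pderiv (Sum.inr k) p) + C (a (Sum.inr k)) *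
      (C (covA (c k) : ℂ) * pderiv (Sum.inr k) p + C (covG (c k) : ℂ) * pderiv (Sum.inl k) p)) := by
  classical
  let K : ℂ → MvPolynomial (ι ⊕ ι) ℂ := fun z => C z
  set D' : Derivation ℂ (MvPolynomial (ι ⊕ ι) ℂ) (MvPolynomial (ι ⊕ ι) ℂ) :=
    ∑ k, (K (a (Sum.inl k)) • (K (covA (c k)) • pderiv (Sum.inl k) +
      K (covG (c k)) • pderiv (Sum.inr k)) + K (a (Sum.inr k)) •
      (K (covA (c k)) • pderiv (Sum.inr k) + K (covG (c k)) • pderiv (Sum.inl k)))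
    with hD'
  have happ : ∀ q, D' q = ∑ k, (C (a (Sum.inl k)) * (C (covA (c k) : ℂ) * pderiv (Sum.inl k) q +
      C (covG (c k) : ℂ) * pderiv (Sum.inr k) q) + C (a (Sum.inr k)) *
      (C (covA (c k) : ℂ) * pderiv (Sum.inr k) q +
        C (covG (c k) : ℂ) * pderiv (Sum.inl k) q)) := by
    intro q
    rw [hD']
    refine (congrFun (map_sum (Derivation.coeFnAddMonoidHom (R := ℂ)
      (A := MvPolynomial (ι ⊕ ι) ℂ) (M := MvPolynomial (ι ⊕ ι) ℂ)) _ _) q).trans ?_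
    rw [Finset.sum_apply]
    simp [K, mul_add]
  rw [← happ p]
  congr 1
  refine MvPolynomial.derivation_ext fun i => ?_
  rw [happ]
  unfold covD
  rw [mkDerivation_X]
  rcases i with k | k
  · simp only [pderiv_X, Pi.single_apply, Sum.inl.injEq, reduceCtorEq, if_false, mul_zero,
      add_zero, zero_add, Sum.elim_inl]
    simp only [mul_ite, mul_one, mul_zero, Finset.sum_add_distrib]
    simp
    ring
  · simp only [pderiv_X, Pi.single_apply, Sum.inr.injEq, reduceCtorEq, if_false, mul_zero,
      add_zero, zero_add, Sum.elim_inr]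
    simp only [mul_ite, mul_one, mul_zero, Finset.sum_add_distrib]
    simp
    ring

lemma wick_aff_mul (hc : ∀ k, c k ≠ 0 ∧ c k < 1) (κ : ℂ) (a : ι ⊕ ι → ℂ)
    (p : MvPolynomial (ι ⊕ ι) ℂ) :
    wick c (aff κ a * p) = κ * wick c p + wick c (covD c a p) := by
  rw [covD_eq, aff, add_mul, wick_add hc, wick_C_mul, Finset.sum_mul, wick_sum hc, wick_sum hc,
    Fintype.sum_sum_type, ← Finset.sum_add_distrib]
  congr 1
  refine Finset.sum_congr rfl fun k _ => ?_
  rw [mul_assoc, mul_assoc, wick_C_mul, wick_C_mul, wick_X_inl_mul hc, wick_X_inr_mul hc,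
    wick_add hc, wick_C_mul, wick_C_mul, wick_add hc, wick_add hc, wick_C_mul, wick_C_mul,
    wick_C_mul, wick_C_mul]

lemma wick_aff_two (hc : ∀ k, c k ≠ 0 ∧ c k < 1) (k1 k2 : ℂ) (a1 a2 : ι ⊕ ι → ℂ) :
    wick c (aff k1 a1 * aff k2 a2) = wick c 1 * (k1 * k2 + covB c a1 a2) := by
  have h1 : wick c (aff k2 a2) = wick c 1 * k2 := by
    have := wick_aff_mul hc k2 a2 1
    rw [mul_one] at this
    rw [this]; simp [wick_zero, mul_comm]
  have h2 : ∀ z, wick c (C z) = wick c 1 * z := by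
    intro z
    have := wick_C_mul (c := c) z 1
    rw [mul_one] at this
    rw [this]; ring
  rw [wick_aff_mul hc, covD_aff, h1, h2]; ring

lemma wick_aff_four (hc : ∀ k, c k ≠ 0 ∧ c k < 1) (k1 k2 k3 k4 : ℂ) (a1 a2 a3 a4 : ι ⊕ ι → ℂ) :
    wick c (aff k1 a1 * (aff k2 a2 * (aff k3 a3 * aff k4 a4))) = wick c 1 *
      (k1 * k2 * k3 * k4 + covB c a1 a2 * k3 * k4 + covB c a1 a3 * k2 * k4 + covB c a1 a4 * k2 * k3
       + covB c a2 a3 * k1 * k4 + covB c a2 a4 * k1 * k3 + covB c a3 a4 * k1 * k2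
       + covB c a1 a2 * covB c a3 a4 + covB c a1 a3 * covB c a2 a4
       + covB c a1 a4 * covB c a2 a3) := by
  have h1 : ∀ k2 a2, wick c (aff k2 a2) = wick c 1 * k2 := by
    intro k2 a2
    have := wick_aff_mul hc k2 a2 1
    rw [mul_one] at this
    rw [this]; simp [wick_zero, mul_comm]
  have e : covD c a1 (aff k2 a2 * (aff k3 a3 * aff k4 a4)) =
      C (covB c a1 a2) * (aff k3 a3 * aff k4 a4) + (C (covB c a1 a3) * (aff k2 a2 * aff k4 a4)
        + C (covB c a1 a4) * (aff k2 a2 * aff k3 a3)) := by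
    simp only [Derivation.leibniz, covD_aff, smul_eq_mul]; ring
  have e' : covD c a2 (aff k3 a3 * aff k4 a4) =
      C (covB c a2 a3) * aff k4 a4 + C (covB c a2 a4) * aff k3 a3 := by
    simp only [Derivation.leibniz, covD_aff, smul_eq_mul]; ring
  rw [wick_aff_mul hc, e, wick_add hc, wick_add hc, wick_C_mul, wick_C_mul, wick_C_mul,
    wick_aff_two hc, wick_aff_two hc, wick_aff_two hc, wick_aff_mul hc, e', wick_add hc,
    wick_C_mul, wick_C_mul, wick_aff_two hc, h1, h1]
  ring

end

section
open ProbabilityTheory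

variable {ι : Type*} [Fintype ι] {c : ι → ℝ≥0}

/-- The overlap `N₀ + ∑ s_k t_k` of two coherent fields. -/
def overlap (N0 : ℝ) (z : (ι → ℝ) × (ι → ℝ)) : ℝ := N0 + ∑ k, z.1 k * z.2 k

lemma continuous_overlap (N0 : ℝ) : Continuous (overlap (ι := ι) N0) := by
  unfold overlap; fun_prop

lemma hasSum_congr_fun {α : Type*} [AddCommMonoid α] [TopologicalSpace α] {f g : ℕ → α} {a : α}
    (h : ∀ n, f n = g n) : HasSum f a ↔ HasSum g a := by rw [funext h]

lemma integrable_of_le_polyEval (hc : ∀ k, c k ≠ 0 ∧ c k < 1)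
    {Q : (ι → ℝ) × (ι → ℝ) → ℂ} {p : MvPolynomial (ι ⊕ ι) ℂ}
    (hQ : AEStronglyMeasurable Q ((gaussPi c).prod (gaussPi c)))
    (hp : ∀ z, ‖Q z‖ ≤ ‖polyEval p z‖) (N0 : ℝ) :
    Integrable (fun z => ‖Q z‖ * exp (N0 + ∑ k, |z.1 k * z.2 k|))
      ((gaussPi c).prod (gaussPi c)) := by
  refine ((integrable_polyEval hc p).mul_const (exp N0)).mono' ?_ (ae_of_all _ fun z => ?_)
  · exact hQ.norm.mul (Continuous.aestronglyMeasurable (by fun_prop))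
  · rw [exp_add, Real.norm_of_nonneg (by positivity)]
    have := hp z
    calc _ ≤ ‖polyEval p z‖ * (exp N0 * exp (∑ k, |z.1 k * z.2 k|)) := by gcongr
      _ = _ := by ring

lemma hasSum_overlap_pow (hc : ∀ k, c k ≠ 0 ∧ c k < 1)
    {Q : (ι → ℝ) × (ι → ℝ) → ℂ} {p : MvPolynomial (ι ⊕ ι) ℂ}
    (hQ : AEStronglyMeasurable Q ((gaussPi c).prod (gaussPi c)))
    (hp : ∀ z, ‖Q z‖ ≤ ‖polyEval p z‖) {N0 : ℝ} (h0 : 0 ≤ N0) :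
    HasSum (fun n : ℕ => ((n.factorial : ℂ))⁻¹ *
        ∫ z, Q z * (overlap N0 z : ℂ) ^ n ∂((gaussPi c).prod (gaussPi c)))
      (∫ z, Q z * (exp (overlap N0 z) : ℝ) ∂((gaussPi c).prod (gaussPi c))) := by
  have hI := integrable_of_le_polyEval hc hQ hp N0
  have key := hasSum_integral_of_dominated_convergence
    (μ := (gaussPi c).prod (gaussPi c))
    (F := fun (n : ℕ) z => Q z * ((n.factorial : ℂ)⁻¹ * (overlap N0 z : ℂ) ^ n))
    (f := fun z => Q z * (exp (overlap N0 z) : ℝ))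
    (bound := fun n z => ‖Q z‖ * ((n.factorial : ℝ)⁻¹ * (N0 + ∑ k, |z.1 k * z.2 k|) ^ n))
    ?_ ?_ ?_ ?_ ?_
  · refine (hasSum_congr_fun fun n => ?_).mpr key
    rw [← integral_const_mul]
    congr 1; ext z; ring
  · intro n
    have := continuous_overlap (ι := ι) N0
    exact hQ.mul (Continuous.aestronglyMeasurable (by fun_prop))
  · intro n
    refine ae_of_all _ fun z => ?_
    rw [norm_mul, norm_mul, norm_inv, Complex.norm_natCast, norm_pow, Complex.norm_real]
    gcongr
    unfold overlap
    rw [Real.norm_eq_abs]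
    refine (abs_add_le _ _).trans ?_
    rw [abs_of_nonneg h0]
    gcongr
    exact Finset.abs_sum_le_sum_abs _ _
  · refine ae_of_all _ fun z => ?_
    refine Summable.mul_left _ ?_
    refine (Real.summable_pow_div_factorial (N0 + ∑ k, |z.1 k * z.2 k|)).congr fun n => ?_
    field_simp
  · refine hI.congr (ae_of_all _ fun z => ?_)
    simp only
    rw [tsum_mul_left]
    congr 1
    rw [Real.exp_eq_exp_ℝ, NormedSpace.exp_eq_tsum_div]
    exact tsum_congr fun n => by field_simp
  · refine ae_of_all _ fun z => ?_
    refine HasSum.mul_left _ ?_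
    have := NormedSpace.expSeries_div_hasSum_exp (overlap N0 z : ℂ)
    rw [← Complex.exp_eq_exp_ℂ, ← Complex.ofReal_exp] at this
    exact (hasSum_congr_fun fun n => by field_simp).mpr this

end

section
open ProbabilityTheory ComplexConjugate

section
variable {X : Type*} [MeasurableSpace X] {ν : Measure X} [SigmaFinite ν]

lemma integral_pi_single {n : ℕ} (i : Fin (n + 1)) (F0 F : X → ℂ) :
    ∫ x : Fin (n + 1) → X, ∏ l, (if l = i then F0 else F) (x l) ∂(Measure.pi fun _ => ν) =
      (∫ x, F0 x ∂ν) * (∫ x, F x ∂ν) ^ n := by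
  rw [integral_fintype_prod_eq_prod (fun l x => (if l = i then F0 else F) x),
    Fin.prod_univ_succAbove _ i]
  simp [Fin.succAbove_ne]

lemma integral_pi_pair_aux {n : ℕ} (i : Fin (n + 2)) (j' : Fin (n + 1)) (w : X → X → ℂ)
    (F : X → ℂ) :
    ∫ x : Fin (n + 2) → X, w (x i) (x (i.succAbove j')) * ∏ l, F (x l) ∂(Measure.pi fun _ => ν) =
      (∫ p, w p.1 p.2 * (F p.1 * F p.2) ∂(ν.prod ν)) * (∫ x, F x ∂ν) ^ n := by
  have e1 := measurePreserving_piFinSuccAbove (fun _ : Fin (n + 2) => ν) i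
  have e2 := measurePreserving_piFinSuccAbove (fun _ : Fin (n + 1) => ν) j'
  have e12 := (MeasurePreserving.id ν).prod e2
  have e3 := (measurePreserving_prodAssoc ν ν (Measure.pi fun _ : Fin n => ν)).symm
  have h1 := e1.integral_comp' (g := fun q : X × (Fin (n + 1) → X) =>
    w q.1 (q.2 j') * (F q.1 * ∏ l, F (q.2 l)))
  have h2 := e12.integral_comp ((MeasurableEquiv.refl X).prodCongr
    (MeasurableEquiv.piFinSuccAbove (fun _ : Fin (n + 1) => X) j')).measurableEmbedding
    (fun q : X × X × (Fin n → X) => w q.1 q.2.1 * (F q.1 * (F q.2.1 * ∏ l, F (q.2.2 l))))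
  have h3 := e3.integral_comp' (g := fun q : (X × X) × (Fin n → X) =>
    (w q.1.1 q.1.2 * (F q.1.1 * F q.1.2)) * ∏ l, F (q.2 l))
  rw [integral_prod_mul (fun p : X × X => w p.1 p.2 * (F p.1 * F p.2))
    (fun x : Fin n → X => ∏ l, F (x l)), integral_fintype_prod_eq_prod (fun _ => F)] at h3
  simp only [Finset.prod_const, Finset.card_univ, Fintype.card_fin] at h3
  rw [← h3]
  trans
  · refine (integral_congr_ae (ae_of_all _ fun x => ?_)).trans h1
    simp only [MeasurableEquiv.piFinSuccAbove_apply, Fin.insertNthEquiv_symm_apply, Fin.removeNth]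
    rw [Fin.prod_univ_succAbove _ i]
  trans
  · refine (integral_congr_ae (ae_of_all _ fun x => ?_)).trans h2
    simp only [Prod.map, id, MeasurableEquiv.piFinSuccAbove_apply,
      Fin.insertNthEquiv_symm_apply, Fin.removeNth]
    rw [Fin.prod_univ_succAbove _ j']
  · refine integral_congr_ae (ae_of_all _ fun x => ?_)
    simp [MeasurableEquiv.prodAssoc]
    ring

lemma integral_pi_pair {n : ℕ} {i j : Fin (n + 2)} (hij : i ≠ j) (w : X → X → ℂ)
    (F : X → ℂ) :
    ∫ x : Fin (n + 2) → X, w (x i) (x j) * ∏ l, F (x l) ∂(Measure.pi fun _ => ν) =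
      (∫ p, w p.1 p.2 * (F p.1 * F p.2) ∂(ν.prod ν)) * (∫ x, F x ∂ν) ^ n := by
  obtain ⟨j', rfl⟩ := Fin.exists_succAbove_eq hij.symm
  exact integral_pi_pair_aux i j' w F

end

lemma integral_normSq_superposition {Ω X : Type*} [MeasurableSpace Ω] [MeasurableSpace X]
    {P : Measure Ω} [SFinite P] {ν : Measure X} [IsFiniteMeasure ν]
    {F : Ω → X → ℂ} (hF : Measurable (Function.uncurry F)) {h : Ω → ℝ} (hh : Integrable h P)
    (hFh : ∀ g x, ‖F g x‖ ≤ h g) {w : X → ℝ} (hw : Measurable w) {M : ℝ} (hM : ∀ x, |w x| ≤ M) :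
    ((∫ x, w x * ‖∫ g, F g x ∂P‖ ^ 2 ∂ν : ℝ) : ℂ) =
      ∫ z, ∫ x, (w x : ℂ) * (F z.1 x * conj (F z.2 x)) ∂ν ∂(P.prod P) := by
  rw [integral_integral_swap, ← integral_complex_ofReal]
  · refine integral_congr_ae (ae_of_all _ fun x => ?_)
    simp only
    rw [integral_const_mul, integral_prod_mul (fun g => F g x) (fun g => conj (F g x)),
      integral_conj, Complex.mul_conj, Complex.normSq_eq_norm_sq]
    push_cast; rfl
  · have hdom : Integrable (fun p : (Ω × Ω) × X => (h p.1.1 * h p.1.2) * M)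
        ((P.prod P).prod ν) := (hh.mul_prod hh).mul_prod (integrable_const M)
    refine hdom.mono' ?_ (ae_of_all _ fun p => ?_)
    · refine Measurable.aestronglyMeasurable ?_
      have m1 : Measurable fun p : (Ω × Ω) × X => F p.1.1 p.2 :=
        hF.comp (by fun_prop : Measurable fun p : (Ω × Ω) × X => (p.1.1, p.2))
      have m2 : Measurable fun p : (Ω × Ω) × X => F p.1.2 p.2 :=
        hF.comp (by fun_prop : Measurable fun p : (Ω × Ω) × X => (p.1.2, p.2))
      have m3 : Measurable fun p : (Ω × Ω) × X => conj (F p.1.2 p.2) :=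
        (Complex.continuous_conj.measurable).comp m2
      have m4 : Measurable fun p : (Ω × Ω) × X => (w p.2 : ℂ) :=
        Complex.measurable_ofReal.comp (hw.comp measurable_snd)
      exact m4.mul (m1.mul m3)
    · simp only [Function.uncurry, norm_mul, Complex.norm_real, Real.norm_eq_abs,
        RCLike.norm_conj]
      have h1 := hFh p.1.1 p.2
      have h2 := hFh p.1.2 p.2
      have h3 := hM p.2
      have h4 : 0 ≤ h p.1.1 := (norm_nonneg _).trans h1
      calc _ ≤ M * (h p.1.1 * h p.1.2) := by gcongr; exact (abs_nonneg _).trans h3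
        _ = _ := by ring

end

section
open ProbabilityTheory ComplexConjugate

variable {ι : Type*} [Fintype ι] {c : ι → ℝ≥0}

/-- A polynomial bound for the fields. -/
def gb (K : ℝ) (g : ι → ℝ) : ℝ := K * (1 + ∑ k, (1 + g k ^ 2))

def gbP (K : ℝ) (s : ι → ι ⊕ ι) : MvPolynomial (ι ⊕ ι) ℂ :=
  MvPolynomial.C (K : ℂ) * (1 + ∑ k, (1 + MvPolynomial.X (s k) ^ 2))

lemma polyEval_gbP_inl (K : ℝ) (z : (ι → ℝ) × (ι → ℝ)) :
    polyEval (gbP K Sum.inl) z = gb K z.1 := by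
  simp [polyEval, gbP, gb]

lemma polyEval_gbP_inr (K : ℝ) (z : (ι → ℝ) × (ι → ℝ)) :
    polyEval (gbP K Sum.inr) z = gb K z.2 := by
  simp [polyEval, gbP, gb]

omit [Fintype ι] in
lemma polyEval_mul (p q : MvPolynomial (ι ⊕ ι) ℂ) (z : (ι → ℝ) × (ι → ℝ)) :
    polyEval (p * q) z = polyEval p z * polyEval q z := by simp [polyEval]

omit [Fintype ι] in
lemma polyEval_pow (p : MvPolynomial (ι ⊕ ι) ℂ) (n : ℕ) (z : (ι → ℝ) × (ι → ℝ)) :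
    polyEval (p ^ n) z = polyEval p z ^ n := by simp [polyEval]

lemma gb_nonneg {K : ℝ} (hK : 0 ≤ K) (g : ι → ℝ) : 0 ≤ gb K g := by unfold gb; positivity

lemma continuous_gb (K : ℝ) : Continuous (gb (ι := ι) K) := by unfold gb; fun_prop

lemma integrable_gb_pow (hc : ∀ k, c k ≠ 0 ∧ c k < 1) {K : ℝ} (hK : 0 ≤ K) (n : ℕ) :
    Integrable (fun g : ι → ℝ => gb K g ^ n) (gaussPi c) := by
  have hcont := continuous_gb (ι := ι) K
  have h1 := (measurePreserving_fst (μ := gaussPi c) (ν := gaussPi c)).integrable_comp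
    (g := fun g : ι → ℝ => gb K g ^ n) (Continuous.aestronglyMeasurable (by fun_prop))
  rw [← h1]
  refine (integrable_polyEval hc (gbP K Sum.inl ^ n)).mono'
    (Continuous.aestronglyMeasurable (by fun_prop)) (ae_of_all _ fun z => ?_)
  have hn := gb_nonneg hK z.1
  rw [polyEval_pow, polyEval_gbP_inl, norm_pow, Complex.norm_real, Real.norm_of_nonneg hn,
    Function.comp, Real.norm_of_nonneg (pow_nonneg hn n)]
  exact le_mul_of_one_le_right (pow_nonneg hn n) (Real.one_le_exp (by positivity))

/-- Coefficients and modes of the coherent field. -/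
def co (κ : ℝ) (ω : ι → ℂ) (g : ι → ℝ) : Option ι → ℂ
  | none => κ
  | some k => ω k * g k

def em (u : ι → Vec 3 → ℝ) (x : Vec 3) : Option ι → ℝ
  | none => 1
  | some k => u k x

/-- The coherent field `κ + ∑ ω_k g_k u_k(x)`. -/
def fld (κ : ℝ) (ω : ι → ℂ) (u : ι → Vec 3 → ℝ) (g : ι → ℝ) (x : Vec 3) : ℂ :=
  κ + ∑ k, ω k * g k * u k x

lemma fld_eq (κ : ℝ) (ω : ι → ℂ) (u : ι → Vec 3 → ℝ) (g : ι → ℝ) (x : Vec 3) :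
    fld κ ω u g x = ∑ o, co κ ω g o * em u x o := by
  simp [fld, Fintype.sum_option, co, em]

lemma norm_fld_le {κ : ℝ} {ω : ι → ℂ} (hω : ∀ k, ‖ω k‖ = 1) {u : ι → Vec 3 → ℝ} {K : ℝ}
    (hκ : |κ| ≤ K) {x : Vec 3} (hu : ∀ k, |u k x| ≤ K) (g : ι → ℝ) :
    ‖fld κ ω u g x‖ ≤ gb K g := by
  unfold fld gb
  have hK : 0 ≤ K := (abs_nonneg _).trans hκ
  refine (norm_add_le _ _).trans ?_
  rw [mul_add, mul_one, Complex.norm_real, Real.norm_eq_abs, Finset.mul_sum]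
  refine add_le_add hκ ((norm_sum_le _ _).trans (Finset.sum_le_sum fun k _ => ?_))
  rw [norm_mul, norm_mul, hω, Complex.norm_real, Complex.norm_real, one_mul, Real.norm_eq_abs,
    Real.norm_eq_abs, mul_comm]
  have : |g k| ≤ 1 + g k ^ 2 := by nlinarith [sq_nonneg (|g k| - 1), sq_abs (g k)]
  exact mul_le_mul (hu k) this (abs_nonneg _) hK

lemma norm_co_le {κ : ℝ} {ω : ι → ℂ} (hω : ∀ k, ‖ω k‖ = 1) (g : ι → ℝ) (o : Option ι) :
    ‖co κ ω g o‖ ≤ gb (|κ| + 1) g := by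
  have h0 : 0 ≤ ∑ k, (1 + g k ^ 2) := by positivity
  have h1 := abs_nonneg κ
  unfold gb
  rcases o with _ | k
  · simp only [co, Complex.norm_real, Real.norm_eq_abs]
    nlinarith
  · simp only [co, norm_mul, hω, one_mul, Complex.norm_real, Real.norm_eq_abs]
    have h2 : (1 + g k ^ 2) ≤ ∑ k, (1 + g k ^ 2) :=
      Finset.single_le_sum (f := fun k => 1 + g k ^ 2) (fun k _ => by positivity)
        (Finset.mem_univ k)
    have : |g k| ≤ 1 + g k ^ 2 := by nlinarith [sq_nonneg (|g k| - 1), sq_abs (g k)]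
    nlinarith

omit [Fintype ι] in
lemma continuous_co (κ : ℝ) (ω : ι → ℂ) (o : Option ι) : Continuous fun g => co κ ω g o := by
  rcases o with _ | k
  · exact continuous_const
  · simp only [co]; fun_prop

lemma integral_prod_expand (hc : ∀ k, c k ≠ 0 ∧ c k < 1) (κ : ℝ) {ω : ι → ℂ}
    (hω : ∀ k, ‖ω k‖ = 1) {n : ℕ} (Φ : Fin n → Option ι → ℂ) :
    ∫ g, ∏ l, ∑ o, co κ ω g o * Φ l o ∂(gaussPi c) =
      ∑ f : Fin n → Option ι, (∫ g, ∏ l, co κ ω g (f l) ∂(gaussPi c)) * ∏ l, Φ l (f l) := by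
  classical
  simp_rw [Finset.prod_univ_sum, Fintype.piFinset_univ, Finset.prod_mul_distrib]
  rw [integral_finsetSum]
  · simp_rw [integral_mul_const]
  · intro f _
    refine Integrable.mul_const ?_ _
    refine (integrable_gb_pow hc (K := |κ| + 1) (by positivity) n).mono' ?_
      (ae_of_all _ fun g => ?_)
    · have := fun l => continuous_co κ ω (f l)
      exact Continuous.aestronglyMeasurable (by fun_prop)
    · rw [norm_prod]
      refine (Finset.prod_le_prod (fun _ _ => norm_nonneg _)
        (fun l _ => norm_co_le hω g (f l))).trans ?_
      simp

/-- The Gaussian superposition of coherent `n`-particle states. -/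
def psi (c : ι → ℝ≥0) (κ : ℝ) (ω : ι → ℂ) (u : ι → Vec 3 → ℝ) (n : ℕ) (x : Fin n → Vec 3) : ℂ :=
  ∫ g, ∏ l, fld κ ω u g (x l) ∂(gaussPi c)

/-- The coherent field with its modes differentiated in the direction `k`. -/
def dfld (ω : ι → ℂ) (u : ι → Vec 3 → ℝ) (k : Fin 3) (g : ι → ℝ) (x : Vec 3) : ℂ :=
  fld 0 ω (fun j x => fderiv ℝ (u j) x (Pi.single k 1)) g x

lemma psi_expand (hc : ∀ k, c k ≠ 0 ∧ c k < 1) (κ : ℝ) {ω : ι → ℂ} (hω : ∀ k, ‖ω k‖ = 1)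
    (u : ι → Vec 3 → ℝ) (n : ℕ) :
    psi c κ ω u n = fun x => ∑ f : Fin n → Option ι,
      (∫ g, ∏ l, co κ ω g (f l) ∂(gaussPi c)) * ∏ l, (em u (x l) (f l) : ℂ) := by
  funext x
  unfold psi
  simp_rw [fld_eq]
  exact integral_prod_expand hc κ hω (fun l o => (em u (x l) o : ℂ))

omit [Fintype ι] in
lemma contDiff_em {u : ι → Vec 3 → ℝ} (hu : ∀ k, ContDiff ℝ (⊤ : ℕ∞) (u k)) (o : Option ι) :
    ContDiff ℝ (⊤ : ℕ∞) fun x => em u x o := by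
  rcases o with _ | k
  · exact contDiff_const
  · exact hu k

lemma contDiff_psi (hc : ∀ k, c k ≠ 0 ∧ c k < 1) (κ : ℝ) {ω : ι → ℂ} (hω : ∀ k, ‖ω k‖ = 1)
    {u : ι → Vec 3 → ℝ} (hu : ∀ k, ContDiff ℝ (⊤ : ℕ∞) (u k)) (n : ℕ) :
    ContDiff ℝ (⊤ : ℕ∞) (psi c κ ω u n) := by
  rw [psi_expand hc κ hω]
  refine ContDiff.sum fun f _ => contDiff_const.mul (contDiff_prod fun l _ => ?_)
  exact Complex.ofRealCLM.contDiff.comp ((contDiff_em hu (f l)).comp (contDiff_apply ℝ (Vec 3) l))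

lemma psi_periodic (κ : ℝ) (ω : ι → ℂ) {u : ι → Vec 3 → ℝ} {T : ℝ}
    (hu : ∀ k x (v : Fin 3 → ℤ), u k (fun j => x j + T * v j) = u k x) (n : ℕ)
    (x : Fin n → Vec 3) (v : Fin n → Fin 3 → ℤ) :
    psi c κ ω u n (fun i k => x i k + T * v i k) = psi c κ ω u n x := by
  unfold psi fld
  simp_rw [hu]

lemma psi_symm (κ : ℝ) (ω : ι → ℂ) (u : ι → Vec 3 → ℝ) (n : ℕ) (σ : Equiv.Perm (Fin n))
    (x : Fin n → Vec 3) : psi c κ ω u n (x ∘ σ) = psi c κ ω u n x := by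
  unfold psi
  congr 1; ext g
  exact Equiv.prod_comp σ (fun l => fld κ ω u g (x l))

lemma fderiv_psi (hc : ∀ k, c k ≠ 0 ∧ c k < 1) (κ : ℝ) {ω : ι → ℂ} (hω : ∀ k, ‖ω k‖ = 1)
    {u : ι → Vec 3 → ℝ} (hu : ∀ k, ContDiff ℝ (⊤ : ℕ∞) (u k)) {n : ℕ} (x : Fin n → Vec 3)
    (i : Fin n) (k : Fin 3) :
    fderiv ℝ (psi c κ ω u n) x (Pi.single i (Pi.single k 1)) =
      ∫ g, ∏ l, (if l = i then dfld ω u k else fld κ ω u) g (x l) ∂(gaussPi c) := by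
  set dem : Vec 3 → Option ι → ℝ := fun y o => fderiv ℝ (fun x => em u x o) y (Pi.single k 1)
    with hdem
  have hd : ∀ g y, dfld ω u k g y = ∑ o, co κ ω g o * dem y o := by
    intro g y
    simp [dfld, fld, Fintype.sum_option, co, hdem, em]
  have e : ∀ g l, (if l = i then dfld ω u k else fld κ ω u) g (x l) =
      ∑ o, co κ ω g o * (if l = i then (dem (x l) o : ℂ) else em u (x l) o) := by
    intro g l
    split_ifs
    · exact hd g _
    · exact fld_eq κ ω u g _
  simp_rw [e]
  rw [integral_prod_expand hc κ hω, psi_expand hc κ hω]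
  have hE : ∀ (l : Fin n) (o : Option ι), HasFDerivAt (fun x : Fin n → Vec 3 => (em u (x l) o : ℂ))
      (Complex.ofRealCLM.comp ((fderiv ℝ (fun x => em u x o) (x l)).comp
        (ContinuousLinearMap.proj l))) x := by
    intro l o
    refine Complex.ofRealCLM.hasFDerivAt.comp x ?_
    refine HasFDerivAt.comp x (g := fun x => em u x o) ?_ (hasFDerivAt_apply l x)
    exact ((contDiff_em hu o).differentiable (by simp) _).hasFDerivAt
  have hS := HasFDerivAt.fun_sum (u := Finset.univ) fun (f : Fin n → Option ι) _ =>
    (HasFDerivAt.finsetProd (u := Finset.univ) fun l _ => hE l (f l)).const_mul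
      (∫ g, ∏ l, co κ ω g (f l) ∂(gaussPi c))
  rw [hS.fderiv, sum_apply]
  refine Finset.sum_congr rfl fun f _ => ?_
  rw [smul_apply, smul_eq_mul, sum_apply]
  congr 1
  rw [Finset.sum_eq_single i]
  · rw [← Finset.mul_prod_erase _ _ (Finset.mem_univ i)]
    simp only [smul_apply, ContinuousLinearMap.comp_apply,
      ContinuousLinearMap.proj_apply, Pi.single_eq_same, smul_eq_mul, if_true]
    rw [mul_comm]
    congr 1
    refine Finset.prod_congr rfl fun l hl => ?_
    rw [if_neg (Finset.ne_of_mem_erase hl)]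
  · intro l _ hl
    simp [hl]
  · simp

end

section
open ProbabilityTheory ComplexConjugate

lemma lintegral_normSq_superposition {Ω X : Type*} [MeasurableSpace Ω] [MeasurableSpace X]
    {P : Measure Ω} [SFinite P] {ν : Measure X} [IsFiniteMeasure ν]
    {F : Ω → X → ℂ} (hF : Measurable (Function.uncurry F)) {h : Ω → ℝ} (hh : Integrable h P)
    (hFh : ∀ g x, ‖F g x‖ ≤ h g) {w : X → ℝ} (hw : Measurable w) (hw0 : ∀ x, 0 ≤ w x) {M : ℝ}
    (hM : ∀ x, w x ≤ M) :
    ∃ r : ℝ, 0 ≤ r ∧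
      ∫⁻ x, ENNReal.ofReal (w x) * (‖∫ g, F g x ∂P‖₊ : ℝ≥0∞) ^ 2 ∂ν = ENNReal.ofReal r ∧
      (r : ℂ) = ∫ z, ∫ x, (w x : ℂ) * (F z.1 x * conj (F z.2 x)) ∂ν ∂(P.prod P) := by
  refine ⟨∫ x, w x * ‖∫ g, F g x ∂P‖ ^ 2 ∂ν,
    integral_nonneg fun x => mul_nonneg (hw0 x) (by positivity), ?_,
    integral_normSq_superposition hF hh hFh hw
      (M := M) (fun x => by rw [abs_of_nonneg (hw0 x)]; exact hM x)⟩
  have hm : StronglyMeasurable fun x => ∫ g, F g x ∂P :=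
    StronglyMeasurable.integral_prod_right (f := fun (x : X) (g : Ω) => F g x)
      (hF.comp measurable_swap).stronglyMeasurable
  rw [ofReal_integral_eq_lintegral_ofReal]
  · refine lintegral_congr fun x => ?_
    rw [ENNReal.ofReal_mul (hw0 x), ENNReal.ofReal_pow (norm_nonneg _), ofReal_norm]
    rfl
  · refine (integrable_const (M * (∫ g, h g ∂P) ^ 2)).mono' ?_ (ae_of_all _ fun x => ?_)
    · exact hw.aestronglyMeasurable.mul (hm.norm.pow 2).aestronglyMeasurable
    · rw [norm_mul, norm_pow, norm_norm, Real.norm_of_nonneg (hw0 x)]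
      have h1 : ‖∫ g, F g x ∂P‖ ≤ ∫ g, h g ∂P :=
        norm_integral_le_of_norm_le hh (ae_of_all _ fun g => hFh g x)
      have := (hw0 x).trans (hM x)
      have := hM x
      gcongr
  · exact ae_of_all _ fun x => mul_nonneg (hw0 x) (by positivity)

/-- Lebesgue measure on the one-particle box. -/
def boxM (T : ℝ) : Measure (Vec 3) := volume.restrict (Set.univ.pi fun _ => Set.Icc (-T/2) (T/2))

instance (T : ℝ) : IsFiniteMeasure (boxM T) := by
  unfold boxM
  exact ⟨by
    rw [Measure.restrict_apply_univ]
    exact (isCompact_univ_pi fun _ => isCompact_Icc).measure_lt_top⟩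

lemma restrict_box (n : ℕ) (T : ℝ) :
    (volume : Measure (Fin n → Vec 3)).restrict (box 3 n T) = Measure.pi fun _ => boxM T := by
  have : box 3 n T = Set.univ.pi fun _ => Set.univ.pi fun _ => Set.Icc (-T/2) (T/2) := by
    ext x; simp only [box, Set.mem_ofPred_eq, Set.mem_pi, Set.mem_univ, true_imp_iff]
  rw [this, volume_pi, Measure.restrict_pi_pi]
  rfl

variable {ι : Type*} [Fintype ι] {c : ι → ℝ≥0}

lemma continuous_fld (κ : ℝ) (ω : ι → ℂ) {u : ι → Vec 3 → ℝ} (hu : ∀ k, Continuous (u k)) :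
    Continuous fun p : (ι → ℝ) × Vec 3 => fld κ ω u p.1 p.2 := by
  unfold fld
  fun_prop

/-- Smooth, periodic real modes that are orthonormal together with the constants. -/
structure IsModes [DecidableEq ι] (T : ℝ) (u : ι → Vec 3 → ℝ) (ε : ι → ℝ) (U : ℝ) : Prop where
  smooth : ∀ k, ContDiff ℝ (⊤ : ℕ∞) (u k)
  periodic : ∀ k x (v : Fin 3 → ℤ), u k (fun j => x j + T * v j) = u k x
  bound : ∀ k x, |u k x| ≤ U
  dbound : ∀ k j x, |fderiv ℝ (u k) x (Pi.single j 1)| ≤ U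
  mean : ∀ k, ∫ x, u k x ∂(boxM T) = 0
  orth : ∀ k l, ∫ x, u k x * u l x ∂(boxM T) = if k = l then 1 else 0
  dorth : ∀ k l, ∑ j, ∫ x, fderiv ℝ (u k) x (Pi.single j 1) * fderiv ℝ (u l) x (Pi.single j 1)
    ∂(boxM T) = if k = l then ε k else 0

lemma integral_one_boxM {T : ℝ} (hT : 0 < T) : ∫ _, (1 : ℝ) ∂(boxM T) = T ^ 3 := by
  rw [integral_const, smul_eq_mul, mul_one, Measure.real, boxM, Measure.restrict_apply_univ,
    volume_pi_pi]
  simp only [Real.volume_Icc, Finset.prod_const, Finset.card_univ, Fintype.card_fin]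
  rw [show T / 2 - -T / 2 = T by ring, ENNReal.toReal_pow, ENNReal.toReal_ofReal hT.le]

lemma integral_fld_mul_conj {T : ℝ} (κ : ℝ) {ω : ι → ℂ}
    {u : ι → Vec 3 → ℝ} (hu : ∀ k, Continuous (u k)) (g g' : ι → ℝ) :
    ∫ x, fld κ ω u g x * conj (fld κ ω u g' x) ∂(boxM T) =
      ∑ o, ∑ o', co κ ω g o * conj (co κ ω g' o') *
        ((∫ x, em u x o * em u x o' ∂(boxM T) : ℝ) : ℂ) := by
  have hem : ∀ o, Continuous fun x => em u x o := by
    rintro (_ | k)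
    · exact continuous_const
    · exact hu k
  have hintg : ∀ o o' (a : ℂ), Integrable (fun x => a * ((em u x o * em u x o' : ℝ) : ℂ))
      (boxM T) := by
    intro o o' a
    have h1 := hem o
    have h2 := hem o'
    have : Continuous fun x => a * ((em u x o * em u x o' : ℝ) : ℂ) := by fun_prop
    exact this.continuousOn.integrableOn_compact (isCompact_univ_pi fun _ => isCompact_Icc)
  have e : ∀ x, fld κ ω u g x * conj (fld κ ω u g' x) = ∑ o, ∑ o',
      co κ ω g o * conj (co κ ω g' o') * ((em u x o * em u x o' : ℝ) : ℂ) := by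
    intro x
    rw [fld_eq, fld_eq, map_sum, Finset.sum_mul_sum]
    refine Finset.sum_congr rfl fun o _ => Finset.sum_congr rfl fun o' _ => ?_
    rw [map_mul, Complex.conj_ofReal]; push_cast; ring
  simp_rw [e]
  rw [integral_finsetSum _ fun o _ => integrable_finsetSum _ fun o' _ => hintg o o' _]
  refine Finset.sum_congr rfl fun o _ => ?_
  rw [integral_finsetSum _ fun o' _ => hintg o o' _]
  refine Finset.sum_congr rfl fun o' _ => ?_
  rw [integral_const_mul, integral_complex_ofReal]

variable [DecidableEq ι]

lemma integral_fld_overlap {T : ℝ} (hT : 0 < T) (κ : ℝ) {ω : ι → ℂ} (hω : ∀ k, ‖ω k‖ = 1)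
    {u : ι → Vec 3 → ℝ} {ε : ι → ℝ} {U : ℝ} (hu : IsModes T u ε U) (z : (ι → ℝ) × (ι → ℝ)) :
    ∫ x, fld κ ω u z.1 x * conj (fld κ ω u z.2 x) ∂(boxM T) = overlap (κ ^ 2 * T ^ 3) z := by
  rw [integral_fld_mul_conj κ fun k => (hu.smooth k).continuous]
  simp only [Fintype.sum_option, em, co, one_mul, mul_one, hu.mean, hu.orth, integral_one_boxM hT]
  simp only [Complex.ofReal_zero, mul_zero, Finset.sum_const_zero, add_zero, zero_add,
    apply_ite Complex.ofReal, Complex.ofReal_one, mul_ite, mul_one, Finset.sum_ite_eq,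
    Finset.mem_univ, if_true, overlap, Complex.conj_ofReal]
  push_cast
  congr 1
  · ring
  · refine Finset.sum_congr rfl fun k _ => ?_
    have : ω k * conj (ω k) = 1 := by
      rw [Complex.mul_conj, Complex.normSq_eq_norm_sq, hω]; simp
    rw [map_mul, Complex.conj_ofReal]
    linear_combination (z.1 k * z.2 k : ℂ) * this

/-- The kinetic symbol of two coherent fields. -/
def kinS (ε : ι → ℝ) (z : (ι → ℝ) × (ι → ℝ)) : ℝ := ∑ k, ε k * (z.1 k * z.2 k)

lemma integral_dfld {T : ℝ} {ω : ι → ℂ} (hω : ∀ k, ‖ω k‖ = 1)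
    {u : ι → Vec 3 → ℝ} {ε : ι → ℝ} {U : ℝ} (hu : IsModes T u ε U) (z : (ι → ℝ) × (ι → ℝ)) :
    ∑ j, ∫ x, dfld ω u j z.1 x * conj (dfld ω u j z.2 x) ∂(boxM T) = kinS ε z := by
  have hcd : ∀ j k, Continuous fun x => fderiv ℝ (u k) x (Pi.single j 1) := fun j k =>
    ((hu.smooth k).continuous_fderiv (by simp)).clm_apply continuous_const
  unfold dfld
  simp_rw [fun j => integral_fld_mul_conj (T := T) 0 (ω := ω) (hcd j) z.1 z.2]
  simp only [Fintype.sum_option, em, co, Complex.ofReal_zero, zero_mul, map_zero, mul_zero,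
    Finset.sum_const_zero, zero_add]
  rw [Finset.sum_comm]
  unfold kinS
  push_cast
  refine Finset.sum_congr rfl fun k _ => ?_
  rw [Finset.sum_comm]
  have := fun l => hu.dorth k l
  simp_rw [← Finset.mul_sum, ← Complex.ofReal_sum, this]
  simp only [apply_ite Complex.ofReal, Complex.ofReal_zero, mul_ite, mul_zero, Finset.sum_ite_eq,
    Finset.mem_univ, if_true]
  have : ω k * conj (ω k) = 1 := by
    rw [Complex.mul_conj, Complex.normSq_eq_norm_sq, hω]; simp
  rw [map_mul, Complex.conj_ofReal]
  linear_combination (z.1 k * z.2 k * ε k : ℂ) * this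

/-- The interaction symbol of two coherent fields. -/
def intS (T κ : ℝ) (ω : ι → ℂ) (u : ι → Vec 3 → ℝ) (v : Vec 3 → ℝ) (z : (ι → ℝ) × (ι → ℝ)) : ℂ :=
  ∫ p, (v (p.1 - p.2) : ℂ) * ((fld κ ω u z.1 p.1 * conj (fld κ ω u z.2 p.1)) *
    (fld κ ω u z.1 p.2 * conj (fld κ ω u z.2 p.2))) ∂((boxM T).prod (boxM T))

section energies
variable {T κ : ℝ} {ω : ι → ℂ} {u : ι → Vec 3 → ℝ} {ε : ι → ℝ} {U : ℝ}

omit [DecidableEq ι] in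
lemma prod_superposition (hc : ∀ k, c k ≠ 0 ∧ c k < 1) {n : ℕ}
    {G : Fin n → (ι → ℝ) → Vec 3 → ℂ} (hG : ∀ l, Continuous fun p : (ι → ℝ) × Vec 3 => G l p.1 p.2)
    {K : ℝ} (hK : 0 ≤ K) (hb : ∀ l g x, ‖G l g x‖ ≤ gb K g) {w : (Fin n → Vec 3) → ℝ}
    (hw : Measurable w) (hw0 : ∀ x, 0 ≤ w x) {M : ℝ} (hM : ∀ x, w x ≤ M) :
    ∃ r : ℝ, 0 ≤ r ∧ ∫⁻ x in box 3 n T, ENNReal.ofReal (w x) *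
        (‖∫ g, ∏ l, G l g (x l) ∂(gaussPi c)‖₊ : ℝ≥0∞) ^ 2 = ENNReal.ofReal r ∧
      (r : ℂ) = ∫ z, ∫ x, (w x : ℂ) * ∏ l, (G l z.1 (x l) * conj (G l z.2 (x l)))
        ∂(Measure.pi fun _ : Fin n => boxM T) ∂((gaussPi c).prod (gaussPi c)) := by
  obtain ⟨r, h0, h1, h2⟩ := lintegral_normSq_superposition (P := gaussPi c)
    (ν := Measure.pi fun _ : Fin n => boxM T)
    (F := fun g x => ∏ l, G l g (x l)) (w := w) (M := M) (h := fun g => gb K g ^ n)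
    (Continuous.measurable (by
      unfold Function.uncurry
      refine continuous_finsetProd _ fun l _ => ?_
      exact (hG l).comp
        (by fun_prop : Continuous fun p : (ι → ℝ) × (Fin n → Vec 3) => (p.1, p.2 l))))
    (integrable_gb_pow hc hK n)
    (fun g x => by
      rw [norm_prod]
      refine (Finset.prod_le_prod (fun _ _ => norm_nonneg _) (fun l _ => hb l g (x l))).trans ?_
      simp) hw hw0 hM
  refine ⟨r, h0, ?_, ?_⟩
  · rw [restrict_box, ← h1]
  · rw [h2]
    simp only [map_prod, ← Finset.prod_mul_distrib]

omit [DecidableEq ι] in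
lemma integrable_polyEval_only (hc : ∀ k, c k ≠ 0 ∧ c k < 1) (p : MvPolynomial (ι ⊕ ι) ℂ) :
    Integrable (polyEval p) ((gaussPi c).prod (gaussPi c)) :=
  (integrable_polyEval hc p).mono' (continuous_polyEval _).aestronglyMeasurable
    (ae_of_all _ fun _ => le_mul_of_one_le_right (norm_nonneg _)
      (Real.one_le_exp (by positivity)))

lemma norm_psi (hc : ∀ k, c k ≠ 0 ∧ c k < 1) (hT : 0 < T) (hω : ∀ k, ‖ω k‖ = 1)
    (hu : IsModes T u ε U) (n : ℕ) :
    ∃ r : ℝ, 0 ≤ r ∧ ∫⁻ x in box 3 n T, (‖psi c κ ω u n x‖₊ : ℝ≥0∞) ^ 2 = ENNReal.ofReal r ∧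
      (r : ℂ) = ∫ z, (overlap (κ ^ 2 * T ^ 3) z : ℂ) ^ n ∂((gaussPi c).prod (gaussPi c)) := by
  obtain ⟨r, h0, h1, h2⟩ := prod_superposition (T := T) hc (G := fun _ : Fin n => fld κ ω u)
    (fun _ => continuous_fld κ ω (fun k => (hu.smooth k).continuous)) (K := |κ| + |U|)
    (by positivity) (fun _ g x => norm_fld_le hω (K := |κ| + |U|) (by simp)
      (fun k => (hu.bound k _).trans ((le_abs_self U).trans (by simp))) g)
    (w := fun _ => 1) measurable_const (fun _ => zero_le_one) (fun _ => le_rfl)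
  refine ⟨r, h0, ?_, ?_⟩
  · rw [← h1]
    simp [psi]
  · rw [h2]
    refine integral_congr_ae (ae_of_all _ fun z => ?_)
    simp only [Complex.ofReal_one, one_mul]
    rw [integral_fintype_prod_eq_prod (fun (_ : Fin n) x =>
      fld κ ω u z.1 x * conj (fld κ ω u z.2 x))]
    simp [integral_fld_overlap hT κ hω hu]

omit [Fintype ι] in
lemma continuous_dmode (hu : IsModes T u ε U) (j : Fin 3) (k : ι) :
    Continuous fun x => fderiv ℝ (u k) x (Pi.single j 1) :=
  ((hu.smooth k).continuous_fderiv (by simp)).clm_apply continuous_const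

lemma kinetic_psi_aux (hc : ∀ k, c k ≠ 0 ∧ c k < 1) (hT : 0 < T) (hω : ∀ k, ‖ω k‖ = 1)
    (hu : IsModes T u ε U) (n : ℕ) (i : Fin (n + 1)) (j : Fin 3) :
    ∃ r : ℝ, 0 ≤ r ∧ ∫⁻ x in box 3 (n + 1) T,
      (‖fderiv ℝ (psi c κ ω u (n + 1)) x (Pi.single i (Pi.single j 1))‖₊ : ℝ≥0∞) ^ 2 =
        ENNReal.ofReal r ∧ (r : ℂ) = ∫ z, (∫ x, dfld ω u j z.1 x * conj (dfld ω u j z.2 x)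
          ∂(boxM T)) * (overlap (κ ^ 2 * T ^ 3) z : ℂ) ^ n ∂((gaussPi c).prod (gaussPi c)) := by
  have hcf := continuous_fld κ ω (fun k => (hu.smooth k).continuous)
  have hcd : Continuous fun p : (ι → ℝ) × Vec 3 => dfld ω u j p.1 p.2 :=
    continuous_fld 0 ω (continuous_dmode hu j)
  obtain ⟨r, h0, h1, h2⟩ := prod_superposition (T := T) hc
    (G := fun l : Fin (n + 1) => if l = i then dfld ω u j else fld κ ω u)
    (fun l => by split_ifs <;> assumption) (K := |κ| + |U|) (by positivity)
    (fun l g x => by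
      split_ifs
      · exact norm_fld_le hω (K := |κ| + |U|) (by rw [abs_zero]; positivity)
          (fun k => (hu.dbound k _ _).trans ((le_abs_self U).trans (by simp))) g
      · exact norm_fld_le hω (K := |κ| + |U|) (by simp) (fun k => (hu.bound k _).trans
          ((le_abs_self U).trans (by simp))) g)
    (w := fun _ => 1) measurable_const (fun _ => zero_le_one) (fun _ => le_rfl)
  refine ⟨r, h0, ?_, ?_⟩
  · rw [← h1]
    simp_rw [fderiv_psi hc κ hω hu.smooth]
    simp
  · rw [h2]
    refine integral_congr_ae (ae_of_all _ fun z => ?_)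
    simp only [Complex.ofReal_one, one_mul]
    have := integral_pi_single (ν := boxM T) i
      (fun x => dfld ω u j z.1 x * conj (dfld ω u j z.2 x))
      (fun x => fld κ ω u z.1 x * conj (fld κ ω u z.2 x))
    rw [integral_fld_overlap hT κ hω hu] at this
    rw [← this]
    congr 1; ext x
    refine Finset.prod_congr rfl fun l _ => ?_
    split_ifs <;> rfl

lemma integrable_dfld_overlap (hc : ∀ k, c k ≠ 0 ∧ c k < 1)
    (hu : IsModes T u ε U) (n : ℕ) (j : Fin 3) :
    Integrable (fun z => (∫ x, dfld ω u j z.1 x * conj (dfld ω u j z.2 x)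
          ∂(boxM T)) * (overlap (κ ^ 2 * T ^ 3) z : ℂ) ^ n) ((gaussPi c).prod (gaussPi c)) := by
  convert integrable_polyEval_only hc
    ((∑ k, ∑ l, MvPolynomial.C (ω k * conj (ω l) * ((∫ x, fderiv ℝ (u k) x
      (Pi.single j 1) * fderiv ℝ (u l) x (Pi.single j 1) ∂(boxM T) : ℝ) : ℂ)) *
      MvPolynomial.X (Sum.inl k) * MvPolynomial.X (Sum.inr l)) *
    (MvPolynomial.C ((κ ^ 2 * T ^ 3 : ℝ) : ℂ) +
      ∑ k, MvPolynomial.X (Sum.inl k) * MvPolynomial.X (Sum.inr k)) ^ n) using 1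
  funext z
  rw [polyEval_mul, polyEval_pow]
  congr 1
  · unfold dfld
    rw [integral_fld_mul_conj (T := T) 0 (ω := ω) (continuous_dmode hu j) z.1 z.2]
    simp only [Fintype.sum_option, em, co, Complex.ofReal_zero, zero_mul, map_zero, mul_zero,
      Finset.sum_const_zero, zero_add, polyEval, map_sum, map_mul, MvPolynomial.eval_C,
      MvPolynomial.eval_X, Sum.elim_inl, Sum.elim_inr, Complex.conj_ofReal]
    refine Finset.sum_congr rfl fun k _ => Finset.sum_congr rfl fun l _ => by ring
  · simp [polyEval, overlap]

lemma kinetic_psi (hc : ∀ k, c k ≠ 0 ∧ c k < 1) (hT : 0 < T) (hω : ∀ k, ‖ω k‖ = 1)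
    (hu : IsModes T u ε U) (n : ℕ) :
    ∃ r : ℝ, 0 ≤ r ∧ kineticE 3 (n + 1) T (psi c κ ω u (n + 1)) = ENNReal.ofReal r ∧
      (r : ℂ) = (n + 1) * ∫ z, (kinS ε z : ℂ) * (overlap (κ ^ 2 * T ^ 3) z : ℂ) ^ n
        ∂((gaussPi c).prod (gaussPi c)) := by
  choose r h0 h1 h2 using kinetic_psi_aux (κ := κ) hc hT hω hu n
  refine ⟨∑ i, ∑ j, r i j, Finset.sum_nonneg fun i _ => Finset.sum_nonneg fun j _ => h0 i j,
    ?_, ?_⟩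
  · unfold kineticE
    simp_rw [h1]
    rw [ENNReal.ofReal_sum_of_nonneg fun i _ => Finset.sum_nonneg fun j _ => h0 i j]
    refine Finset.sum_congr rfl fun i _ => ?_
    rw [ENNReal.ofReal_sum_of_nonneg fun j _ => h0 i j]
  · push_cast
    simp_rw [h2]
    rw [Finset.sum_const, Finset.card_univ, Fintype.card_fin, nsmul_eq_mul,
      ← integral_finsetSum _ fun j _ => integrable_dfld_overlap hc hu n j]
    push_cast
    congr 2; ext z
    rw [← Finset.sum_mul, integral_dfld hω hu]

lemma inter_psi (hc : ∀ k, c k ≠ 0 ∧ c k < 1) (hT : 0 < T) (hω : ∀ k, ‖ω k‖ = 1)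
    (hu : IsModes T u ε U) {V : Vec 3 → ℝ≥0∞} {v : Vec 3 → ℝ} (hv : Measurable v)
    (hv0 : ∀ x, 0 ≤ v x) {M : ℝ} (hM : ∀ x, v x ≤ M)
    (hVv : ∀ x, periodize 3 V T x = ENNReal.ofReal (v x)) (n : ℕ) :
    ∃ r : ℝ, 0 ≤ r ∧ interE 3 (n + 2) T V (psi c κ ω u (n + 2)) = ENNReal.ofReal r ∧
      (r : ℂ) = (n + 2) * (n + 1) / 2 * ∫ z, intS T κ ω u v z *
        (overlap (κ ^ 2 * T ^ 3) z : ℂ) ^ n ∂((gaussPi c).prod (gaussPi c)) := by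
  have key : ∀ i j : Fin (n + 2), ∃ r : ℝ, 0 ≤ r ∧ (i ≠ j → ∫⁻ x in box 3 (n + 2) T,
      periodize 3 V T (fun k => x i k - x j k) * (‖psi c κ ω u (n + 2) x‖₊ : ℝ≥0∞) ^ 2 =
        ENNReal.ofReal r ∧ (r : ℂ) = ∫ z, intS T κ ω u v z *
        (overlap (κ ^ 2 * T ^ 3) z : ℂ) ^ n ∂((gaussPi c).prod (gaussPi c))) := by
    intro i j
    by_cases hij : i = j
    · exact ⟨0, le_rfl, fun h => absurd hij h⟩
    obtain ⟨r, h0, h1, h2⟩ := prod_superposition (T := T) hc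
      (G := fun _ : Fin (n + 2) => fld κ ω u)
      (fun _ => continuous_fld κ ω (fun k => (hu.smooth k).continuous)) (K := |κ| + |U|)
      (by positivity) (fun _ g x => norm_fld_le hω (K := |κ| + |U|) (by simp)
        (fun k => (hu.bound k _).trans ((le_abs_self U).trans (by simp))) g)
      (w := fun x => v (x i - x j)) (hv.comp (by fun_prop)) (fun _ => hv0 _) (fun _ => hM _)
    refine ⟨r, h0, fun _ => ⟨?_, ?_⟩⟩
    · rw [← h1]
      refine lintegral_congr fun x => ?_
      rw [hVv]
      rfl
    · rw [h2]
      refine integral_congr_ae (ae_of_all _ fun z => ?_)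
      have := integral_pi_pair (ν := boxM T) hij (fun a b => (v (a - b) : ℂ))
        (fun x => fld κ ω u z.1 x * conj (fld κ ω u z.2 x))
      rw [integral_fld_overlap hT κ hω hu] at this
      exact this
  choose r h0 hr using key
  refine ⟨∑ i, ∑ j, if i < j then r i j else 0, Finset.sum_nonneg fun i _ =>
    Finset.sum_nonneg fun j _ => by split_ifs <;> simp [h0], ?_, ?_⟩
  · unfold interE
    rw [ENNReal.ofReal_sum_of_nonneg fun i _ => Finset.sum_nonneg fun j _ => by
      split_ifs <;> simp [h0]]
    refine Finset.sum_congr rfl fun i _ => ?_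
    rw [ENNReal.ofReal_sum_of_nonneg fun j _ => by split_ifs <;> simp [h0]]
    refine Finset.sum_congr rfl fun j _ => ?_
    split_ifs with h
    · exact (hr i j h.ne).1
    · simp
  · set I := ∫ z, intS T κ ω u v z * (overlap (κ ^ 2 * T ^ 3) z : ℂ) ^ n
      ∂((gaussPi c).prod (gaussPi c))
    push_cast
    have : ∀ i j : Fin (n + 2), ((if i < j then r i j else 0 : ℝ) : ℂ) =
        if i < j then I else 0 := by
      intro i j
      split_ifs with h
      · exact (hr i j h.ne).2
      · simp
    simp_rw [this]
    have hcount : ∀ m : ℕ, ∑ i : Fin m, ∑ j : Fin m, (if i < j then I else 0) =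
        (m : ℂ) * (m - 1) / 2 * I := by
      intro m
      induction m with
      | zero => simp
      | succ m ih =>
        rw [Fin.sum_univ_succ]
        simp_rw [Fin.sum_univ_succ (n := m)]
        simp only [Fin.succ_lt_succ_iff]
        simp only [lt_self_iff_false, if_false, Fin.succ_pos, if_true, Fin.not_lt_zero,
          Finset.sum_const, Finset.card_univ, Fintype.card_fin, nsmul_eq_mul, zero_add]
        rw [ih]
        push_cast
        ring
    rw [hcount]
    push_cast
    ring
end energies

end

section
/-- Admissible but not necessarily normalised states. -/
structure IsState (N : ℕ) (T : ℝ) (ψ : (Fin N → Vec 3) → ℂ) : Prop where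
  smooth : ContDiff ℝ (⊤ : ℕ∞) ψ
  periodic : ∀ (x : Fin N → Vec 3) (v : Fin N → Fin 3 → ℤ),
    ψ (fun i k => x i k + T * v i k) = ψ x
  symm : ∀ (σ : Equiv.Perm (Fin N)) (x : Fin N → Vec 3), ψ (x ∘ σ) = ψ x

lemma gsEnergy_nonneg (N : ℕ) (T : ℝ) (V : Vec 3 → ℝ≥0∞) : 0 ≤ gsEnergy 3 N T V :=
  Real.sInf_nonneg (by rintro _ ⟨ψ, _, _, rfl⟩; exact ENNReal.toReal_nonneg)

lemma normSq_ne_top {N : ℕ} {T : ℝ} {ψ : (Fin N → Vec 3) → ℂ} (h : IsState N T ψ) :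
    ∫⁻ x in box 3 N T, (‖ψ x‖₊ : ℝ≥0∞) ^ 2 ≠ ⊤ := by
  have hc : IsCompact (box 3 N T) := by
    have : box 3 N T = Set.univ.pi fun _ => Set.univ.pi fun _ => Set.Icc (-T/2) (T/2) := by
      ext x; simp only [box, Set.mem_ofPred_eq, Set.mem_pi, Set.mem_univ, true_imp_iff]
    rw [this]
    exact isCompact_univ_pi fun _ => isCompact_univ_pi fun _ => isCompact_Icc
  have hi : IntegrableOn (fun x => ‖ψ x‖ ^ 2) (box 3 N T) :=
    (h.smooth.continuous.norm.pow 2).continuousOn.integrableOn_compact hc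
  have := hi.2.ne
  refine fun h => this ?_
  rw [← h]
  refine lintegral_congr fun x => ?_
  rw [enorm_pow, enorm_norm]; rfl

lemma gsEnergy_mul_le {N : ℕ} {T : ℝ} {V : Vec 3 → ℝ≥0∞} {ψ : (Fin N → Vec 3) → ℂ}
    (h : IsState N T ψ) :
    ENNReal.ofReal (gsEnergy 3 N T V) * ∫⁻ x in box 3 N T, (‖ψ x‖₊ : ℝ≥0∞) ^ 2 ≤
      kineticE 3 N T ψ + interE 3 N T V ψ := by
  set m := ∫⁻ x in box 3 N T, (‖ψ x‖₊ : ℝ≥0∞) ^ 2 with hm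
  have hmt : m ≠ ⊤ := normSq_ne_top h
  by_cases hE : kineticE 3 N T ψ + interE 3 N T V ψ = ⊤
  · rw [hE]; exact le_top
  by_cases hm0 : m = 0
  · rw [hm0, mul_zero]; exact zero_le
  have hmr : 0 < m.toReal := ENNReal.toReal_pos hm0 hmt
  set s : ℝ := (√m.toReal)⁻¹ with hs
  have hs0 : 0 < s := by positivity
  have hss : s ^ 2 = m.toReal⁻¹ := by rw [hs, inv_pow, Real.sq_sqrt hmr.le]
  have hsE : ((‖(s : ℂ)‖₊ : ℝ≥0∞)) ^ 2 = m⁻¹ := by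
    rw [← ENNReal.ofReal_toReal hmt, ← ENNReal.ofReal_inv_of_pos hmr, ← hss,
      ENNReal.ofReal_pow hs0.le, ← Real.enorm_of_nonneg hs0.le]
    congr 1
    simp [enorm]
  set φ : (Fin N → Vec 3) → ℂ := fun x => (s : ℂ) * ψ x with hφ
  have hn : ∀ x, (‖φ x‖₊ : ℝ≥0∞) ^ 2 = m⁻¹ * (‖ψ x‖₊ : ℝ≥0∞) ^ 2 := by
    intro x; rw [← hsE, hφ, nnnorm_mul, ENNReal.coe_mul, mul_pow]
  have hmi : m⁻¹ ≠ ⊤ := ENNReal.inv_ne_top.mpr hm0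
  have hkin : kineticE 3 N T φ = m⁻¹ * kineticE 3 N T ψ := by
    unfold kineticE
    rw [Finset.mul_sum]
    refine Finset.sum_congr rfl fun i _ => ?_
    rw [Finset.mul_sum]
    refine Finset.sum_congr rfl fun k _ => ?_
    rw [← lintegral_const_mul' _ _ hmi]
    refine lintegral_congr fun x => ?_
    have : fderiv ℝ φ x = (s : ℂ) • fderiv ℝ ψ x :=
      fderiv_const_mul (h.smooth.differentiable (by simp) x) _
    rw [this, ← hsE]
    rw [smul_apply, nnnorm_smul, ENNReal.coe_mul, mul_pow]
  have hintg : interE 3 N T V φ = m⁻¹ * interE 3 N T V ψ := by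
    unfold interE
    rw [Finset.mul_sum]
    refine Finset.sum_congr rfl fun i _ => ?_
    rw [Finset.mul_sum]
    refine Finset.sum_congr rfl fun k _ => ?_
    split_ifs
    · rw [← lintegral_const_mul' _ _ hmi]
      refine lintegral_congr fun x => ?_
      rw [hn]; ring
    · simp
  have htrial : IsTrialState 3 N T φ := by
    refine ⟨contDiff_const.mul h.smooth, fun x v => ?_, fun σ x => ?_, ?_⟩
    · simp only [hφ, h.periodic]
    · simp only [hφ, h.symm]
    · simp_rw [hn]
      rw [lintegral_const_mul' _ _ hmi]
      exact ENNReal.inv_mul_cancel hm0 hmt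
  have hsum : kineticE 3 N T φ + interE 3 N T V φ =
      m⁻¹ * (kineticE 3 N T ψ + interE 3 N T V ψ) := by rw [hkin, hintg, mul_add]
  have hle : gsEnergy 3 N T V ≤ (m⁻¹ * (kineticE 3 N T ψ + interE 3 N T V ψ)).toReal := by
    refine csInf_le ⟨0, ?_⟩ ⟨φ, htrial, ?_, by rw [hsum]⟩
    · rintro _ ⟨ψ, _, _, rfl⟩; exact ENNReal.toReal_nonneg
    · rw [hsum]; exact ENNReal.mul_ne_top hmi hE
  have h2 := ENNReal.ofReal_le_ofReal hle
  rw [ENNReal.ofReal_toReal (ENNReal.mul_ne_top hmi hE)] at h2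
  calc _ ≤ m⁻¹ * (kineticE 3 N T ψ + interE 3 N T V ψ) * m := by gcongr
    _ = (m⁻¹ * m) * (kineticE 3 N T ψ + interE 3 N T V ψ) := by ring
    _ = _ := by rw [ENNReal.inv_mul_cancel hm0 hmt, one_mul]

lemma lintegral_box_succ {n : ℕ} {T : ℝ} {f : (Fin (n + 1) → Vec 3) → ℝ≥0∞} (hf : Measurable f) :
    ∫⁻ x in box 3 (n + 1) T, f x =
      ∫⁻ y, (∫⁻ x in box 3 n T, f (Fin.cons y x)) ∂(boxM T) := by
  simp_rw [restrict_box]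
  have e1 := (measurePreserving_piFinSuccAbove (fun _ : Fin (n + 1) => boxM T) 0).symm
  rw [← e1.lintegral_comp_emb (MeasurableEquiv.measurableEmbedding _), lintegral_prod]
  · refine lintegral_congr fun y => lintegral_congr fun x => ?_
    congr 1
    ext i
    refine Fin.cases ?_ (fun j => ?_) i <;>
    simp [MeasurableEquiv.piFinSuccAbove]
  · exact (hf.comp (MeasurableEquiv.measurable _)).aemeasurable

lemma isState_cons {n : ℕ} {T : ℝ} {ψ : (Fin (n + 1) → Vec 3) → ℂ} (h : IsState (n + 1) T ψ)
    (y : Vec 3) : IsState n T fun x => ψ (Fin.cons y x) := by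
  refine ⟨h.smooth.comp ?_, fun x v => ?_, fun σ x => ?_⟩
  · refine contDiff_pi.mpr fun i => ?_
    refine Fin.cases ?_ (fun j => ?_) i
    · simp only [Fin.cons_zero]; exact contDiff_const
    · simp only [Fin.cons_succ]; exact contDiff_apply ℝ (Vec 3) j
  · rw [← h.periodic (Fin.cons y x) (Fin.cons 0 v)]
    congr 1
    ext i k
    refine Fin.cases ?_ (fun j => ?_) i <;> simp
  · rw [← h.symm (Equiv.Perm.decomposeFin.symm (0, σ)) (Fin.cons y x)]
    congr 1
    ext i k
    refine Fin.cases ?_ (fun j => ?_) i <;> simp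

lemma fderiv_cons {n : ℕ} {T : ℝ} {ψ : (Fin (n + 1) → Vec 3) → ℂ} (h : IsState (n + 1) T ψ)
    (y : Vec 3) (x : Fin n → Vec 3) (i : Fin n) (w : Vec 3) :
    fderiv ℝ (fun x : Fin n → Vec 3 => ψ (Fin.cons y x)) x (Pi.single i w) =
      fderiv ℝ ψ (Fin.cons y x) (Pi.single i.succ w) := by
  have hc : HasFDerivAt (fun x : Fin n → Vec 3 => (Fin.cons y x : Fin (n + 1) → Vec 3))
      (ContinuousLinearMap.pi (Fin.cons (0 : (Fin n → Vec 3) →L[ℝ] Vec 3)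
        fun i => ContinuousLinearMap.proj i)) x := by
    refine hasFDerivAt_pi.mpr fun j => ?_
    refine Fin.cases ?_ (fun j => ?_) j
    · simp only [Fin.cons_zero]; exact hasFDerivAt_const _ _
    · simp only [Fin.cons_succ]; exact hasFDerivAt_apply j x
  have := ((h.smooth.differentiable (by simp) (Fin.cons y x)).hasFDerivAt).comp x hc
  have e := this.fderiv
  have e' : (fun x : Fin n → Vec 3 => ψ (Fin.cons y x)) =
    ψ ∘ fun x : Fin n → Vec 3 => (Fin.cons y x : Fin (n + 1) → Vec 3) := rfl
  rw [e', e, ContinuousLinearMap.comp_apply]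
  congr 1
  ext j k
  refine Fin.cases ?_ (fun j => ?_) j
  · simp
  · by_cases hj : j = i
    · subst hj; simp
    · simp [hj]

lemma measurable_periodize {V : Vec 3 → ℝ≥0∞} (hV : Measurable V) (T : ℝ) :
    Measurable (periodize 3 V T) := by
  unfold periodize
  exact Measurable.tsum fun n => hV.comp (by fun_prop)

lemma gsEnergy_mul_le_of_le {N : ℕ} {T : ℝ} {V : Vec 3 → ℝ≥0∞} (hV : Measurable V) {n : ℕ}
    (hn : N ≤ n) : ∀ {ψ : (Fin n → Vec 3) → ℂ}, IsState n T ψ →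
    ENNReal.ofReal (gsEnergy 3 N T V) * ∫⁻ x in box 3 n T, (‖ψ x‖₊ : ℝ≥0∞) ^ 2 ≤
      kineticE 3 n T ψ + interE 3 n T V ψ := by
  induction n, hn using Nat.le_induction with
  | base => exact gsEnergy_mul_le
  | succ n hn ih =>
    intro ψ h
    have hcont := h.smooth.continuous
    have hdm : ∀ w, Measurable fun x => (‖fderiv ℝ ψ x w‖₊ : ℝ≥0∞) ^ 2 := fun w =>
      (((h.smooth.continuous_fderiv (by simp)).clm_apply
        continuous_const).nnnorm.measurable.coe_nnreal_ennreal).pow_const 2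
    have hpm : Measurable fun x => (‖ψ x‖₊ : ℝ≥0∞) ^ 2 :=
      (hcont.nnnorm.measurable.coe_nnreal_ennreal).pow_const 2
    have hVm : ∀ i j : Fin (n + 1), Measurable fun x : Fin (n + 1) → Vec 3 =>
        periodize 3 V T (fun k => x i k - x j k) * (‖ψ x‖₊ : ℝ≥0∞) ^ 2 := fun i j =>
      ((measurable_periodize hV T).comp (by fun_prop)).mul hpm
    have mcons : Measurable fun p : Vec 3 × (Fin n → Vec 3) =>
        (Fin.cons p.1 p.2 : Fin (n + 1) → Vec 3) := by
      refine measurable_pi_iff.mpr fun i => ?_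
      refine Fin.cases ?_ (fun j => ?_) i
      · simp only [Fin.cons_zero]; fun_prop
      · simp only [Fin.cons_succ]; fun_prop
    have ms : ∀ {f : (Fin (n + 1) → Vec 3) → ℝ≥0∞}, Measurable f →
        Measurable fun y => ∫⁻ x in box 3 n T, f (Fin.cons y x) := fun hf =>
      (hf.comp mcons).lintegral_prod_right'
    calc _ = ∫⁻ y, ENNReal.ofReal (gsEnergy 3 N T V) *
          (∫⁻ x in box 3 n T, (‖ψ (Fin.cons y x)‖₊ : ℝ≥0∞) ^ 2) ∂(boxM T) := by
          rw [lintegral_box_succ hpm, lintegral_const_mul' _ _ ENNReal.ofReal_ne_top]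
      _ ≤ ∫⁻ y, (kineticE 3 n T (fun x => ψ (Fin.cons y x)) +
          interE 3 n T V (fun x => ψ (Fin.cons y x))) ∂(boxM T) :=
          lintegral_mono fun y => ih (isState_cons h y)
      _ ≤ _ := ?_
    unfold kineticE interE
    simp_rw [fderiv_cons h]
    rw [lintegral_add_left]
    swap
    · exact Finset.measurable_sum _ fun i _ => Finset.measurable_sum _ fun k _ => ms (hdm _)
    refine add_le_add ?_ ?_
    · rw [Fin.sum_univ_succ]
      refine le_add_left ?_
      rw [lintegral_finsetSum _ fun i _ => Finset.measurable_sum _ fun k _ => ms (hdm _)]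
      refine Finset.sum_le_sum fun i _ => ?_
      rw [lintegral_finsetSum _ fun k _ => ms (hdm _)]
      refine Finset.sum_le_sum fun k _ => ?_
      rw [lintegral_box_succ (hdm _)]
    · rw [Fin.sum_univ_succ (n := n)]
      refine le_add_left ?_
      have hm : ∀ i j : Fin n, Measurable fun y => if i < j then ∫⁻ x in box 3 n T,
          periodize 3 V T (fun k => x i k - x j k) * (‖ψ (Fin.cons y x)‖₊ : ℝ≥0∞) ^ 2 else 0 := by
        intro i j
        split_ifs
        · have := ms (hVm i.succ j.succ)
          simpa only [Fin.cons_succ] using this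
        · exact measurable_const
      rw [lintegral_finsetSum _ fun i _ => Finset.measurable_sum _ fun j _ => hm i j]
      refine Finset.sum_le_sum fun i _ => ?_
      rw [Fin.sum_univ_succ (n := n)]
      refine le_add_left ?_
      rw [lintegral_finsetSum _ fun j _ => hm i j]
      refine Finset.sum_le_sum fun j _ => ?_
      simp only [Fin.succ_lt_succ_iff]
      split_ifs with hij
      · rw [lintegral_box_succ (hVm i.succ j.succ)]
        simp only [Fin.cons_succ]
        exact le_rfl
      · simp

end

section
open ComplexConjugate
open MvPolynomial (X C)

section moments
variable {ι : Type*} [Fintype ι] {c : ι → ℝ≥0}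

def fldP (κ : ℝ) (ω : ι → ℂ) (u : ι → Vec 3 → ℝ) (x : Vec 3) : MvPolynomial (ι ⊕ ι) ℂ :=
  aff κ (Sum.elim (fun k => ω k * u k x) 0)

def fldQ (κ : ℝ) (ω : ι → ℂ) (u : ι → Vec 3 → ℝ) (x : Vec 3) : MvPolynomial (ι ⊕ ι) ℂ :=
  aff κ (Sum.elim 0 (fun k => conj (ω k) * u k x))

lemma polyEval_fldP (κ : ℝ) (ω : ι → ℂ) (u : ι → Vec 3 → ℝ) (x : Vec 3)
    (z : (ι → ℝ) × (ι → ℝ)) : polyEval (fldP κ ω u x) z = fld κ ω u z.1 x := by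
  simp only [polyEval, fldP, aff, fld, map_add, map_sum, map_mul, MvPolynomial.eval_C,
    MvPolynomial.eval_X, Fintype.sum_sum_type, Sum.elim_inl, Sum.elim_inr, Pi.zero_apply,
    zero_mul, Finset.sum_const_zero, add_zero]
  congr 1
  exact Finset.sum_congr rfl fun k _ => by ring

lemma polyEval_fldQ (κ : ℝ) (ω : ι → ℂ) (u : ι → Vec 3 → ℝ) (x : Vec 3)
    (z : (ι → ℝ) × (ι → ℝ)) : polyEval (fldQ κ ω u x) z = conj (fld κ ω u z.2 x) := by
  simp only [polyEval, fldQ, aff, fld, map_add, map_sum, map_mul, MvPolynomial.eval_C,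
    MvPolynomial.eval_X, Fintype.sum_sum_type, Sum.elim_inl, Sum.elim_inr, Pi.zero_apply,
    zero_mul, Finset.sum_const_zero, zero_add, Complex.conj_ofReal]
  congr 1
  exact Finset.sum_congr rfl fun k _ => by ring

/-- Weighted two-point sums of the modes. -/
def twoPt (w : ι → ℝ) (u : ι → Vec 3 → ℝ) (x y : Vec 3) : ℝ := ∑ k, w k * (u k x * u k y)

/-- The two-body density of the coherent superposition. -/
def fourPt (κ : ℝ) (α γ : ι → ℝ) (u : ι → Vec 3 → ℝ) (x y : Vec 3) : ℝ :=
  (κ ^ 2 + twoPt α u x y) ^ 2 + 2 * κ ^ 2 * twoPt γ u x y + twoPt γ u x y ^ 2 +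
    κ ^ 2 * (twoPt γ u x x + twoPt γ u y y) + twoPt γ u x x * twoPt γ u y y

lemma wick_fld_four (hc : ∀ k, c k ≠ 0 ∧ c k < 1) (κ : ℝ) {ω : ι → ℂ} (hω : ∀ k, ‖ω k‖ = 1)
    {σ : ι → ℝ} (hσ : ∀ k, ω k * ω k = σ k) (u : ι → Vec 3 → ℝ) (x y : Vec 3) :
    wick c (fldP κ ω u x * (fldQ κ ω u x * (fldP κ ω u y * fldQ κ ω u y))) =
      wick c 1 * fourPt κ (fun k => σ k * covA (c k)) (fun k => covG (c k)) u x y := by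
  unfold fldP fldQ
  have hσ' : ∀ k, conj (ω k) * conj (ω k) = σ k := fun k => by
    rw [← map_mul, hσ, Complex.conj_ofReal]
  have h1 : ∀ k, ω k * conj (ω k) = 1 := fun k => by
    rw [Complex.mul_conj, Complex.normSq_eq_norm_sq, hω]; norm_num
  have ePP : ∀ x y : Vec 3, covB c (Sum.elim (fun k => ω k * u k x) 0)
      (Sum.elim (fun k => ω k * u k y) 0) = twoPt (fun k => σ k * covA (c k)) u x y := by
    intro x y
    simp only [covB, twoPt, Sum.elim_inl, Sum.elim_inr, Pi.zero_apply]
    push_cast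
    refine Finset.sum_congr rfl fun k _ => ?_
    rw [← hσ]; ring
  have eQQ : ∀ x y : Vec 3, covB c (Sum.elim 0 (fun k => conj (ω k) * u k x))
      (Sum.elim 0 (fun k => conj (ω k) * u k y)) = twoPt (fun k => σ k * covA (c k)) u x y := by
    intro x y
    simp only [covB, twoPt, Sum.elim_inl, Sum.elim_inr, Pi.zero_apply]
    push_cast
    refine Finset.sum_congr rfl fun k _ => ?_
    rw [← hσ']; ring
  have ePQ : ∀ x y : Vec 3, covB c (Sum.elim (fun k => ω k * u k x) 0)
      (Sum.elim 0 (fun k => conj (ω k) * u k y)) = twoPt (fun k => covG (c k)) u x y := by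
    intro x y
    simp only [covB, twoPt, Sum.elim_inl, Sum.elim_inr, Pi.zero_apply]
    push_cast
    refine Finset.sum_congr rfl fun k _ => ?_
    linear_combination (covG (c k) * (u k x * u k y) : ℂ) * h1 k
  have eQP : ∀ x y : Vec 3, covB c (Sum.elim 0 (fun k => conj (ω k) * u k x))
      (Sum.elim (fun k => ω k * u k y) 0) = twoPt (fun k => covG (c k)) u x y := by
    intro x y
    simp only [covB, twoPt, Sum.elim_inl, Sum.elim_inr, Pi.zero_apply]
    push_cast
    refine Finset.sum_congr rfl fun k _ => ?_
    linear_combination (covG (c k) * (u k x * u k y) : ℂ) * h1 k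
  rw [wick_aff_four hc, ePP, eQQ, ePQ, ePQ, ePQ, eQP]
  congr 1
  unfold fourPt
  push_cast
  ring

lemma aff_single [DecidableEq ι] (i : ι ⊕ ι) : aff 0 (Pi.single i 1) = X i := by
  simp only [aff, map_zero, zero_add, Pi.single_apply, apply_ite C, map_one, ite_mul, one_mul,
    zero_mul, Finset.sum_ite_eq', Finset.mem_univ, if_true]

lemma wick_pair (hc : ∀ k, c k ≠ 0 ∧ c k < 1) (k : ι) :
    wick c (X (Sum.inl k) * X (Sum.inr k)) = wick c 1 * covG (c k) := by
  classical
  rw [← aff_single, ← aff_single, wick_aff_two hc]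
  congr 1
  simp [covB, Pi.single_apply]

lemma wick_pair_pair [DecidableEq ι] (hc : ∀ k, c k ≠ 0 ∧ c k < 1) (k l : ι) :
    wick c (X (Sum.inl k) * (X (Sum.inr k) * (X (Sum.inl l) * X (Sum.inr l)))) =
      wick c 1 * (covG (c k) * covG (c l) +
        if k = l then (covA (c k) : ℂ) ^ 2 + covG (c k) ^ 2 else 0) := by
  rw [← aff_single, ← aff_single, ← aff_single, ← aff_single, wick_aff_four hc]
  congr 1
  by_cases h : k = l
  · subst h; simp [covB, Pi.single_apply]; ring
  · have h' : l ≠ k := fun h' => h h'.symm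
    simp [covB, Pi.single_apply, h, h']

def ovP (N0 : ℝ) : MvPolynomial (ι ⊕ ι) ℂ := C (N0 : ℂ) * 1 + ∑ k, X (Sum.inl k) * X (Sum.inr k)

lemma polyEval_ovP (N0 : ℝ) (z : (ι → ℝ) × (ι → ℝ)) : polyEval (ovP N0) z = overlap N0 z := by
  simp [polyEval, ovP, overlap]

lemma wick_ovP (hc : ∀ k, c k ≠ 0 ∧ c k < 1) (N0 : ℝ) :
    wick c (ovP N0) = wick c 1 * ((N0 + ∑ k, covG (c k) : ℝ) : ℂ) := by
  rw [ovP, wick_add hc, wick_sum hc, wick_C_mul]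
  simp_rw [wick_pair hc]
  push_cast
  rw [mul_add, Finset.mul_sum, mul_comm]

lemma wick_ovP_sq (hc : ∀ k, c k ≠ 0 ∧ c k < 1) (N0 : ℝ) :
    wick c (ovP N0 * ovP N0) = wick c 1 * (((N0 + ∑ k, covG (c k)) ^ 2 +
      ∑ k, (covA (c k) ^ 2 + covG (c k) ^ 2) : ℝ) : ℂ) := by
  classical
  have h : (ovP N0 * ovP N0 : MvPolynomial (ι ⊕ ι) ℂ) =
      C ((N0 : ℂ)) * ovP N0 + (C (N0 : ℂ) * ∑ k, X (Sum.inl k) * X (Sum.inr k) +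
      ∑ k, ∑ l, X (Sum.inl k) * (X (Sum.inr k) * (X (Sum.inl l) * X (Sum.inr l)))) := by
    have : ∑ k, ∑ l, X (Sum.inl k) * (X (Sum.inr k) * (X (Sum.inl l) * X (Sum.inr l))) =
      (∑ k, X (Sum.inl k) * X (Sum.inr k) : MvPolynomial (ι ⊕ ι) ℂ) *
        ∑ k, X (Sum.inl k) * X (Sum.inr k) := by
      rw [Finset.sum_mul_sum]
      exact Finset.sum_congr rfl fun k _ => Finset.sum_congr rfl fun l _ => by ring
    rw [this]
    unfold ovP; ring
  rw [h, wick_add hc, wick_add hc, wick_C_mul, wick_C_mul, wick_sum hc, wick_sum hc, wick_ovP hc]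
  simp_rw [wick_sum hc, wick_pair_pair hc, wick_pair hc]
  simp_rw [mul_add, Finset.sum_add_distrib, mul_ite, mul_zero, Finset.sum_ite_eq,
    Finset.mem_univ, if_true, ← Finset.mul_sum]
  push_cast
  have hq : ∑ x, (∑ i, (covG (c i) : ℂ)) * covG (c x) = (∑ i, (covG (c i) : ℂ)) ^ 2 := by
    rw [← Finset.mul_sum, sq]
  simp_rw [Finset.sum_add_distrib]
  ring_nf
  rw [hq]

def kinP (ε : ι → ℝ) : MvPolynomial (ι ⊕ ι) ℂ :=
  ∑ k, C (ε k : ℂ) * (X (Sum.inl k) * X (Sum.inr k))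

lemma polyEval_kinP (ε : ι → ℝ) (z : (ι → ℝ) × (ι → ℝ)) : polyEval (kinP ε) z = kinS ε z := by
  simp [polyEval, kinP, kinS]

lemma wick_kinP (hc : ∀ k, c k ≠ 0 ∧ c k < 1) (ε : ι → ℝ) :
    wick c (kinP ε) = wick c 1 * ((∑ k, ε k * covG (c k) : ℝ) : ℂ) := by
  rw [kinP, wick_sum hc]
  simp_rw [wick_C_mul, wick_pair hc]
  push_cast
  rw [Finset.mul_sum]
  exact Finset.sum_congr rfl fun k _ => by ring

lemma integral_polyEval_exp_overlap (N0 : ℝ) (p : MvPolynomial (ι ⊕ ι) ℂ) :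
    ∫ z, polyEval p z * (exp (overlap N0 z) : ℝ) ∂((gaussPi c).prod (gaussPi c)) =
      exp N0 * wick c p := by
  unfold wick overlap
  rw [← integral_const_mul]
  refine integral_congr_ae (ae_of_all _ fun z => ?_)
  simp only [exp_add]; push_cast; ring

variable [DecidableEq ι] {T κ : ℝ} {ω : ι → ℂ} {u : ι → Vec 3 → ℝ} {ε : ι → ℝ} {U : ℝ}

lemma norm_fld_le_modes (hω : ∀ k, ‖ω k‖ = 1) (hu : IsModes T u ε U) (g : ι → ℝ) (x : Vec 3) :
    ‖fld κ ω u g x‖ ≤ gb (|κ| + |U|) g :=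
  norm_fld_le hω (by simp) (fun k => (hu.bound k x).trans
    ((le_abs_self U).trans (le_add_of_nonneg_left (abs_nonneg _)))) g

lemma norm_four_le (hω : ∀ k, ‖ω k‖ = 1) (hu : IsModes T u ε U) {v : Vec 3 → ℝ}
    (hv0 : ∀ x, 0 ≤ v x) {M : ℝ} (hM : ∀ x, v x ≤ M) (z : (ι → ℝ) × (ι → ℝ)) (p : Vec 3 × Vec 3) :
    ‖(v (p.1 - p.2) : ℂ) * ((fld κ ω u z.1 p.1 * conj (fld κ ω u z.2 p.1)) *
    (fld κ ω u z.1 p.2 * conj (fld κ ω u z.2 p.2)))‖ ≤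
      M * (gb (|κ| + |U|) z.1 ^ 2 * gb (|κ| + |U|) z.2 ^ 2) := by
  have hK : 0 ≤ |κ| + |U| := by positivity
  have h1 := gb_nonneg hK z.1
  have h2 := gb_nonneg hK z.2
  have hM0 : 0 ≤ M := (hv0 0).trans (hM 0)
  have hb := fun g x => norm_fld_le_modes (κ := κ) hω hu g x
  rw [norm_mul, norm_mul, norm_mul, norm_mul, RCLike.norm_conj, RCLike.norm_conj,
    Complex.norm_real, Real.norm_of_nonneg (hv0 _)]
  calc _ ≤ M * ((gb (|κ| + |U|) z.1 * gb (|κ| + |U|) z.2) *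
        (gb (|κ| + |U|) z.1 * gb (|κ| + |U|) z.2)) := by
        gcongr
        · exact hM _
        all_goals exact hb _ _
    _ = _ := by ring

lemma continuous_four (hu : IsModes T u ε U) : Continuous
    fun q : ((ι → ℝ) × (ι → ℝ)) × (Vec 3 × Vec 3) =>
      (fld κ ω u q.1.1 q.2.1 * conj (fld κ ω u q.1.2 q.2.1)) *
      (fld κ ω u q.1.1 q.2.2 * conj (fld κ ω u q.1.2 q.2.2)) := by
  have h := continuous_fld κ ω (fun k => (hu.smooth k).continuous)
  have h11 := h.comp (f := fun q : ((ι → ℝ) × (ι → ℝ)) × (Vec 3 × Vec 3) => (q.1.1, q.2.1))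
    (by fun_prop)
  have h21 := h.comp (f := fun q : ((ι → ℝ) × (ι → ℝ)) × (Vec 3 × Vec 3) => (q.1.2, q.2.1))
    (by fun_prop)
  have h12 := h.comp (f := fun q : ((ι → ℝ) × (ι → ℝ)) × (Vec 3 × Vec 3) => (q.1.1, q.2.2))
    (by fun_prop)
  have h22 := h.comp (f := fun q : ((ι → ℝ) × (ι → ℝ)) × (Vec 3 × Vec 3) => (q.1.2, q.2.2))
    (by fun_prop)
  exact (h11.mul (Complex.continuous_conj.comp h21)).mul (h12.mul (Complex.continuous_conj.comp h22))

lemma measurable_four (hu : IsModes T u ε U) {v : Vec 3 → ℝ} (hv : Measurable v) : Measurable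
    fun q : ((ι → ℝ) × (ι → ℝ)) × (Vec 3 × Vec 3) =>
      (v (q.2.1 - q.2.2) : ℂ) * ((fld κ ω u q.1.1 q.2.1 * conj (fld κ ω u q.1.2 q.2.1)) *
      (fld κ ω u q.1.1 q.2.2 * conj (fld κ ω u q.1.2 q.2.2))) :=
  (Complex.measurable_ofReal.comp (hv.comp (by fun_prop))).mul
    (continuous_four hu).measurable

lemma stronglyMeasurable_intS (hu : IsModes T u ε U) {v : Vec 3 → ℝ} (hv : Measurable v) :
    StronglyMeasurable (intS T κ ω u v) :=
  (measurable_four hu hv).stronglyMeasurable.integral_prod_right'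
    (ν := (boxM T).prod (boxM T))

lemma norm_intS_le (hω : ∀ k, ‖ω k‖ = 1) (hu : IsModes T u ε U) {v : Vec 3 → ℝ}
    (hv0 : ∀ x, 0 ≤ v x) {M : ℝ} (hM : ∀ x, v x ≤ M) : ∃ p : MvPolynomial (ι ⊕ ι) ℂ,
    ∀ z, ‖intS T κ ω u v z‖ ≤ ‖polyEval p z‖ := by
  set B := ((boxM T).prod (boxM T)).real Set.univ
  refine ⟨C ((M * B : ℝ) : ℂ) *
    (gbP (|κ| + |U|) Sum.inl ^ 2 * gbP (|κ| + |U|) Sum.inr ^ 2), fun z => ?_⟩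
  have hM0 : 0 ≤ M := (hv0 0).trans (hM 0)
  refine (norm_integral_le_of_norm_le_const (ae_of_all _ fun p =>
    norm_four_le hω hu hv0 hM z p)).trans (le_of_eq ?_)
  rw [polyEval_mul, polyEval_mul, polyEval_pow, polyEval_pow, polyEval_gbP_inl, polyEval_gbP_inr]
  have : polyEval (C ((M * B : ℝ) : ℂ) : MvPolynomial (ι ⊕ ι) ℂ) z = ((M * B : ℝ) : ℂ) := by
    simp [polyEval]
  rw [this, ← Complex.ofReal_pow, ← Complex.ofReal_pow, ← Complex.ofReal_mul,
    ← Complex.ofReal_mul, Complex.norm_real, Real.norm_of_nonneg]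
  · ring
  · have : 0 ≤ B := measureReal_nonneg
    positivity

lemma integral_intS_exp (hc : ∀ k, c k ≠ 0 ∧ c k < 1) (hω : ∀ k, ‖ω k‖ = 1)
    {σ : ι → ℝ} (hσ : ∀ k, ω k * ω k = σ k) (hu : IsModes T u ε U) {v : Vec 3 → ℝ}
    (hv : Measurable v) (hv0 : ∀ x, 0 ≤ v x) {M : ℝ} (hM : ∀ x, v x ≤ M) (N0 : ℝ) :
    ∫ z, intS T κ ω u v z * (exp (overlap N0 z) : ℝ) ∂((gaussPi c).prod (gaussPi c)) =
      exp N0 * (wick c 1 * ((∫ p, v (p.1 - p.2) * fourPt κ (fun k => σ k * covA (c k))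
        (fun k => covG (c k)) u p.1 p.2 ∂((boxM T).prod (boxM T)) : ℝ) : ℂ)) := by
  unfold intS
  simp_rw [← integral_mul_const]
  rw [integral_integral_swap]
  · rw [← integral_complex_ofReal, ← integral_const_mul, ← integral_const_mul]
    refine integral_congr_ae (ae_of_all _ fun p => ?_)
    simp only
    rw [Complex.ofReal_mul, mul_left_comm (wick c 1), ← wick_fld_four hc κ hω hσ, mul_left_comm,
      ← integral_polyEval_exp_overlap, ← integral_const_mul]
    refine integral_congr_ae (ae_of_all _ fun z => ?_)
    simp only [polyEval_mul, polyEval_fldP, polyEval_fldQ]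
    push_cast; ring
  · have hcon := continuous_overlap (ι := ι) N0
    have hI := (integrable_of_le_polyEval hc (Q := polyEval (gbP (|κ| + |U|) Sum.inl ^ 2 *
      gbP (|κ| + |U|) Sum.inr ^ 2)) (continuous_polyEval _).aestronglyMeasurable
      (fun _ => le_rfl) N0).mul_prod (integrable_const M (μ := (boxM T).prod (boxM T)))
    refine hI.mono' ?_ (ae_of_all _ fun q => ?_)
    · exact ((measurable_four hu hv).mul (Complex.measurable_ofReal.comp
        (Real.measurable_exp.comp (hcon.measurable.comp measurable_fst)))).aestronglyMeasurable
    · simp only [Function.uncurry]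
      have hM0 : 0 ≤ M := (hv0 0).trans (hM 0)
      rw [norm_mul, Complex.norm_real, Real.norm_of_nonneg (exp_pos _).le, polyEval_mul,
        polyEval_pow, polyEval_pow, polyEval_gbP_inl, polyEval_gbP_inr, ← Complex.ofReal_pow,
        ← Complex.ofReal_pow, ← Complex.ofReal_mul, Complex.norm_real, Real.norm_of_nonneg
        (by positivity)]
      have h4 := norm_four_le (κ := κ) hω hu hv0 hM q.1 q.2
      have he : exp (overlap N0 q.1) ≤ exp (N0 + ∑ k, |q.1.1 k * q.1.2 k|) := by
        unfold overlap
        gcongr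
        exact le_abs_self _
      calc _ ≤ (M * (gb (|κ| + |U|) q.1.1 ^ 2 * gb (|κ| + |U|) q.1.2 ^ 2)) *
            exp (N0 + ∑ k, |q.1.1 k * q.1.2 k|) := by gcongr
        _ = _ := by ring

end moments

end

section
open ComplexConjugate

section energy
variable {ι : Type*} [Fintype ι] {c : ι → ℝ≥0}
variable [DecidableEq ι] {T κ : ℝ} {ω : ι → ℂ} {u : ι → Vec 3 → ℝ} {ε : ι → ℝ} {U : ℝ}

lemma hasSum_shift {f : ℕ → ℝ} {a : ℝ} (k : ℕ) (h0 : ∀ i < k, f i = 0)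
    (h : HasSum (fun n => f (n + k)) a) : HasSum f a := by
  rw [hasSum_nat_add_iff] at h
  rwa [Finset.sum_eq_zero fun i hi => h0 i (Finset.mem_range.mp hi), add_zero] at h

lemma hasSum_real_of_complex {f : ℕ → ℝ} {g : ℕ → ℂ} {a : ℝ} {b : ℂ} (h : HasSum g b)
    (hf : ∀ n, (f n : ℂ) = g n) (hb : (a : ℂ) = b) : HasSum f a := by
  rw [← Complex.hasSum_ofReal, hb]
  simpa only [hf] using h

omit [DecidableEq ι] in
lemma hasSum_polyEval_overlap (hc : ∀ k, c k ≠ 0 ∧ c k < 1) {N0 : ℝ} (h0 : 0 ≤ N0)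
    (p : MvPolynomial (ι ⊕ ι) ℂ) :
    HasSum (fun n : ℕ => ((n.factorial : ℂ))⁻¹ *
        ∫ z, polyEval p z * (overlap N0 z : ℂ) ^ n ∂((gaussPi c).prod (gaussPi c)))
      (exp N0 * wick c p) := by
  rw [← integral_polyEval_exp_overlap]
  exact hasSum_overlap_pow hc (continuous_polyEval p).aestronglyMeasurable (fun _ => le_rfl) h0

/-- The grand canonical energy bound for superpositions of coherent states. -/
theorem gsEnergy_le_modes (hc : ∀ k, c k ≠ 0 ∧ c k < 1) (hT : 0 < T) (hω : ∀ k, ‖ω k‖ = 1)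
    {σ : ι → ℝ} (hσ : ∀ k, ω k * ω k = σ k) (hu : IsModes T u ε U)
    {V : Vec 3 → ℝ≥0∞} (hV : Measurable V) {v : Vec 3 → ℝ} (hv : Measurable v)
    (hv0 : ∀ x, 0 ≤ v x) {M : ℝ} (hM : ∀ x, v x ≤ M)
    (hVv : ∀ x, periodize 3 V T x = ENNReal.ofReal (v x)) {N : ℕ} {Nb : ℝ}
    (hNb : Nb = κ ^ 2 * T ^ 3 + ∑ k, covG (c k)) (hN : N < Nb) :
    gsEnergy 3 N T V *
      (1 - (∑ k, (covA (c k) ^ 2 + covG (c k) ^ 2) + Nb) / (Nb - N) ^ 2) ≤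
      ∑ k, ε k * covG (c k) + 1 / 2 * ∫ p, v (p.1 - p.2) * fourPt κ (fun k => σ k * covA (c k))
        (fun k => covG (c k)) u p.1 p.2 ∂((boxM T).prod (boxM T)) := by
  set Var := ∑ k, (covA (c k) ^ 2 + covG (c k) ^ 2)
  set Kin := ∑ k, ε k * covG (c k)
  set In := ∫ p, v (p.1 - p.2) * fourPt κ (fun k => σ k * covA (c k))
        (fun k => covG (c k)) u p.1 p.2 ∂((boxM T).prod (boxM T)) with hIn
  set N0 := κ ^ 2 * T ^ 3 with hN0
  have h0 : 0 ≤ N0 := by positivity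
  obtain ⟨Z1, hZ1, hZe⟩ := wick_one_pos hc
  set Z := exp N0 * Z1 with hZ
  have hZ0 : 0 < Z := by positivity
  choose r r0 r1 r2 using fun n => norm_psi (κ := κ) hc hT hω hu n
  choose K K0 K1 K2 using fun n => kinetic_psi (κ := κ) hc hT hω hu n
  choose I I0 I1 I2 using fun n => inter_psi (κ := κ) hc hT hω hu hv hv0 hM hVv n
  have hst : ∀ n, IsState n T (psi c κ ω u n) := fun n =>
    ⟨contDiff_psi hc κ hω hu.smooth n, psi_periodic κ ω hu.periodic n, psi_symm κ ω u n⟩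
  let Kf : ℕ → ℝ := fun n => (kineticE 3 n T (psi c κ ω u n)).toReal
  let If : ℕ → ℝ := fun n => (interE 3 n T V (psi c κ ω u n)).toReal
  have hk0 : kineticE 3 0 T (psi c κ ω u 0) = 0 := by simp [kineticE]
  have hi0 : interE 3 0 T V (psi c κ ω u 0) = 0 := by simp [interE]
  have hi1 : interE 3 1 T V (psi c κ ω u 1) = 0 := by simp [interE]
  have hKe : ∀ n, kineticE 3 n T (psi c κ ω u n) = ENNReal.ofReal (Kf n) := by
    intro n
    refine (ENNReal.ofReal_toReal ?_).symm
    rcases n with _ | n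
    · simp [hk0]
    · rw [K1]; exact ENNReal.ofReal_ne_top
  have hIe : ∀ n, interE 3 n T V (psi c κ ω u n) = ENNReal.ofReal (If n) := by
    intro n
    refine (ENNReal.ofReal_toReal ?_).symm
    rcases n with _ | _ | n
    · simp [hi0]
    · simp [hi1]
    · rw [I1]; exact ENNReal.ofReal_ne_top
  have hKf : ∀ n, Kf (n + 1) = K n := fun n => by
    simp only [Kf, K1, ENNReal.toReal_ofReal (K0 n)]
  have hIf : ∀ n, If (n + 2) = I n := fun n => by
    simp only [If, I1, ENNReal.toReal_ofReal (I0 n)]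
  have hf0 : ∀ n : ℕ, (n.factorial : ℂ) ≠ 0 := fun n => by exact_mod_cast n.factorial_ne_zero
  have hS0 : HasSum (fun n => r n / (n.factorial : ℝ)) Z := by
    refine hasSum_real_of_complex (hasSum_polyEval_overlap hc h0 1) (fun n => ?_) ?_
    · push_cast
      rw [r2]
      simp only [polyEval, map_one, one_mul, div_eq_inv_mul]
      rfl
    · rw [hZe, hZ, Complex.ofReal_mul]
  have hS1 : HasSum (fun n : ℕ => (n : ℝ) * (r n / (n.factorial : ℝ))) (Z * Nb) := by
    refine hasSum_shift 1 (by simp) ?_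
    refine hasSum_real_of_complex (hasSum_polyEval_overlap hc h0 (ovP N0)) (fun n => ?_) ?_
    · push_cast
      rw [r2]
      simp only [polyEval_ovP, ← pow_succ', Nat.factorial_succ]
      have := hf0 n
      have h2 : (n : ℂ) + 1 ≠ 0 := by exact_mod_cast n.succ_ne_zero
      push_cast
      field_simp
      rfl
    · rw [wick_ovP hc, hZe, hZ, hNb]; push_cast; ring
  have hS2 : HasSum (fun n : ℕ => (n : ℝ) * (n - 1) * (r n / (n.factorial : ℝ)))
      (Z * (Nb ^ 2 + Var)) := by
    refine hasSum_shift 2 (fun i hi => by interval_cases i <;> simp) ?_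
    refine hasSum_real_of_complex (hasSum_polyEval_overlap hc h0 (ovP N0 * ovP N0))
      (fun n => ?_) ?_
    · push_cast
      rw [r2]
      simp only [polyEval_mul, polyEval_ovP, mul_assoc, ← pow_succ', Nat.factorial_succ]
      have := hf0 n
      have h2 : (n : ℂ) + 1 ≠ 0 := by exact_mod_cast n.succ_ne_zero
      have h3 : (n : ℂ) + 2 ≠ 0 := by exact_mod_cast (n + 1).succ_ne_zero
      have h4 : (n : ℂ) + 1 + 1 = n + 2 := by ring
      have h5 : (n : ℂ) + 2 - 1 = n + 1 := by ring
      push_cast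
      rw [h4, h5]
      field_simp
      rfl
    · rw [wick_ovP_sq hc, hZe, hZ, hNb, Complex.ofReal_mul, Complex.ofReal_mul, mul_assoc]
  have hSK : HasSum (fun n : ℕ => Kf n / (n.factorial : ℝ)) (Z * Kin) := by
    refine hasSum_shift 1 (fun i hi => by interval_cases i; simp [Kf, hk0]) ?_
    refine hasSum_real_of_complex (hasSum_polyEval_overlap hc h0 (kinP ε)) (fun n => ?_) ?_
    · push_cast
      rw [hKf, K2]
      simp only [polyEval_kinP, Nat.factorial_succ]
      have := hf0 n
      have h2 : (n : ℂ) + 1 ≠ 0 := by exact_mod_cast n.succ_ne_zero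
      push_cast
      field_simp
      rfl
    · rw [wick_kinP hc, hZe, hZ, Complex.ofReal_mul, Complex.ofReal_mul, mul_assoc]
  have hSI : HasSum (fun n : ℕ => If n / (n.factorial : ℝ)) (Z * (1 / 2 * In)) := by
    refine hasSum_shift 2 (fun i hi => by interval_cases i <;> simp [If, hi0, hi1]) ?_
    obtain ⟨p, hp⟩ := norm_intS_le (κ := κ) hω hu hv0 hM
    have hs := hasSum_overlap_pow hc (stronglyMeasurable_intS (κ := κ) (ω := ω) hu
      hv).aestronglyMeasurable hp h0
    rw [integral_intS_exp hc hω hσ hu hv hv0 hM, ← hIn] at hs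
    refine hasSum_real_of_complex (hs.mul_left (1 / 2)) (fun n => ?_) ?_
    · push_cast
      rw [hIf, I2]
      simp only [Nat.factorial_succ]
      have := hf0 n
      have h2 : (n : ℂ) + 1 ≠ 0 := by exact_mod_cast n.succ_ne_zero
      have h3 : (n : ℂ) + 2 ≠ 0 := by exact_mod_cast (n + 1).succ_ne_zero
      have h4 : (n : ℂ) + 1 + 1 = n + 2 := by ring
      push_cast
      rw [h4, ← hN0]
      field_simp
    · rw [hZe, hZ]; push_cast; ring
  set d := Nb - N with hd
  have hd0 : 0 < d := sub_pos.mpr hN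
  set gs := gsEnergy 3 N T V with hgs
  have hgs0 : 0 ≤ gs := gsEnergy_nonneg _ _ _
  have hpt : ∀ n : ℕ, gs * ((1 - (n - Nb) ^ 2 / d ^ 2) * (r n / n.factorial)) ≤
      Kf n / n.factorial + If n / n.factorial := by
    intro n
    have hfp : (0 : ℝ) < n.factorial := by exact_mod_cast n.factorial_pos
    have hKn : 0 ≤ Kf n := ENNReal.toReal_nonneg
    have hIn : 0 ≤ If n := ENNReal.toReal_nonneg
    rw [← add_div, ← mul_div_assoc, ← mul_div_assoc, div_le_div_iff_of_pos_right hfp]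
    rcases lt_or_ge n N with h | h
    · have h' : (n : ℝ) < N := by exact_mod_cast h
      have : 1 - ((n : ℝ) - Nb) ^ 2 / d ^ 2 ≤ 0 := by
        rw [sub_nonpos, one_le_div (by positivity)]
        nlinarith
      have := mul_nonneg hgs0 (mul_nonneg (neg_nonneg.mpr this) (r0 n))
      linarith
    · have h1 := gsEnergy_mul_le_of_le hV h (hst n)
      rw [hKe, hIe, r1, ← ENNReal.ofReal_add hKn hIn, ← ENNReal.ofReal_mul hgs0,
        ENNReal.ofReal_le_ofReal_iff (by positivity)] at h1
      refine le_trans ?_ h1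
      refine mul_le_mul_of_nonneg_left ?_ hgs0
      have : 0 ≤ ((n : ℝ) - Nb) ^ 2 / d ^ 2 := by positivity
      nlinarith [r0 n]
  have hL : HasSum (fun n : ℕ => gs * ((1 - (n - Nb) ^ 2 / d ^ 2) * (r n / n.factorial)))
      (Z * (gs * (1 - (Var + Nb) / d ^ 2))) := by
    have := ((hS0.mul_left (gs * (1 - Nb ^ 2 / d ^ 2))).add
      (hS1.mul_left (gs * ((2 * Nb - 1) / d ^ 2)))).sub (hS2.mul_left (gs / d ^ 2))
    have e : gs * (1 - Nb ^ 2 / d ^ 2) * Z + gs * ((2 * Nb - 1) / d ^ 2) * (Z * Nb) -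
        gs / d ^ 2 * (Z * (Nb ^ 2 + Var)) = Z * (gs * (1 - (Var + Nb) / d ^ 2)) := by ring
    rw [e] at this
    refine (hasSum_congr_fun fun n => ?_).mp this
    ring
  have := hasSum_le hpt hL (hSK.add hSI)
  rw [← mul_add] at this
  exact le_of_mul_le_mul_left this hZ0

end energy

end

section lattice

/-- The phase `2π n·x / T`. -/
def phase (T : ℝ) (n : Fin 3 → ℤ) (x : Vec 3) : ℝ := 2 * π / T * ∑ j, n j * x j

lemma phase_add_left (T : ℝ) (n m : Fin 3 → ℤ) (x : Vec 3) :
    phase T (n + m) x = phase T n x + phase T m x := by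
  simp only [phase, Pi.add_apply, Int.cast_add, add_mul, Finset.sum_add_distrib, mul_add]

lemma phase_sub_left (T : ℝ) (n m : Fin 3 → ℤ) (x : Vec 3) :
    phase T (n - m) x = phase T n x - phase T m x := by
  simp only [phase, Pi.sub_apply, Int.cast_sub, sub_mul, Finset.sum_sub_distrib, mul_sub]

lemma phase_neg_left (T : ℝ) (n : Fin 3 → ℤ) (x : Vec 3) : phase T (-n) x = -phase T n x := by
  simp [phase]

lemma phase_add (T : ℝ) (n : Fin 3 → ℤ) (x y : Vec 3) :
    phase T n (x + y) = phase T n x + phase T n y := by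
  simp only [phase, Pi.add_apply, mul_add, Finset.sum_add_distrib]

lemma phase_sub (T : ℝ) (n : Fin 3 → ℤ) (x y : Vec 3) :
    phase T n (x - y) = phase T n x - phase T n y := by
  simp only [phase, Pi.sub_apply, mul_sub, Finset.sum_sub_distrib]

lemma phase_shift {T : ℝ} (hT : 0 < T) (n : Fin 3 → ℤ) (x : Vec 3) (v : Fin 3 → ℤ) :
    phase T n (fun j => x j + T * v j) = phase T n x + ((∑ j, n j * v j : ℤ) : ℝ) * (2 * π) := by
  simp only [phase, mul_add, Finset.sum_add_distrib]
  congr 1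
  push_cast
  rw [Finset.mul_sum, Finset.sum_mul]
  refine Finset.sum_congr rfl fun j _ => ?_
  field_simp

@[fun_prop]
lemma continuous_phase (T : ℝ) (n : Fin 3 → ℤ) : Continuous (phase T n) := by
  unfold phase; fun_prop

lemma contDiff_phase (T : ℝ) (n : Fin 3 → ℤ) : ContDiff ℝ (⊤ : ℕ∞) (phase T n) := by
  unfold phase; fun_prop

lemma boxM_eq_pi (T : ℝ) :
    boxM T = Measure.pi fun _ : Fin 3 => volume.restrict (Set.Icc (-T/2) (T/2)) := by
  rw [boxM, volume_pi, Measure.restrict_pi_pi]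

lemma integral_exp_one {T : ℝ} (hT : 0 < T) (m : ℤ) :
    ∫ x in Set.Icc (-T/2) (T/2), Complex.exp ((2 * π / T * (m * x) : ℝ) * Complex.I) =
      if m = 0 then (T : ℂ) else 0 := by
  rw [integral_Icc_eq_integral_Ioc, ← intervalIntegral.integral_of_le (by linarith)]
  split_ifs with h
  · subst h
    simp
    ring
  · have hc : (2 * π / T * m : ℂ) * Complex.I ≠ 0 := by
      have : (π : ℂ) ≠ 0 := by exact_mod_cast pi_ne_zero
      have : (T : ℂ) ≠ 0 := by exact_mod_cast hT.ne'
      have : (m : ℂ) ≠ 0 := by exact_mod_cast h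
      simp [*]
    have : ∀ x : ℝ, Complex.exp ((2 * π / T * (m * x) : ℝ) * Complex.I) =
        Complex.exp ((2 * π / T * m : ℂ) * Complex.I * x) := by
      intro x; congr 1; push_cast; ring
    simp_rw [this]
    rw [integral_exp_mul_complex hc, div_eq_zero_iff]
    left
    rw [sub_eq_zero, Complex.exp_eq_exp_iff_exists_int]
    refine ⟨m, ?_⟩
    have : (T : ℂ) ≠ 0 := by exact_mod_cast hT.ne'
    push_cast
    field_simp
    ring

lemma integral_exp_phase {T : ℝ} (hT : 0 < T) (m : Fin 3 → ℤ) :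
    ∫ x, Complex.exp ((phase T m x : ℂ) * Complex.I) ∂(boxM T) =
      if m = 0 then (T : ℂ) ^ 3 else 0 := by
  have : ∀ x : Vec 3, Complex.exp ((phase T m x : ℂ) * Complex.I) =
      ∏ j, Complex.exp ((2 * π / T * (m j * x j) : ℝ) * Complex.I) := by
    intro x
    rw [← Complex.exp_sum, phase, Finset.mul_sum, Complex.ofReal_sum, Finset.sum_mul]
  simp_rw [this]
  rw [boxM_eq_pi, integral_fintype_prod_eq_prod (𝕜 := ℂ) (f := fun j : Fin 3 => fun y : ℝ =>
    Complex.exp ((2 * π / T * (m j * y) : ℝ) * Complex.I))]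
  simp_rw [integral_exp_one hT]
  split_ifs with h
  · subst h; simp
  · obtain ⟨j, hj⟩ := Function.ne_iff.mp h
    exact Finset.prod_eq_zero (Finset.mem_univ j) (if_neg hj)

lemma integrable_boxM {E : Type*} [NormedAddCommGroup E] {T : ℝ} {f : Vec 3 → E}
    (hf : Continuous f) : Integrable f (boxM T) :=
  hf.continuousOn.integrableOn_compact (isCompact_univ_pi fun _ => isCompact_Icc)

lemma integral_cos_sin_phase {T : ℝ} (hT : 0 < T) (m : Fin 3 → ℤ) :
    ∫ x, cos (phase T m x) ∂(boxM T) = (if m = 0 then T ^ 3 else 0) ∧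
      ∫ x, sin (phase T m x) ∂(boxM T) = 0 := by
  have h := integral_exp_phase hT m
  have e : ∀ x, Complex.exp ((phase T m x : ℂ) * Complex.I) =
      ((cos (phase T m x) : ℝ) : ℂ) + ((sin (phase T m x) : ℝ) : ℂ) * Complex.I := by
    intro x; rw [Complex.exp_mul_I]; push_cast; rfl
  simp_rw [e] at h
  rw [integral_add (integrable_boxM (by fun_prop)) (integrable_boxM (by fun_prop)),
    integral_mul_const, integral_complex_ofReal, integral_complex_ofReal] at h
  constructor
  · have := congrArg Complex.re h
    simp at this
    rw [this]
    split_ifs <;> simp [← Complex.ofReal_pow]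
  · have := congrArg Complex.im h
    simp at this
    rw [this]
    split_ifs <;> simp [← Complex.ofReal_pow]

/-- The normalised real plane waves. -/
def cas (T : ℝ) (n : Fin 3 → ℤ) (x : Vec 3) : ℝ :=
  (√(T ^ 3))⁻¹ * (cos (phase T n x) + sin (phase T n x))

lemma hasFDerivAt_phase (T : ℝ) (n : Fin 3 → ℤ) (x : Vec 3) :
    HasFDerivAt (phase T n) ((2 * π / T) • ∑ j, (n j : ℝ) •
      (ContinuousLinearMap.proj j : Vec 3 →L[ℝ] ℝ)) x := by
  unfold phase
  refine HasFDerivAt.const_mul ?_ _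
  refine HasFDerivAt.fun_sum fun j _ => ?_
  exact (hasFDerivAt_apply j x).const_mul _

lemma fderiv_cas (T : ℝ) (n : Fin 3 → ℤ) (x : Vec 3) (j : Fin 3) :
    fderiv ℝ (cas T n) x (Pi.single j 1) =
      (√(T ^ 3))⁻¹ * (2 * π / T * n j) * (cos (phase T n x) - sin (phase T n x)) := by
  have h := hasFDerivAt_phase T n x
  have := ((h.cos.add h.sin).const_mul (√(T ^ 3))⁻¹).fderiv
  have e : fderiv ℝ (cas T n) x = _ := this
  rw [e]
  simp [Pi.single_apply]
  ring

lemma isModes_cas {T : ℝ} (hT : 0 < T) (M : Finset (Fin 3 → ℤ)) (h0 : (0 : Fin 3 → ℤ) ∉ M) :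
    ∃ U, IsModes (ι := M) T (fun n => cas T n) (fun n => (2 * π / T) ^ 2 * ∑ j, (n.1 j : ℝ) ^ 2) U := by
  have hs : (√(T ^ 3))⁻¹ * (√(T ^ 3))⁻¹ * T ^ 3 = 1 := by
    rw [← mul_inv, Real.mul_self_sqrt (by positivity), inv_mul_cancel₀ (by positivity)]
  have hcs : ∀ y, |cos y + sin y| ≤ 2 := fun y => by
    rw [abs_le]; constructor <;> linarith [neg_one_le_cos y, neg_one_le_sin y, cos_le_one y, sin_le_one y]
  have hcs' : ∀ y, |cos y - sin y| ≤ 2 := fun y => by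
    rw [abs_le]; constructor <;> linarith [neg_one_le_cos y, neg_one_le_sin y, cos_le_one y, sin_le_one y]
  refine ⟨(√(T ^ 3))⁻¹ * 2 + ∑ n ∈ M, ∑ j, |(√(T ^ 3))⁻¹ * (2 * π / T * n j)| * 2,
    fun n => ?_, fun n x v => ?_, fun n x => ?_, fun n j x => ?_, fun n => ?_, fun n m => ?_,
    fun n m => ?_⟩
  · have := contDiff_phase T n
    unfold cas; fun_prop
  · simp only [cas, phase_shift hT, cos_add_int_mul_two_pi, sin_add_int_mul_two_pi]
  · refine le_trans ?_ (le_add_of_nonneg_right (by positivity))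
    rw [cas, abs_mul, abs_of_nonneg (by positivity)]
    gcongr
    exact hcs _
  · refine le_trans ?_ (le_add_of_nonneg_left (by positivity))
    rw [fderiv_cas, abs_mul]
    refine le_trans (mul_le_mul_of_nonneg_left (hcs' _) (abs_nonneg _)) ?_
    refine le_trans ?_ (Finset.single_le_sum (f := fun n : Fin 3 → ℤ =>
      ∑ j, |(√(T ^ 3))⁻¹ * (2 * π / T * n j)| * 2) (fun _ _ => by positivity) n.2)
    exact Finset.single_le_sum (f := fun j =>
      |(√(T ^ 3))⁻¹ * (2 * π / T * n.1 j)| * 2) (fun _ _ => by positivity) (Finset.mem_univ j)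
  · have hn : n.1 ≠ 0 := fun h => h0 (h ▸ n.2)
    unfold cas
    rw [integral_const_mul, integral_add (integrable_boxM (by fun_prop))
      (integrable_boxM (by fun_prop)), (integral_cos_sin_phase hT _).1,
      (integral_cos_sin_phase hT _).2, if_neg hn]
    simp
  · have e : ∀ x, cas T n x * cas T m x = (√(T ^ 3))⁻¹ * (√(T ^ 3))⁻¹ *
        (cos (phase T (n.1 - m.1) x) + sin (phase T (n.1 + m.1) x)) := by
      intro x
      rw [phase_sub_left, phase_add_left, cos_sub, sin_add]
      unfold cas; ring
    simp_rw [e]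
    rw [integral_const_mul, integral_add (integrable_boxM (by fun_prop))
      (integrable_boxM (by fun_prop)), (integral_cos_sin_phase hT _).1,
      (integral_cos_sin_phase hT _).2, add_zero]
    simp only [sub_eq_zero, Subtype.ext_iff, mul_ite, mul_zero, hs]
  · have e : ∀ j x, fderiv ℝ (cas T n) x (Pi.single j 1) * fderiv ℝ (cas T m) x (Pi.single j 1) =
        (√(T ^ 3))⁻¹ * (√(T ^ 3))⁻¹ * (2 * π / T) ^ 2 * (n.1 j * m.1 j) *
        (cos (phase T (n.1 - m.1) x) - sin (phase T (n.1 + m.1) x)) := by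
      intro j x
      rw [phase_sub_left, phase_add_left, cos_sub, sin_add, fderiv_cas, fderiv_cas]
      ring
    simp_rw [e]
    simp_rw [integral_const_mul]
    rw [integral_sub (integrable_boxM (by fun_prop))
      (integrable_boxM (by fun_prop)), (integral_cos_sin_phase hT _).1,
      (integral_cos_sin_phase hT _).2, sub_zero]
    simp only [sub_eq_zero, Subtype.ext_iff]
    split_ifs with h
    · rw [h, ← Finset.sum_mul, ← Finset.mul_sum]
      simp only [← sq]
      linear_combination ((2 * π / T) ^ 2 * ∑ j, (m.1 j : ℝ) ^ 2) * hs
    · simp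

end lattice

section
/-- The pair density as a function of the pair amplitude. -/
def gam (t : ℝ) : ℝ := √(t ^ 2 + 1 / 4) - 1 / 2

lemma half_le_sqrt (t : ℝ) : 1 / 2 ≤ √(t ^ 2 + 1 / 4) :=
  Real.le_sqrt_of_sq_le (by nlinarith [sq_nonneg t])

lemma gam_nonneg (t : ℝ) : 0 ≤ gam t := by have := half_le_sqrt t; unfold gam; linarith

lemma gam_sq_add (t : ℝ) : gam t ^ 2 + gam t = t ^ 2 := by
  have := Real.sq_sqrt (show 0 ≤ t ^ 2 + 1 / 4 by positivity)
  unfold gam; linarith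

lemma gam_zero : gam 0 = 0 := by
  have h := gam_sq_add 0
  have h' := gam_nonneg 0
  nlinarith

lemma gam_le_sq (t : ℝ) : gam t ≤ t ^ 2 := by have := gam_sq_add t; nlinarith [sq_nonneg (gam t)]

lemma gam_le_abs (t : ℝ) : gam t ≤ |t| := by
  refine abs_le_of_sq_le_sq' ?_ (abs_nonneg t) |>.2
  rw [sq_abs]; have := gam_sq_add t; have := gam_nonneg t; linarith

@[fun_prop]
lemma continuous_gam : Continuous gam := by unfold gam; fun_prop

lemma exists_covA_covG {t : ℝ} (ht : t ≠ 0) :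
    ∃ c : ℝ≥0, c ≠ 0 ∧ c < 1 ∧ covA c = |t| ∧ covG c = gam t := by
  have hg := gam_nonneg t
  have hsq := gam_sq_add t
  have hg1 : 0 < gam t + 1 := by linarith
  have hc2 : (|t| / (gam t + 1)) ^ 2 = gam t / (gam t + 1) := by
    rw [div_pow, sq_abs, ← hsq]; field_simp
  have h1 : 1 - (|t| / (gam t + 1)) ^ 2 = (gam t + 1)⁻¹ := by rw [hc2]; field_simp; ring
  have hp : 0 < |t| / (gam t + 1) := div_pos (abs_pos.mpr ht) hg1
  have hcoe := Real.coe_toNNReal _ hp.le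
  refine ⟨(|t| / (gam t + 1)).toNNReal, (Real.toNNReal_pos.mpr hp).ne', ?_, ?_, ?_⟩
  · rw [Real.toNNReal_lt_one]
    have : 0 < (gam t + 1)⁻¹ := by positivity
    exact lt_of_pow_lt_pow_left₀ 2 zero_le_one (by linarith)
  · rw [covA, hcoe, h1]; field_simp
  · rw [covG, hcoe, h1, hc2]; field_simp

section lattice

/-- Normalised finite cosine sums over the dual lattice. -/
def latSum (T : ℝ) (M : Finset (Fin 3 → ℤ)) (w : (Fin 3 → ℤ) → ℝ) (z : Vec 3) : ℝ :=
  (T ^ 3)⁻¹ * ∑ n ∈ M, w n * cos (phase T n z)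

@[fun_prop]
lemma continuous_latSum (T : ℝ) (M : Finset (Fin 3 → ℤ)) (w : (Fin 3 → ℤ) → ℝ) :
    Continuous (latSum T M w) := by unfold latSum; fun_prop

lemma latSum_periodic {T : ℝ} (hT : 0 < T) (M : Finset (Fin 3 → ℤ)) (w : (Fin 3 → ℤ) → ℝ)
    (z : Vec 3) (v : Fin 3 → ℤ) : latSum T M w (fun j => z j + T * v j) = latSum T M w z := by
  simp only [latSum, phase_shift hT, Real.cos_add_int_mul_two_pi]

lemma abs_latSum_le {T : ℝ} (hT : 0 < T) (M : Finset (Fin 3 → ℤ)) {w : (Fin 3 → ℤ) → ℝ}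
    (hw : ∀ n, 0 ≤ w n) (z : Vec 3) : |latSum T M w z| ≤ latSum T M w 0 := by
  simp only [latSum, phase, Pi.zero_apply, mul_zero, Finset.sum_const_zero, cos_zero, mul_one]
  rw [abs_mul, abs_of_pos (by positivity : 0 < (T ^ 3)⁻¹)]
  gcongr
  refine (Finset.abs_sum_le_sum_abs _ _).trans (Finset.sum_le_sum fun n _ => ?_)
  rw [abs_mul, abs_of_nonneg (hw n)]
  exact mul_le_of_le_one_right (hw n) (abs_cos_le_one _)

lemma twoPt_cas {T : ℝ} (hT : 0 < T) {M : Finset (Fin 3 → ℤ)} (hM : ∀ n ∈ M, -n ∈ M)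
    {w : (Fin 3 → ℤ) → ℝ} (hw : ∀ n, w (-n) = w n) (x y : Vec 3) :
    twoPt (fun n : M => w n) (fun n : M => cas T n) x y = latSum T M w (x - y) := by
  have hs : (√(T ^ 3))⁻¹ * (√(T ^ 3))⁻¹ = (T ^ 3)⁻¹ := by
    rw [← mul_inv, Real.mul_self_sqrt (by positivity)]
  have hodd : ∑ n ∈ M, w n * sin (phase T n (x + y)) = 0 := by
    have : ∑ n ∈ M, w n * sin (phase T n (x + y)) = ∑ n ∈ M, -(w n * sin (phase T n (x + y))) := by
      refine Finset.sum_nbij' (fun n => -n) (fun n => -n) hM hM (by simp) (by simp) fun n _ => ?_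
      rw [hw, phase_neg_left, sin_neg]; ring
    rw [Finset.sum_neg_distrib] at this
    linarith
  have key : ∀ n, w n * (cas T n x * cas T n y) =
      (T ^ 3)⁻¹ * (w n * cos (phase T n (x - y))) + (T ^ 3)⁻¹ * (w n * sin (phase T n (x + y))) := by
    intro n
    rw [← hs, cas, cas, phase_sub, phase_add, cos_sub, sin_add]; ring
  rw [twoPt, Finset.sum_coe_sort M (fun n => w n * (cas T n x * cas T n y))]
  simp_rw [key]
  rw [Finset.sum_add_distrib, ← Finset.mul_sum, ← Finset.mul_sum, hodd, mul_zero, add_zero, latSum]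

/-- The half-open box is a fundamental domain for translations by `T ℤ³`. -/
lemma tsum_indicator_box {T : ℝ} (hT : 0 < T) (w : Vec 3) :
    ∑' n : Fin 3 → ℤ, (Set.univ.pi fun _ => Set.Ioc (-T/2) (T/2)).indicator (fun _ => (1 : ℝ≥0∞))
      (fun j => w j - T * n j) = 1 := by
  choose m hm hu using fun j => existsUnique_sub_zsmul_mem_Ioc hT (w j) (-T/2)
  have e : -T/2 + T = T/2 := by ring
  simp only [e, zsmul_eq_mul] at hm hu
  rw [tsum_eq_single m]
  · rw [Set.indicator_of_mem]
    intro j _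
    simpa only [mul_comm] using hm j
  · intro n hn
    rw [Set.indicator_of_notMem]
    intro h
    refine hn (funext fun j => hu j (n j) ?_)
    simpa only [mul_comm] using h j trivial

lemma lintegral_box_periodize {T : ℝ} (hT : 0 < T) {V : Vec 3 → ℝ≥0∞} (hV : Measurable V)
    (y : Vec 3) : ∫⁻ x, periodize 3 V T (x - y) ∂(boxM T) = ∫⁻ x, V x := by
  have hb : boxM T = volume.restrict (Set.univ.pi fun _ => Set.Ioc (-T/2) (T/2)) := by
    rw [boxM]
    refine Measure.restrict_congr_set ?_
    rw [volume_pi]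
    exact (Measure.pi_Ioc_ae_eq_pi_Icc (μ := fun _ => volume) (s := Set.univ)
      (f := fun _ : Fin 3 => -T/2) (g := fun _ => T/2)).symm
  have hQ : MeasurableSet (Set.univ.pi fun _ : Fin 3 => Set.Ioc (-T/2) (T/2)) :=
    MeasurableSet.univ_pi fun _ => measurableSet_Ioc
  set Q := (Set.univ.pi fun _ : Fin 3 => Set.Ioc (-T/2) (T/2)) with hQd
  have hmeas : ∀ n : Fin 3 → ℤ, Measurable fun x : Vec 3 => V (fun k => (x - y) k + T * n k) := by
    intro n
    refine hV.comp ?_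
    fun_prop
  have hI : ∀ n : Fin 3 → ℤ, Measurable fun x : Vec 3 =>
      Q.indicator (fun _ => (1 : ℝ≥0∞)) (fun j => x j + y j - T * n j) := by
    intro n
    refine (measurable_const.indicator hQ).comp ?_
    fun_prop
  unfold periodize
  rw [lintegral_tsum fun n => (hmeas n).aemeasurable]
  have : ∀ n : Fin 3 → ℤ, ∫⁻ x, V (fun k => (x - y) k + T * n k) ∂(boxM T) =
      ∫⁻ x, Q.indicator (fun _ => (1 : ℝ≥0∞)) (fun j => x j + y j - T * n j) * V x := by
    intro n
    rw [hb, ← lintegral_indicator hQ, ← lintegral_sub_right_eq_self (μ := (volume : Measure (Vec 3)))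
      (fun x => Q.indicator (fun _ => (1 : ℝ≥0∞)) (fun j => x j + y j - T * n j) * V x)
      (y - fun k => T * n k)]
    refine lintegral_congr fun x => ?_
    have e1 : (fun j => (x - (y - fun k => T * (n k : ℝ))) j + y j - T * n j) = x := by
      ext j; simp only [Pi.sub_apply]; ring
    have e2 : (fun k => (x - y) k + T * (n k : ℝ)) = x - (y - fun k => T * (n k : ℝ)) := by
      ext j; simp; ring
    change Q.indicator (fun x => V (fun k => (x - y) k + T * (n k : ℝ))) x =
      Q.indicator (fun _ => (1 : ℝ≥0∞))
        (fun j => (x - (y - fun k => T * (n k : ℝ))) j + y j - T * n j) *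
      V (x - (y - fun k => T * (n k : ℝ)))
    rw [e1, ← e2]
    by_cases hx : x ∈ Q <;> simp [hx]
  simp_rw [this]
  rw [← lintegral_tsum (f := fun (n : Fin 3 → ℤ) (x : Vec 3) =>
    Q.indicator (fun _ => (1 : ℝ≥0∞)) (fun j => x j + y j - T * n j) * V x)
    fun n => ((hI n).mul hV).aemeasurable]
  refine lintegral_congr fun x => ?_
  rw [ENNReal.tsum_mul_right, tsum_indicator_box hT (fun j => x j + y j), one_mul]

end lattice

end

section lattice

lemma periodize_le {v : Vec 3 → ℝ} {R T B : ℝ} (hT : 2 * R < T)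
    (hR : ∀ x, v x ≠ 0 → ∀ j, |x j| ≤ R) (hB : ∀ x, v x ≤ B) (z : Vec 3) :
    periodize 3 (fun x => ENNReal.ofReal (v x)) T z ≤ ENNReal.ofReal B := by
  unfold periodize
  by_cases h : ∃ n : Fin 3 → ℤ, v (fun k => z k + T * n k) ≠ 0
  · obtain ⟨n, hn⟩ := h
    rw [tsum_eq_single n]
    · exact ENNReal.ofReal_le_ofReal (hB _)
    · intro m hm
      by_contra hc
      have hm' : v (fun k => z k + T * m k) ≠ 0 := fun h => hc (by simp only [h, ENNReal.ofReal_zero])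
      refine hm (funext fun j => ?_)
      have h1 := abs_le.mp (hR _ hn j)
      have h2 := abs_le.mp (hR _ hm' j)
      have hT0 : 0 < T := by linarith [(abs_nonneg _).trans (hR _ hn j)]
      have h3 : |T * ((m j - n j : ℤ) : ℝ)| < T := by
        rw [abs_lt]; push_cast; constructor <;> linarith
      rw [abs_mul, abs_of_pos hT0, mul_lt_iff_lt_one_right hT0, ← Int.cast_abs] at h3
      have : |m j - n j| < 1 := by exact_mod_cast h3
      rw [Int.abs_lt_one_iff] at this
      linarith
  · push Not at h
    simp [h]

lemma integral_periodize {T : ℝ} (hT : 0 < T) {v F : Vec 3 → ℝ} (hv : Measurable v)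
    (hv0 : ∀ x, 0 ≤ v x) (hF : Continuous F) (hF0 : ∀ x, 0 ≤ F x)
    (hFp : ∀ x (n : Fin 3 → ℤ), F (fun j => x j + T * n j) = F x)
    (hfin : ∀ z, periodize 3 (fun x => ENNReal.ofReal (v x)) T z ≠ ⊤) :
    ∫ p, (periodize 3 (fun x => ENNReal.ofReal (v x)) T (p.1 - p.2)).toReal * F (p.1 - p.2)
      ∂((boxM T).prod (boxM T)) = T ^ 3 * ∫ x, v x * F x := by
  have hm := measurable_periodize hv.ennreal_ofReal T
  have hFm := hF.measurable
  have hsub : Measurable fun p : Vec 3 × Vec 3 => p.1 - p.2 := measurable_fst.sub measurable_snd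
  have hm2 : Measurable fun p : Vec 3 × Vec 3 =>
      (periodize 3 (fun x => ENNReal.ofReal (v x)) T (p.1 - p.2)).toReal * F (p.1 - p.2) :=
    (hm.comp hsub).ennreal_toReal.mul (hFm.comp hsub)
  have hV' : Measurable fun x => ENNReal.ofReal (v x * F x) := (hv.mul hFm).ennreal_ofReal
  have key : ∀ z, ENNReal.ofReal
      ((periodize 3 (fun x => ENNReal.ofReal (v x)) T z).toReal * F z) =
      periodize 3 (fun x => ENNReal.ofReal (v x * F x)) T z := by
    intro z
    rw [ENNReal.ofReal_mul ENNReal.toReal_nonneg, ENNReal.ofReal_toReal (hfin z)]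
    simp only [periodize]
    rw [← ENNReal.tsum_mul_right]
    refine tsum_congr fun n => ?_
    rw [hFp, ENNReal.ofReal_mul (hv0 _)]
  rw [integral_eq_lintegral_of_nonneg_ae
      (ae_of_all _ fun p => mul_nonneg ENNReal.toReal_nonneg (hF0 _)) hm2.aestronglyMeasurable,
    integral_eq_lintegral_of_nonneg_ae (ae_of_all _ fun p => mul_nonneg (hv0 _) (hF0 _))
      (hv.mul hFm).aestronglyMeasurable,
    lintegral_prod_symm _ hm2.ennreal_ofReal.aemeasurable]
  simp_rw [key]
  have : ∀ y, ∫⁻ x, periodize 3 (fun x => ENNReal.ofReal (v x * F x)) T (x - y) ∂(boxM T) =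
      ∫⁻ x, ENNReal.ofReal (v x * F x) := lintegral_box_periodize hT hV'
  simp_rw [this]
  have h1 := integral_one_boxM hT
  rw [integral_const, smul_eq_mul, mul_one, Measure.real] at h1
  rw [lintegral_const, ENNReal.toReal_mul, h1, mul_comm]

/-- The interaction density of a state with condensate density `r`, pairing `A` and excitation
density function `G`. -/
def pairDens (r A G G0 : ℝ) : ℝ := (r - A) ^ 2 + 2 * r * G + G ^ 2 + 2 * r * G0 + G0 ^ 2

lemma pairDens_nonneg {r A G G0 : ℝ} (hr : 0 ≤ r) (h : |G| ≤ G0) : 0 ≤ pairDens r A G G0 := by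
  have := (abs_le.mp h).1
  have : 0 ≤ 2 * r * (G + G0) := mul_nonneg (by linarith) (by linarith)
  unfold pairDens
  nlinarith [sq_nonneg (r - A), sq_nonneg G, sq_nonneg G0]

/-- The finite volume energy upper bound. -/
theorem gsEnergy_le_lattice {T R B : ℝ} (hT : 0 < T) (hRT : 2 * R < T) {v : Vec 3 → ℝ}
    (hv : Continuous v) (hv0 : ∀ x, 0 ≤ v x) (hR : ∀ x, v x ≠ 0 → ∀ j, |x j| ≤ R)
    (hB : ∀ x, v x ≤ B) {M : Finset (Fin 3 → ℤ)} (hM : ∀ n ∈ M, -n ∈ M) (h0 : 0 ∉ M)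
    {a : (Fin 3 → ℤ) → ℝ} (ha : ∀ n, a (-n) = a n) (ha0 : ∀ n ∈ M, a n ≠ 0) {r : ℝ} (hr : 0 ≤ r)
    {N : ℕ} {Nb : ℝ} (hNb : Nb = r * T ^ 3 + ∑ n ∈ M, gam (a n)) (hN : N < Nb) :
    gsEnergy 3 N T (fun x => ENNReal.ofReal (v x)) *
        (1 - (∑ n ∈ M, (a n ^ 2 + gam (a n) ^ 2) + Nb) / (Nb - N) ^ 2) ≤
      ∑ n ∈ M, (2 * π / T) ^ 2 * (∑ j, (n j : ℝ) ^ 2) * gam (a n) + T ^ 3 * (1 / 2 * ∫ x, v x *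
        pairDens r (latSum T M a x) (latSum T M (fun n => gam (a n)) x)
          (latSum T M (fun n => gam (a n)) 0)) := by
  choose c hc0 hc1 hcA hcG using fun n : M => exists_covA_covG (ha0 n n.2)
  obtain ⟨U, hU⟩ := isModes_cas hT M h0
  let ω : M → ℂ := fun n => if 0 < a n then Complex.I else 1
  let σ : M → ℝ := fun n => if 0 < a n then -1 else 1
  have hω : ∀ k, ‖ω k‖ = 1 := fun k => by simp only [ω]; split_ifs <;> simp
  have hσ : ∀ k, ω k * ω k = σ k := fun k => by simp only [ω, σ]; split_ifs <;> simp
  have hσA : ∀ k, σ k * covA (c k) = -a k := by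
    intro k
    rw [hcA]
    simp only [σ]
    split_ifs with h
    · rw [abs_of_pos h]; ring
    · rw [abs_of_nonpos (not_lt.mp h)]; ring
  have hfin : ∀ z, periodize 3 (fun x => ENNReal.ofReal (v x)) T z ≠ ⊤ := fun z =>
    ((periodize_le hRT hR hB z).trans_lt ENNReal.ofReal_lt_top).ne
  have hκ : √r ^ 2 = r := Real.sq_sqrt hr
  have main := gsEnergy_le_modes (κ := √r) (fun k => ⟨hc0 k, hc1 k⟩) hT hω hσ hU
    hv.measurable.ennreal_ofReal
    (v := fun z => (periodize 3 (fun x => ENNReal.ofReal (v x)) T z).toReal)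
    (measurable_periodize hv.measurable.ennreal_ofReal T).ennreal_toReal
    (fun _ => ENNReal.toReal_nonneg)
    (fun z => ENNReal.toReal_mono ENNReal.ofReal_ne_top (periodize_le hRT hR hB z))
    (fun z => (ENNReal.ofReal_toReal (hfin z)).symm) (N := N) (Nb := Nb)
    (by rw [hκ, hNb]; simp_rw [hcG]; rw [Finset.sum_coe_sort M fun n => gam (a n)]) hN
  simp_rw [hσA, hcG, hcA, sq_abs] at main
  rw [Finset.sum_coe_sort M fun n => a n ^ 2 + gam (a n) ^ 2,
    Finset.sum_coe_sort M fun n => (2 * π / T) ^ 2 * (∑ j, (n j : ℝ) ^ 2) * gam (a n)] at main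
  have hg : ∀ n, gam (a (-n)) = gam (a n) := fun n => by rw [ha]
  have hfour : ∀ x y, fourPt √r (fun k : M => -a k) (fun k => gam (a k)) (fun n => cas T n) x y =
      pairDens r (latSum T M a (x - y)) (latSum T M (fun n => gam (a n)) (x - y))
          (latSum T M (fun n => gam (a n)) 0) := by
    intro x y
    have hneg : twoPt (fun k : M => -a k) (fun n : M => cas T n) x y =
        -twoPt (fun k : M => a k) (fun n : M => cas T n) x y := by
      simp [twoPt, Finset.sum_neg_distrib]
    unfold fourPt pairDens
    rw [hneg, hκ, twoPt_cas hT hM ha, twoPt_cas hT hM (w := fun n => gam (a n)) hg,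
      twoPt_cas hT hM (w := fun n => gam (a n)) hg, twoPt_cas hT hM (w := fun n => gam (a n)) hg,
      sub_self, sub_self]
    ring
  simp_rw [hfour] at main
  rw [integral_periodize hT (F := fun z => pairDens r (latSum T M a z)
    (latSum T M (fun n => gam (a n)) z) (latSum T M (fun n => gam (a n)) 0)) hv.measurable hv0
    (by unfold pairDens; fun_prop)
    (fun z => pairDens_nonneg hr (abs_latSum_le hT M (fun n => gam_nonneg _) z))
    (fun x n => by simp only [latSum_periodic hT]) hfin] at main
  linarith

end lattice

section riemann

/-- The lattice point of `T⁻¹ ℤ³` below `ξ`. -/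
def lowPt (T : ℝ) (ξ : Vec 3) : Vec 3 := fun j => (⌊T * ξ j⌋ : ℝ) / T

lemma abs_lowPt_sub {T : ℝ} (hT : 0 < T) (ξ : Vec 3) (j : Fin 3) : |lowPt T ξ j - ξ j| ≤ T⁻¹ := by
  have h1 := Int.floor_le (T * ξ j)
  have h2 := Int.lt_floor_add_one (T * ξ j)
  have : lowPt T ξ j - ξ j = (⌊T * ξ j⌋ - T * ξ j) * T⁻¹ := by
    unfold lowPt; field_simp
  rw [this, abs_mul, abs_of_pos (inv_pos.mpr hT)]
  refine mul_le_of_le_one_left (inv_pos.mpr hT).le ?_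
  rw [abs_le]; constructor <;> linarith

lemma norm_lowPt_sub {T : ℝ} (hT : 0 < T) (ξ : Vec 3) : ‖lowPt T ξ - ξ‖ ≤ T⁻¹ :=
  (pi_norm_le_iff_of_nonneg (inv_pos.mpr hT).le).mpr fun j => by
    simpa [Real.norm_eq_abs] using abs_lowPt_sub hT ξ j

lemma measurable_lowPt (T : ℝ) : Measurable (lowPt T) := by
  refine measurable_pi_lambda _ fun j => ?_
  have h1 : Measurable fun ξ : Vec 3 => ⌊T * ξ j⌋ :=
    Int.measurable_floor.comp (by fun_prop : Measurable fun ξ : Vec 3 => T * ξ j)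
  exact (measurable_from_top.comp h1 : Measurable fun ξ : Vec 3 => ((⌊T * ξ j⌋ : ℤ) : ℝ)).div_const T

/-- The lattice point with index `n`. -/
def latPt (T : ℝ) (n : Fin 3 → ℤ) : Vec 3 := fun j => (n j : ℝ) / T

lemma riemann_sum_eq {T : ℝ} (hT : 0 < T) {M : Finset (Fin 3 → ℤ)} {h : Vec 3 → ℝ}
    (hM : ∀ n, n ∉ M → h (latPt T n) = 0) :
    (T ^ 3)⁻¹ * ∑ n ∈ M, h (latPt T n) = ∫ ξ, h (lowPt T ξ) := by
  let cell : (Fin 3 → ℤ) → Set (Vec 3) := fun n =>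
    Set.univ.pi fun j => Set.Ico ((n j : ℝ) / T) ((n j + 1) / T)
  have hcell : ∀ n ξ, ξ ∈ cell n ↔ (fun j => ⌊T * ξ j⌋) = n := by
    intro n ξ
    simp only [cell, Set.mem_pi, Set.mem_univ, true_imp_iff, Set.mem_Ico, funext_iff,
      Int.floor_eq_iff, div_le_iff₀ hT, lt_div_iff₀ hT, mul_comm]
  have hmeas : ∀ n, MeasurableSet (cell n) := fun n =>
    MeasurableSet.univ_pi fun j => measurableSet_Ico
  have hvol : ∀ n, volume.real (cell n) = (T ^ 3)⁻¹ := by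
    intro n
    have : ∀ j, ((n j : ℝ) + 1) / T - n j / T = T⁻¹ := fun j => by field_simp; ring
    simp only [cell, Measure.real, volume_pi_pi, Real.volume_Ico, this, Finset.prod_const,
      Finset.card_univ, Fintype.card_fin, ENNReal.toReal_pow,
      ENNReal.toReal_ofReal (inv_pos.mpr hT).le, inv_pow]
  have hfin : ∀ n, volume (cell n) ≠ ⊤ := by
    intro n h
    have := hvol n
    rw [Measure.real, h, ENNReal.toReal_top] at this
    have : 0 < (T ^ 3)⁻¹ := by positivity
    linarith
  have hpt : ∀ ξ, h (lowPt T ξ) = ∑ n ∈ M, (cell n).indicator (fun _ => h (latPt T n)) ξ := by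
    intro ξ
    set m : Fin 3 → ℤ := fun j => ⌊T * ξ j⌋ with hm
    have hlm : lowPt T ξ = latPt T m := rfl
    have : ∀ n, (cell n).indicator (fun _ => h (latPt T n)) ξ = if m = n then h (latPt T n) else 0 := by
      intro n
      classical
      rw [Set.indicator_apply]
      simp only [hcell]
      rfl
    simp_rw [this]
    rw [Finset.sum_ite_eq, hlm]
    split_ifs with hh
    · rfl
    · exact hM m hh
  simp_rw [hpt]
  rw [integral_finsetSum, Finset.mul_sum]
  · refine Finset.sum_congr rfl fun n _ => ?_
    rw [integral_indicator (hmeas n), setIntegral_const, hvol, smul_eq_mul]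
  · intro n _
    exact (integrable_indicator_iff (hmeas n)).mpr (integrableOn_const (hfin n))

lemma exists_bound_lowPt {h : Vec 3 → ℝ} (hc : Continuous h) (hs : HasCompactSupport h) :
    ∃ g : Vec 3 → ℝ, Integrable g ∧ ∀ T, 1 ≤ T → ∀ ξ, |h (lowPt T ξ)| ≤ g ξ := by
  obtain ⟨C, hC⟩ := hs.exists_bound_of_continuous hc
  obtain ⟨R, hR⟩ := hs.isBounded.subset_closedBall 0
  refine ⟨(Metric.closedBall (0 : Vec 3) (R + 1)).indicator fun _ => C,
    (integrable_indicator_iff Metric.isClosed_closedBall.measurableSet).mpr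
      (integrableOn_const (isCompact_closedBall _ _).measure_lt_top.ne), fun T hi ξ => ?_⟩
  by_cases hξ : ξ ∈ Metric.closedBall (0 : Vec 3) (R + 1)
  · rw [Set.indicator_of_mem hξ]; exact hC _
  · rw [Set.indicator_of_notMem hξ]
    have : lowPt T ξ ∉ tsupport h := by
      intro hm
      refine hξ ?_
      have h1 := hR hm
      rw [mem_closedBall_zero_iff] at h1 ⊢
      have h2 := norm_lowPt_sub (by linarith : 0 < T) ξ
      have h3 : T⁻¹ ≤ 1 := inv_le_one_of_one_le₀ hi
      have h4 : ‖ξ‖ ≤ ‖lowPt T ξ‖ + ‖lowPt T ξ - ξ‖ := by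
        have := norm_sub_le (lowPt T ξ) (lowPt T ξ - ξ)
        rwa [sub_sub_cancel] at this
      linarith
    rw [image_eq_zero_of_notMem_tsupport this, abs_zero]

lemma tendsto_riemann {ι : Type*} {l : Filter ι} [l.IsCountablyGenerated] {T : ι → ℝ}
    (hT : Tendsto T l atTop) {h : Vec 3 → ℝ} (hc : Continuous h) (hs : HasCompactSupport h) :
    Tendsto (fun i => ∫ ξ, h (lowPt (T i) ξ)) l (𝓝 (∫ ξ, h ξ)) := by
  obtain ⟨g, hg, hb⟩ := exists_bound_lowPt hc hs
  refine tendsto_integral_filter_of_dominated_convergence g ?_ ?_ hg ?_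
  · exact Eventually.of_forall fun i => (hc.measurable.comp (measurable_lowPt _)).aestronglyMeasurable
  · filter_upwards [hT.eventually_ge_atTop 1] with i hi
    exact ae_of_all _ fun ξ => hb _ hi ξ
  · refine ae_of_all _ fun ξ => (hc.tendsto ξ).comp ?_
    rw [tendsto_iff_norm_sub_tendsto_zero]
    refine squeeze_zero' (Eventually.of_forall fun _ => norm_nonneg _) ?_
      (tendsto_inv_atTop_zero.comp hT)
    filter_upwards [hT.eventually_gt_atTop 0] with i hi using norm_lowPt_sub hi ξ

lemma exists_bound_integral_lowPt {h : Vec 3 → ℝ} (hc : Continuous h) (hs : HasCompactSupport h) :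
    ∃ K : ℝ, ∀ T, 1 ≤ T → ∀ g : Vec 3 → ℝ, (∀ ξ, |g ξ| ≤ 1) →
      |∫ ξ, h (lowPt T ξ) * g ξ| ≤ K := by
  obtain ⟨G, hG, hb⟩ := exists_bound_lowPt hc hs
  refine ⟨∫ ξ, G ξ, fun T hT g hg => ?_⟩
  rw [← Real.norm_eq_abs]
  refine norm_integral_le_of_norm_le hG (ae_of_all _ fun ξ => ?_)
  rw [norm_mul]
  exact (mul_le_of_le_one_right (norm_nonneg _) (hg ξ)).trans (hb T hT ξ)

end riemann

section thermo

/-- The cosine transform. -/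
def ft (h : Vec 3 → ℝ) (x : Vec 3) : ℝ := ∫ ξ, h ξ * cos (2 * π * ∑ j, ξ j * x j)

/-- The dispersion relation in the momentum variable. -/
def disp (ξ : Vec 3) : ℝ := (2 * π) ^ 2 * ∑ j, ξ j ^ 2

@[fun_prop]
lemma continuous_disp : Continuous disp := by unfold disp; fun_prop

lemma disp_nonneg (ξ : Vec 3) : 0 ≤ disp ξ := by unfold disp; positivity

/-- The energy density functional. -/
def enDens (v : Vec 3 → ℝ) (r : ℝ) (α : Vec 3 → ℝ) : ℝ :=
  (∫ ξ, disp ξ * gam (α ξ)) + 1 / 2 * ∫ x, v x *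
    pairDens r (ft α x) (ft (fun ξ => gam (α ξ)) x) (ft (fun ξ => gam (α ξ)) 0)

lemma exists_lattice_support {α : Vec 3 → ℝ} (hs : HasCompactSupport α) {T : ℝ} (hT : 0 < T) :
    ∃ M : Finset (Fin 3 → ℤ), ∀ n, n ∈ M ↔ α (latPt T n) ≠ 0 := by
  classical
  obtain ⟨R, hR⟩ := hs.isBounded.subset_closedBall 0
  refine ⟨(Fintype.piFinset fun _ => Finset.Icc (-⌈R * T⌉) ⌈R * T⌉).filter
    fun n => α (latPt T n) ≠ 0, fun n => ?_⟩
  simp only [Finset.mem_filter, Fintype.mem_piFinset, Finset.mem_Icc, and_iff_right_iff_imp]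
  intro h j
  have h1 := mem_closedBall_zero_iff.mp (hR (subset_tsupport _ h))
  have h2 := (norm_le_pi_norm (latPt T n) j).trans h1
  rw [Real.norm_eq_abs, latPt, abs_div, abs_of_pos hT, div_le_iff₀ hT, abs_le] at h2
  have h3 := Int.le_ceil (R * T)
  constructor
  · have : ((-⌈R * T⌉ : ℤ) : ℝ) ≤ n j := by push_cast; linarith
    exact_mod_cast this
  · have : (n j : ℝ) ≤ (⌈R * T⌉ : ℤ) := by linarith
    exact_mod_cast this

lemma latSum_eq_integral {T : ℝ} (hT : 0 < T) {M : Finset (Fin 3 → ℤ)} {h : Vec 3 → ℝ}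
    (hM : ∀ n, n ∉ M → h (latPt T n) = 0) (x : Vec 3) :
    latSum T M (fun n => h (latPt T n)) x =
      ∫ ξ, h (lowPt T ξ) * cos (2 * π * ∑ j, lowPt T ξ j * x j) := by
  rw [latSum, ← riemann_sum_eq (h := fun ξ => h ξ * cos (2 * π * ∑ j, ξ j * x j)) hT (M := M)
    (fun n hn => by rw [hM n hn, zero_mul])]
  congr 1
  refine Finset.sum_congr rfl fun n _ => ?_
  congr 2
  simp only [phase, latPt, Finset.mul_sum]
  refine Finset.sum_congr rfl fun j _ => ?_
  ring

lemma gsEnergy_le_riemann {v : Vec 3 → ℝ} (hv : Continuous v) (hv0 : ∀ x, 0 ≤ v x) {R B T : ℝ}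
    (hT : 0 < T) (hRT : 2 * R < T) (hR : ∀ x, v x ≠ 0 → ∀ j, |x j| ≤ R) (hB : ∀ x, v x ≤ B)
    {α : Vec 3 → ℝ} (hs : HasCompactSupport α) (hev : ∀ ξ, α (-ξ) = α ξ) (hα0 : α 0 = 0)
    {r : ℝ} (hr : 0 ≤ r) {N : ℕ} {ρ ρ' : ℝ} (hN : (N : ℝ) = ρ * T ^ 3)
    (hρ' : ρ' = r + ∫ ξ, gam (α (lowPt T ξ))) (hlt : ρ < ρ') :
    gsEnergy 3 N T (fun x => ENNReal.ofReal (v x)) / T ^ 3 *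
        (1 - (T ^ 3)⁻¹ * (((∫ ξ, (α (lowPt T ξ) ^ 2 + gam (α (lowPt T ξ)) ^ 2)) + ρ') /
          (ρ' - ρ) ^ 2)) ≤
      (∫ ξ, disp (lowPt T ξ) * gam (α (lowPt T ξ))) + 1 / 2 * ∫ x, v x * pairDens r
        (∫ ξ, α (lowPt T ξ) * cos (2 * π * ∑ j, lowPt T ξ j * x j))
        (∫ ξ, gam (α (lowPt T ξ)) * cos (2 * π * ∑ j, lowPt T ξ j * x j))
        (∫ ξ, gam (α (lowPt T ξ))) := by
  obtain ⟨M, hM⟩ := exists_lattice_support hs hT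
  have hout : ∀ n, n ∉ M → α (latPt T n) = 0 := fun n hn => by simpa [hM] using hn
  have hgout : ∀ n, n ∉ M → gam (α (latPt T n)) = 0 := fun n hn => by rw [hout n hn, gam_zero]
  have hneg : ∀ n, latPt T (-n) = -latPt T n := fun n => by
    ext j; simp [latPt, neg_div]
  have h0 : (0 : Fin 3 → ℤ) ∉ M := by
    rw [hM, not_not]
    have : latPt T 0 = 0 := by ext j; simp [latPt]
    rw [this, hα0]
  have hMn : ∀ n ∈ M, -n ∈ M := fun n hn => by rw [hM] at hn ⊢; rwa [hneg, hev]
  have e1 := riemann_sum_eq hT (h := fun ξ => gam (α ξ)) hgout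
  have e2 := riemann_sum_eq hT (h := fun ξ => α ξ ^ 2 + gam (α ξ) ^ 2) (M := M)
    (fun n hn => by rw [hgout n hn, hout n hn]; ring)
  have e3 := riemann_sum_eq hT (h := fun ξ => disp ξ * gam (α ξ)) (M := M)
    (fun n hn => by rw [hgout n hn]; ring)
  have hT3 : 0 < T ^ 3 := by positivity
  have main := gsEnergy_le_lattice hT hRT hv hv0 hR hB hMn h0 (a := fun n => α (latPt T n))
    (fun n => by rw [hneg, hev]) (fun n hn => (hM n).mp hn) hr (N := N) (Nb := ρ' * T ^ 3)
    (by rw [hρ', ← e1]; field_simp) (by rw [hN]; gcongr)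
  have e4 : ∀ x, latSum T M (fun n => gam (α (latPt T n))) x = _ :=
    fun x => latSum_eq_integral (h := fun ξ => gam (α ξ)) hT hgout x
  simp_rw [latSum_eq_integral hT hout, e4] at main
  simp only [Pi.zero_apply, mul_zero, Finset.sum_const_zero, cos_zero, mul_one] at main
  have e3' : ∑ n ∈ M, (2 * π / T) ^ 2 * (∑ j, (n j : ℝ) ^ 2) * gam (α (latPt T n)) =
      T ^ 3 * ∫ ξ, disp (lowPt T ξ) * gam (α (lowPt T ξ)) := by
    rw [← e3, mul_inv_cancel_left₀ hT3.ne']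
    refine Finset.sum_congr rfl fun n _ => ?_
    simp only [disp, latPt, div_pow, ← Finset.sum_div]
    ring
  have e2' : ∑ n ∈ M, (α (latPt T n) ^ 2 + gam (α (latPt T n)) ^ 2) =
      T ^ 3 * ∫ ξ, (α (lowPt T ξ) ^ 2 + gam (α (lowPt T ξ)) ^ 2) := by
    rw [← e2, mul_inv_cancel_left₀ hT3.ne']
  rw [e3', e2', ← mul_add, hN] at main
  have hd : ρ' - ρ ≠ 0 := (sub_pos.mpr hlt).ne'
  have key := div_le_div_of_nonneg_right main hT3.le
  rw [mul_div_cancel_left₀ _ hT3.ne'] at key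
  refine le_trans (le_of_eq ?_) key
  rw [← sub_mul, div_mul_eq_mul_div]
  congr 3
  field_simp

lemma tendsto_integral_cos {ι : Type*} {l : Filter ι} [l.IsCountablyGenerated] {T : ι → ℝ}
    (hT : Tendsto T l atTop) {h : Vec 3 → ℝ} (hc : Continuous h) (hs : HasCompactSupport h)
    (x : Vec 3) :
    Tendsto (fun i => ∫ ξ, h (lowPt (T i) ξ) * cos (2 * π * ∑ j, lowPt (T i) ξ j * x j)) l
      (𝓝 (ft h x)) :=
  tendsto_riemann hT (h := fun ξ => h ξ * cos (2 * π * ∑ j, ξ j * x j)) (by fun_prop) hs.mul_right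

lemma abs_pairDens_le {r A G G0 K L : ℝ} (hr : 0 ≤ r) (hA : |A| ≤ K) (hG : |G| ≤ L)
    (hG0 : |G0| ≤ L) : |pairDens r A G G0| ≤ (r + K) ^ 2 + 4 * r * L + 2 * L ^ 2 := by
  have h1 := abs_le.mp hG
  have h2 := abs_le.mp hG0
  have h3 := abs_le.mp hA
  have a1 : (r - A) ^ 2 ≤ (r + K) ^ 2 := by apply sq_le_sq'  <;> linarith
  have a2 : G ^ 2 ≤ L ^ 2 := sq_le_sq' h1.1 h1.2
  have a3 : G0 ^ 2 ≤ L ^ 2 := sq_le_sq' h2.1 h2.2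
  have a4 := mul_le_mul_of_nonneg_left h1.2 hr
  have a5 := mul_le_mul_of_nonneg_left h2.2 hr
  have a6 := mul_le_mul_of_nonneg_left h1.1 hr
  have a7 := mul_le_mul_of_nonneg_left h2.1 hr
  unfold pairDens
  rw [abs_le]
  constructor
  · nlinarith [sq_nonneg (r - A), sq_nonneg G, sq_nonneg G0, sq_nonneg (r + K), sq_nonneg L]
  · nlinarith

lemma hasCompactSupport_gam {α : Vec 3 → ℝ} (hs : HasCompactSupport α) :
    HasCompactSupport fun ξ => gam (α ξ) := hs.comp_left gam_zero

/-- The thermodynamic limit of the finite volume bound. -/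
theorem ePlus_le_of_compact {v : Vec 3 → ℝ} (hv : Continuous v) (hv0 : ∀ x, 0 ≤ v x)
    (hvs : HasCompactSupport v) {α : Vec 3 → ℝ} (hα : Continuous α) (hs : HasCompactSupport α)
    (hev : ∀ ξ, α (-ξ) = α ξ) (hα0 : α 0 = 0) {r ρ : ℝ} (hr : 0 ≤ r) (hρ : 0 < ρ)
    (hlt : ρ < r + ∫ ξ, gam (α ξ)) :
    ePlus 3 (fun x => ENNReal.ofReal (v x)) ρ ≤ enDens v r α := by
  obtain ⟨B, hB⟩ := hvs.exists_bound_of_continuous hv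
  obtain ⟨R, hR⟩ := hvs.isBounded.subset_closedBall 0
  have hB' : ∀ x, v x ≤ B := fun x => (le_abs_self _).trans (hB x)
  have hR' : ∀ x, v x ≠ 0 → ∀ j, |x j| ≤ R := fun x hx j =>
    (norm_le_pi_norm x j).trans (mem_closedBall_zero_iff.mp (hR (subset_tsupport _ hx)))
  have hg : Continuous fun ξ => gam (α ξ) := by fun_prop
  have hgs := hasCompactSupport_gam hs
  have hT : Tendsto (fun N : ℕ => sideLength 3 ρ N) atTop atTop :=
    (tendsto_rpow_atTop (by norm_num)).comp (tendsto_natCast_atTop_atTop.atTop_div_const hρ)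
  have hT3 : ∀ N : ℕ, (N : ℝ) = ρ * sideLength 3 ρ N ^ 3 := by
    intro N
    rw [sideLength, ← Real.rpow_natCast, ← Real.rpow_mul (by positivity)]
    norm_num
    field_simp
  set T := fun N : ℕ => sideLength 3 ρ N with hTd
  set ρ' : ℕ → ℝ := fun N => r + ∫ ξ, gam (α (lowPt (T N) ξ)) with hρ'
  have hρl : Tendsto ρ' atTop (𝓝 (r + ∫ ξ, gam (α ξ))) :=
    (tendsto_riemann hT (h := fun ξ => gam (α ξ)) hg hgs).const_add r
  set δ : ℕ → ℝ := fun N => ((T N) ^ 3)⁻¹ * (((∫ ξ, (α (lowPt (T N) ξ) ^ 2 +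
    gam (α (lowPt (T N) ξ)) ^ 2)) + ρ' N) / (ρ' N - ρ) ^ 2) with hδ
  set E : ℕ → ℝ := fun N => (∫ ξ, disp (lowPt (T N) ξ) * gam (α (lowPt (T N) ξ))) +
      1 / 2 * ∫ x, v x * pairDens r
        (∫ ξ, α (lowPt (T N) ξ) * cos (2 * π * ∑ j, lowPt (T N) ξ j * x j))
        (∫ ξ, gam (α (lowPt (T N) ξ)) * cos (2 * π * ∑ j, lowPt (T N) ξ j * x j))
        (∫ ξ, gam (α (lowPt (T N) ξ))) with hE
  have hmain : ∀ᶠ N : ℕ in atTop, gsEnergy 3 N (T N) (fun x => ENNReal.ofReal (v x)) / T N ^ 3 *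
      (1 - δ N) ≤ E N := by
    filter_upwards [hT.eventually_gt_atTop 0, hT.eventually_gt_atTop (2 * R),
      hρl.eventually_const_lt hlt] with N h1 h2 h3
    exact gsEnergy_le_riemann hv hv0 h1 h2 hR' hB' hs hev hα0 hr (hT3 N) rfl h3
  have hδl : Tendsto δ atTop (𝓝 0) := by
    have h1 : Tendsto (fun N => (T N ^ 3)⁻¹) atTop (𝓝 0) :=
      tendsto_inv_atTop_zero.comp ((tendsto_pow_atTop (by norm_num)).comp hT)
    have h2 := (((tendsto_riemann hT (h := fun ξ => α ξ ^ 2 + gam (α ξ) ^ 2) (by fun_prop)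
      ?_).add hρl).div ((hρl.sub_const ρ).pow 2) ?_)
    · simpa using h1.mul h2
    · exact (hs.comp_left (g := fun t => t ^ 2 + gam t ^ 2) (by simp [gam_zero]))
    · exact pow_ne_zero 2 (sub_pos.mpr hlt).ne'
  have hEl : Tendsto E atTop (𝓝 (enDens v r α)) := by
    obtain ⟨K, hK⟩ := exists_bound_integral_lowPt hα hs
    obtain ⟨L, hL⟩ := exists_bound_integral_lowPt hg hgs
    refine (tendsto_riemann hT (h := fun ξ => disp ξ * gam (α ξ)) (by fun_prop)
      hgs.mul_left).add (Tendsto.const_mul _ ?_)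
    refine tendsto_integral_filter_of_dominated_convergence
      (fun x => v x * ((r + K) ^ 2 + 4 * r * L + 2 * L ^ 2)) ?_ ?_ ?_ ?_
    · have hm : ∀ (N : ℕ) {h : Vec 3 → ℝ}, Continuous h → Measurable fun x : Vec 3 =>
          ∫ ξ, h (lowPt (T N) ξ) * cos (2 * π * ∑ j, lowPt (T N) ξ j * x j) := by
        intro N h hh
        have hl := measurable_lowPt (T N)
        refine (StronglyMeasurable.integral_prod_right' (f := fun p : Vec 3 × Vec 3 =>
          h (lowPt (T N) p.2) * cos (2 * π * ∑ j, lowPt (T N) p.2 j * p.1 j)) ?_).measurable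
        have h1 : Measurable fun p : Vec 3 × Vec 3 => (lowPt (T N) p.2, p.1) :=
          (hl.comp measurable_snd).prodMk measurable_fst
        have h2 : Continuous fun p : Vec 3 × Vec 3 => h p.1 * cos (2 * π * ∑ j, p.1 j * p.2 j) := by
          fun_prop
        exact (h2.measurable.comp h1).stronglyMeasurable
      refine Eventually.of_forall fun N => Measurable.aestronglyMeasurable ?_
      have m1 := hm N hα
      have m2 := hm N hg
      have m3 := hv.measurable
      unfold pairDens
      fun_prop
    · filter_upwards [hT.eventually_ge_atTop 1] with N hN
      refine ae_of_all _ fun x => ?_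
      rw [norm_mul, Real.norm_of_nonneg (hv0 x)]
      refine mul_le_mul_of_nonneg_left ?_ (hv0 x)
      refine abs_pairDens_le hr (hK _ hN _ fun ξ => abs_cos_le_one _)
        (hL _ hN _ fun ξ => abs_cos_le_one _) ?_
      simpa using hL _ hN (fun _ => 1) (by simp)
    · exact (hv.integrable_of_hasCompactSupport hvs).mul_const _
    · refine ae_of_all _ fun x => Tendsto.const_mul _ ?_
      have t1 := tendsto_integral_cos hT hα hs x
      have t2 := tendsto_integral_cos hT hg hgs x
      have t3 := tendsto_integral_cos hT hg hgs 0
      simp only [Pi.zero_apply, mul_zero, Finset.sum_const_zero, cos_zero, mul_one] at t3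
      unfold pairDens
      exact (((((t1.const_sub r).pow 2).add (t2.const_mul _)).add (t2.pow 2)).add
        (t3.const_mul _)).add (t3.pow 2)
  have hl : Tendsto (fun N => E N / (1 - δ N)) atTop (𝓝 (enDens v r α)) := by
    have := hEl.div (hδl.const_sub 1) (by norm_num)
    rw [sub_zero, div_one] at this
    exact this
  unfold ePlus
  rw [← hl.limsup_eq]
  refine limsup_le_limsup ?_ ?_ hl.isBoundedUnder_le
  · filter_upwards [hmain, hδl.eventually_lt_const (show (0 : ℝ) < 1 by norm_num)] with N h1 h2
    rwa [le_div_iff₀ (by linarith)]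
  · refine Filter.IsCoboundedUnder.of_frequently_ge (a := 0) ?_
    refine Eventually.frequently ?_
    filter_upwards [hT.eventually_gt_atTop 0] with N h1
    exact div_nonneg (gsEnergy_nonneg _ _ _) (pow_pos h1 3).le

end thermo

section cutoff

/-- Continuous cutoff to the annulus `1/k ≤ ‖ξ‖ ≤ k + 1`. -/
def annCut (k : ℕ) (ξ : Vec 3) : ℝ :=
  max 0 (min 1 (k * ‖ξ‖ - 1)) * max 0 (min 1 (k + 1 - ‖ξ‖))

@[fun_prop]
lemma continuous_annCut (k : ℕ) : Continuous (annCut k) := by unfold annCut; fun_prop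

lemma annCut_neg (k : ℕ) (ξ : Vec 3) : annCut k (-ξ) = annCut k ξ := by simp [annCut]

lemma annCut_nonneg (k : ℕ) (ξ : Vec 3) : 0 ≤ annCut k ξ :=
  mul_nonneg (le_max_left _ _) (le_max_left _ _)

lemma annCut_le_one (k : ℕ) (ξ : Vec 3) : annCut k ξ ≤ 1 :=
  mul_le_one₀ (max_le zero_le_one (min_le_left _ _)) (le_max_left _ _)
    (max_le zero_le_one (min_le_left _ _))

lemma annCut_eq_zero_of_le (k : ℕ) {ξ : Vec 3} (h : k * ‖ξ‖ ≤ 1) : annCut k ξ = 0 := by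
  rw [annCut, max_eq_left ((min_le_right _ _).trans (by linarith)), zero_mul]

lemma annCut_eq_zero_of_ge (k : ℕ) {ξ : Vec 3} (h : k + 1 ≤ ‖ξ‖) : annCut k ξ = 0 := by
  rw [annCut, max_eq_left (a := (0 : ℝ)) (b := min 1 (k + 1 - ‖ξ‖))
    ((min_le_right _ _).trans (by linarith)), mul_zero]

lemma tendsto_annCut {ξ : Vec 3} (hξ : ξ ≠ 0) : Tendsto (fun k => annCut k ξ) atTop (𝓝 1) := by
  have h := norm_pos_iff.mpr hξ
  refine tendsto_const_nhds.congr' ?_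
  have t := tendsto_natCast_atTop_atTop (R := ℝ)
  filter_upwards [t.eventually_ge_atTop (2 / ‖ξ‖), t.eventually_ge_atTop ‖ξ‖] with k h1 h2
  rw [div_le_iff₀ h] at h1
  rw [annCut, min_eq_left (by linarith), min_eq_left (by linarith)]
  simp

variable {α : Vec 3 → ℝ}

lemma continuous_annCut_mul (hα : ContinuousOn α {0}ᶜ) (k : ℕ) :
    Continuous fun ξ => annCut k ξ * α ξ := by
  rw [continuous_iff_continuousAt]
  intro ξ
  by_cases hξ : ξ = 0
  · subst hξ
    have : (fun ξ => annCut k ξ * α ξ) =ᶠ[𝓝 0] fun _ => 0 := by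
      have hc : ContinuousAt (fun ξ : Vec 3 => (k : ℝ) * ‖ξ‖) 0 := by fun_prop
      have : ∀ᶠ ξ : Vec 3 in 𝓝 0, (k : ℝ) * ‖ξ‖ < 1 := hc.eventually_lt_const (by simp)
      filter_upwards [this] with ξ h
      rw [annCut_eq_zero_of_le k h.le, zero_mul]
    exact continuousAt_const.congr this.symm
  · exact (continuous_annCut k).continuousAt.mul (hα.continuousAt (isOpen_compl_singleton.mem_nhds hξ))

lemma hasCompactSupport_annCut_mul (k : ℕ) : HasCompactSupport fun ξ => annCut k ξ * α ξ := by
  refine HasCompactSupport.intro (isCompact_closedBall (0 : Vec 3) (k + 1)) fun ξ hξ => ?_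
  rw [mem_closedBall_zero_iff, not_le] at hξ
  rw [annCut_eq_zero_of_ge k hξ.le, zero_mul]

lemma abs_annCut_mul_le (k : ℕ) (ξ : Vec 3) : |annCut k ξ * α ξ| ≤ |α ξ| := by
  rw [abs_mul, abs_of_nonneg (annCut_nonneg k ξ)]
  exact mul_le_of_le_one_left (abs_nonneg _) (annCut_le_one k ξ)

lemma ae_ne_zero_vec : ∀ᵐ ξ : Vec 3, ξ ≠ 0 :=
  compl_mem_ae_iff.mpr (measure_singleton 0)

lemma tendsto_integral_annCut {F : ℝ → ℝ} (hF : Continuous F) (hF1 : ∀ t, |F t| ≤ |t|)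
    (hα : ContinuousOn α {0}ᶜ) (hi : Integrable α) {g : Vec 3 → ℝ} (hg : Continuous g)
    (hg1 : ∀ ξ, |g ξ| ≤ 1) :
    Tendsto (fun k => ∫ ξ, F (annCut k ξ * α ξ) * g ξ) atTop (𝓝 (∫ ξ, F (α ξ) * g ξ)) := by
  refine tendsto_integral_of_dominated_convergence (fun ξ => |α ξ|) ?_ hi.abs ?_ ?_
  · exact fun k => ((hF.comp (continuous_annCut_mul hα k)).mul hg).aestronglyMeasurable
  · intro k
    refine ae_of_all _ fun ξ => ?_
    rw [norm_mul]
    exact (mul_le_of_le_one_right (norm_nonneg _) (hg1 ξ)).trans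
      ((hF1 _).trans (abs_annCut_mul_le k ξ))
  · filter_upwards [ae_ne_zero_vec] with ξ hξ
    refine Tendsto.mul_const _ ((hF.tendsto _).comp ?_)
    simpa using (tendsto_annCut hξ).mul_const (α ξ)

lemma abs_integral_annCut_le {F : ℝ → ℝ} (hF1 : ∀ t, |F t| ≤ |t|)
    (hi : Integrable α) {g : Vec 3 → ℝ} (hg1 : ∀ ξ, |g ξ| ≤ 1) (k : ℕ) :
    |∫ ξ, F (annCut k ξ * α ξ) * g ξ| ≤ ∫ ξ, |α ξ| := by
  rw [← Real.norm_eq_abs]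
  refine norm_integral_le_of_norm_le hi.abs (ae_of_all _ fun ξ => ?_)
  rw [norm_mul]
  exact (mul_le_of_le_one_right (norm_nonneg _) (hg1 ξ)).trans
    ((hF1 _).trans (abs_annCut_mul_le k ξ))

lemma continuous_ft {h : Vec 3 → ℝ} (hi : Integrable h) : Continuous (ft h) := by
  unfold ft
  refine continuous_of_dominated (bound := fun ξ => |h ξ|) (fun x => ?_) (fun x => ?_) hi.abs ?_
  · exact hi.aestronglyMeasurable.mul (Continuous.aestronglyMeasurable (by fun_prop))
  · refine ae_of_all _ fun ξ => ?_
    rw [norm_mul]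
    exact mul_le_of_le_one_right (norm_nonneg _) (abs_cos_le_one _)
  · exact ae_of_all _ fun ξ => by fun_prop

/-- The energy upper bound for pairing functions which may be singular at the origin. -/
theorem ePlus_le {v : Vec 3 → ℝ} (hv : Continuous v) (hv0 : ∀ x, 0 ≤ v x)
    (hvs : HasCompactSupport v) (hα : ContinuousOn α {0}ᶜ) (hev : ∀ ξ, α (-ξ) = α ξ)
    (hi : Integrable α) (hi2 : Integrable fun ξ => disp ξ * α ξ ^ 2) {r ρ : ℝ} (hr : 0 ≤ r)
    (hρ : 0 < ρ) (hlt : ρ < r + ∫ ξ, gam (α ξ)) :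
    ePlus 3 (fun x => ENNReal.ofReal (v x)) ρ ≤ enDens v r α := by
  have hcos : ∀ x : Vec 3, Continuous fun ξ : Vec 3 => cos (2 * π * ∑ j, ξ j * x j) := fun x => by
    fun_prop
  have hcos1 : ∀ x ξ : Vec 3, |cos (2 * π * ∑ j, ξ j * x j)| ≤ 1 := fun x ξ => abs_cos_le_one _
  have hgam1 : ∀ t, |gam t| ≤ |t| := fun t => by
    rw [abs_of_nonneg (gam_nonneg t)]; exact gam_le_abs t
  have t0 := tendsto_integral_annCut continuous_gam hgam1 hα hi continuous_const
    (g := fun _ => 1) (by simp)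
  simp only [mul_one] at t0
  have hlim : Tendsto (fun k => enDens v r fun ξ => annCut k ξ * α ξ) atTop
      (𝓝 (enDens v r α)) := by
    unfold enDens
    refine Tendsto.add ?_ (Tendsto.const_mul _ ?_)
    · refine tendsto_integral_of_dominated_convergence (fun ξ => disp ξ * α ξ ^ 2) ?_ hi2 ?_ ?_
      · intro k
        exact (continuous_disp.mul
          (continuous_gam.comp (continuous_annCut_mul hα k))).aestronglyMeasurable
      · intro k
        refine ae_of_all _ fun ξ => ?_
        rw [norm_mul, Real.norm_of_nonneg (disp_nonneg ξ), Real.norm_of_nonneg (gam_nonneg _)]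
        refine mul_le_mul_of_nonneg_left ((gam_le_sq _).trans ?_) (disp_nonneg ξ)
        exact sq_le_sq.mpr (abs_annCut_mul_le k ξ)
      · filter_upwards [ae_ne_zero_vec] with ξ hξ
        refine Tendsto.const_mul _ ((continuous_gam.tendsto _).comp ?_)
        simpa using (tendsto_annCut hξ).mul_const (α ξ)
    · set K := ∫ ξ, |α ξ|
      have hci : ∀ k, Integrable fun ξ => annCut k ξ * α ξ := fun k =>
        (continuous_annCut_mul hα k).integrable_of_hasCompactSupport (hasCompactSupport_annCut_mul k)
      have hgi : ∀ k, Integrable fun ξ => gam (annCut k ξ * α ξ) := fun k =>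
        (continuous_gam.comp (continuous_annCut_mul hα k)).integrable_of_hasCompactSupport
          (hasCompactSupport_gam (hasCompactSupport_annCut_mul k))
      refine tendsto_integral_of_dominated_convergence
        (fun x => v x * ((r + K) ^ 2 + 4 * r * K + 2 * K ^ 2)) ?_ ?_ ?_ ?_
      · intro k
        have c1 := continuous_ft (hci k)
        have c2 := continuous_ft (hgi k)
        unfold pairDens
        exact Continuous.aestronglyMeasurable (by fun_prop)
      · exact (hv.integrable_of_hasCompactSupport hvs).mul_const _
      · intro k
        refine ae_of_all _ fun x => ?_
        rw [norm_mul, Real.norm_of_nonneg (hv0 x)]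
        refine mul_le_mul_of_nonneg_left (abs_pairDens_le hr ?_ ?_ ?_) (hv0 x)
        · exact abs_integral_annCut_le (F := id) (fun _ => le_rfl) hi (hcos1 x) k
        · exact abs_integral_annCut_le hgam1 hi (hcos1 x) k
        · exact abs_integral_annCut_le hgam1 hi (hcos1 0) k
      · refine ae_of_all _ fun x => Tendsto.const_mul _ ?_
        have t1 : Tendsto (fun k => ft (fun ξ => annCut k ξ * α ξ) x) atTop (𝓝 (ft α x)) :=
          tendsto_integral_annCut (F := id) continuous_id (fun _ => le_rfl) hα hi (hcos x) (hcos1 x)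
        have t2 : ∀ x, Tendsto (fun k => ft (fun ξ => gam (annCut k ξ * α ξ)) x) atTop
            (𝓝 (ft (fun ξ => gam (α ξ)) x)) := fun x =>
          tendsto_integral_annCut continuous_gam hgam1 hα hi (hcos x) (hcos1 x)
        unfold pairDens
        exact (((((t1.const_sub r).pow 2).add ((t2 x).const_mul _)).add ((t2 x).pow 2)).add
          ((t2 0).const_mul _)).add ((t2 0).pow 2)
  refine ge_of_tendsto hlim ?_
  filter_upwards [(t0.const_add r).eventually_const_lt hlt] with k hk
  exact ePlus_le_of_compact hv hv0 hvs (continuous_annCut_mul hα k) (hasCompactSupport_annCut_mul k)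
    (fun ξ => by rw [annCut_neg, hev]) (by simp [annCut_eq_zero_of_le]) hr hρ hk

end cutoff

section fourier
open scoped SchwartzMap FourierTransform LineDeriv ContDiff
open SchwartzMap

/-- Euclidean three-space. -/
abbrev E3 := EuclideanSpace ℝ (Fin 3)

lemma integral_ofLp {F : Type*} [NormedAddCommGroup F] [NormedSpace ℝ F] (f : Vec 3 → F) :
    ∫ x : E3, f x.ofLp = ∫ x, f x :=
  (PiLp.volume_preserving_ofLp (Fin 3)).integral_comp
    (MeasurableEquiv.toLp 2 (Fin 3 → ℝ)).symm.measurableEmbedding f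

lemma integrable_ofLp {F : Type*} [NormedAddCommGroup F] {f : Vec 3 → F} :
    Integrable (fun x : E3 => f x.ofLp) ↔ Integrable f :=
  (PiLp.volume_preserving_ofLp (Fin 3)).integrable_comp_emb
    (MeasurableEquiv.toLp 2 (Fin 3 → ℝ)).symm.measurableEmbedding

variable {g : Vec 3 → ℝ}

/-- A test function as a Schwartz function on Euclidean space. -/
def toS (hg : ContDiff ℝ (⊤ : ℕ∞) g) (hs : HasCompactSupport g) : 𝓢(E3, ℂ) :=
  HasCompactSupport.toSchwartzMap (f := fun x : E3 => (g x.ofLp : ℂ))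
    ((hs.comp_homeomorph (PiLp.homeomorph 2 (fun _ : Fin 3 => ℝ))).comp_left (g := fun t : ℝ => (t : ℂ)) rfl)
    (Complex.ofRealCLM.contDiff.comp
      (hg.comp (PiLp.continuousLinearEquiv 2 ℝ (fun _ : Fin 3 => ℝ)).contDiff))

lemma toS_apply (hg : ContDiff ℝ (⊤ : ℕ∞) g) (hs : HasCompactSupport g) (x : E3) :
    toS hg hs x = (g x.ofLp : ℂ) := rfl

lemma inner_E3 (x y : E3) : inner ℝ x y = ∑ j, x.ofLp j * y.ofLp j := by
  simp [PiLp.inner_apply, mul_comm]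

lemma re_fourier_toS (hg : ContDiff ℝ (⊤ : ℕ∞) g) (hs : HasCompactSupport g) (ξ : E3) :
    (𝓕 (toS hg hs) ξ).re = ft g ξ.ofLp := by
  have hi : Integrable fun x : E3 => Complex.exp (↑(-2 * π * inner ℝ x ξ) * Complex.I) •
      (toS hg hs x) := by
    refine (toS hg hs).integrable.norm.mono' ?_ (ae_of_all _ fun x => ?_)
    · have := (toS hg hs).continuous
      exact Continuous.aestronglyMeasurable (by fun_prop)
    · rw [norm_smul, Complex.norm_exp_ofReal_mul_I, one_mul]
  rw [SchwartzMap.fourier_coe, Real.fourier_eq', ← RCLike.re_eq_complex_re, ← integral_re hi, ft,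
    ← integral_ofLp]
  refine integral_congr_ae (ae_of_all _ fun x => ?_)
  simp only [toS_apply, smul_eq_mul, RCLike.re_eq_complex_re, Complex.re_mul_ofReal,
    Complex.exp_ofReal_mul_I_re, inner_E3]
  rw [mul_comm, neg_mul, neg_mul, cos_neg]

lemma integrable_ft (hg : ContDiff ℝ (⊤ : ℕ∞) g) (hs : HasCompactSupport g) :
    Integrable (ft g) := by
  rw [← integrable_ofLp]
  simp_rw [← re_fourier_toS hg hs]
  exact (𝓕 (toS hg hs)).integrable.re

lemma ft_neg {h : Vec 3 → ℝ} (x : Vec 3) : ft h (-x) = ft h x := by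
  simp [ft, Finset.sum_neg_distrib]

lemma ft_ft (hg : ContDiff ℝ (⊤ : ℕ∞) g) (hs : HasCompactSupport g) (x : Vec 3) :
    ft (ft g) x = (g x + g (-x)) / 2 := by
  have inv : ∀ y : E3, ∫ ξ : E3, Complex.exp (↑(2 * π * inner ℝ ξ y) * Complex.I) •
      𝓕 (toS hg hs) ξ = g y.ofLp := by
    intro y
    have h := congrArg (fun f : 𝓢(E3, ℂ) => f y) (FourierTransform.fourierInv_fourier_eq (E := 𝓢(E3, ℂ)) (F := 𝓢(E3, ℂ)) (toS hg hs))
    simp only [toS_apply] at h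
    rw [SchwartzMap.fourierInv_coe, Real.fourierInv_eq'] at h
    exact h
  have hi : ∀ y : E3, Integrable fun ξ : E3 => Complex.exp (↑(2 * π * inner ℝ ξ y) * Complex.I) •
      𝓕 (toS hg hs) ξ := by
    intro y
    refine (𝓕 (toS hg hs)).integrable.norm.mono' ?_ (ae_of_all _ fun x => ?_)
    · have := (𝓕 (toS hg hs)).continuous
      exact Continuous.aestronglyMeasurable (by fun_prop)
    · rw [norm_smul, Complex.norm_exp_ofReal_mul_I, one_mul]
  set y : E3 := WithLp.toLp 2 x
  have h1 := inv y
  have h2 := inv (-y)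
  have h3 := integral_add (hi y) (hi (-y))
  rw [h1, h2] at h3
  have h4 := congrArg Complex.re h3
  rw [← RCLike.re_eq_complex_re, ← integral_re (f := fun ξ : E3 =>
    Complex.exp (↑(2 * π * inner ℝ ξ y) * Complex.I) • 𝓕 (toS hg hs) ξ +
    Complex.exp (↑(2 * π * inner ℝ ξ (-y)) * Complex.I) • 𝓕 (toS hg hs) ξ)
    ((hi y).add (hi (-y)))] at h4
  have h5 : ∀ ξ : E3, RCLike.re (Complex.exp (↑(2 * π * inner ℝ ξ y) * Complex.I) •
      𝓕 (toS hg hs) ξ + Complex.exp (↑(2 * π * inner ℝ ξ (-y)) * Complex.I) •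
      𝓕 (toS hg hs) ξ) = 2 * (ft g ξ.ofLp * cos (2 * π * ∑ j, ξ.ofLp j * x j)) := by
    intro ξ
    rw [← re_fourier_toS hg hs]
    simp only [smul_eq_mul, RCLike.re_eq_complex_re, inner_neg_right, mul_neg,
      ← add_mul, Complex.add_re, Complex.mul_re, Complex.add_im, Complex.exp_ofReal_mul_I_re,
      Complex.exp_ofReal_mul_I_im, cos_neg, sin_neg, inner_E3]
    ring
  have h6 : ∫ ξ : E3, (2 * (ft g ξ.ofLp * cos (2 * π * ∑ j, ξ.ofLp j * x j))) =
      g x + g (-x) := by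
    have e : RCLike.re ((g y.ofLp : ℂ) + g (-y).ofLp) = g x + g (-x) := by
      rw [← Complex.ofReal_add]; rfl
    rw [← e, ← h4]
    exact integral_congr_ae (ae_of_all _ fun ξ => (h5 ξ).symm)
  rw [integral_ofLp (fun ξ => 2 * (ft g ξ * cos (2 * π * ∑ j, ξ j * x j))), integral_const_mul]
    at h6
  unfold ft at h6 ⊢
  linarith

lemma fderiv_toS (hg : ContDiff ℝ (⊤ : ℕ∞) g) (hs : HasCompactSupport g) (k : Fin 3) (x : E3) :
    (∂_{EuclideanSpace.single k (1 : ℝ)} (toS hg hs)) x =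
      ((fderiv ℝ g x.ofLp (Pi.single k 1) : ℝ) : ℂ) := by
  rw [SchwartzMap.lineDerivOp_apply_eq_fderiv]
  have h1 : HasFDerivAt (fun x : E3 => g x.ofLp)
      ((fderiv ℝ g x.ofLp).comp
        (PiLp.continuousLinearEquiv 2 ℝ (fun _ : Fin 3 => ℝ) : E3 →L[ℝ] Vec 3)) x :=
    HasFDerivAt.comp x ((hg.differentiable (by simp)) x.ofLp).hasFDerivAt
      (PiLp.continuousLinearEquiv 2 ℝ (fun _ : Fin 3 => ℝ)).hasFDerivAt
  have h2 : HasFDerivAt (toS hg hs) (Complex.ofRealCLM.comp ((fderiv ℝ g x.ofLp).comp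
        (PiLp.continuousLinearEquiv 2 ℝ (fun _ : Fin 3 => ℝ) : E3 →L[ℝ] Vec 3))) x :=
    HasFDerivAt.comp x Complex.ofRealCLM.hasFDerivAt h1
  rw [h2.fderiv]
  rfl

lemma norm_fourier_lineDeriv (hg : ContDiff ℝ (⊤ : ℕ∞) g) (hs : HasCompactSupport g) (k : Fin 3)
    (ξ : E3) : ‖(𝓕 (∂_{EuclideanSpace.single k (1 : ℝ)} (toS hg hs))) ξ‖ =
      2 * π * |ξ.ofLp k| * ‖(𝓕 (toS hg hs)) ξ‖ := by
  rw [SchwartzMap.fourier_lineDerivOp_eq]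
  rw [smul_apply, SchwartzMap.smulLeftCLM_apply_apply (by fun_prop)]
  rw [norm_smul, norm_smul]
  have : inner ℝ ξ (EuclideanSpace.single k (1 : ℝ)) = ξ.ofLp k := by
    simp [EuclideanSpace.inner_single_right]
  rw [this]
  simp [abs_of_pos Real.pi_pos]
  ring

lemma integrable_disp_sq_ft (hg : ContDiff ℝ (⊤ : ℕ∞) g) (hs : HasCompactSupport g) :
    Integrable (fun ξ => disp ξ * ft g ξ ^ 2) ∧
    ∫ ξ, disp ξ * ft g ξ ^ 2 ≤ ∫ x, ∑ k, (fderiv ℝ g x (Pi.single k 1)) ^ 2 := by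
  have hik : ∀ k : Fin 3, Integrable fun ξ : E3 =>
      (2 * π) ^ 2 * ξ.ofLp k ^ 2 * ‖(𝓕 (toS hg hs)) ξ‖ ^ 2 := by
    intro k
    have h := ((𝓕 (∂_{EuclideanSpace.single k (1 : ℝ)} (toS hg hs))).memLp 2).integrable_norm_pow
      (by norm_num)
    refine h.congr (ae_of_all _ fun ξ => ?_)
    simp only [norm_fourier_lineDeriv]
    simp [mul_pow]
  have hk : ∀ k : Fin 3, ∫ ξ : E3, (2 * π) ^ 2 * ξ.ofLp k ^ 2 * ‖(𝓕 (toS hg hs)) ξ‖ ^ 2 =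
      ∫ x, (fderiv ℝ g x (Pi.single k 1)) ^ 2 := by
    intro k
    rw [← integral_ofLp]
    have h := SchwartzMap.integral_norm_sq_fourier
      (∂_{EuclideanSpace.single k (1 : ℝ)} (toS hg hs))
    simp_rw [norm_fourier_lineDeriv, fderiv_toS, Complex.norm_real] at h
    simpa [mul_pow] using h
  have hd : ∀ k : Fin 3, Integrable fun x => (fderiv ℝ g x (Pi.single k 1)) ^ 2 := by
    intro k
    have hc : Continuous (fderiv ℝ g) := hg.continuous_fderiv (by simp)
    refine Continuous.integrable_of_hasCompactSupport (by fun_prop) ?_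
    exact ((hs.fderiv (𝕜 := ℝ)).comp_left (g := fun L : Vec 3 →L[ℝ] ℝ => (L (Pi.single k 1)) ^ 2)
      (by simp))
  have hle : ∀ ξ : E3, disp ξ.ofLp * ft g ξ.ofLp ^ 2 ≤
      ∑ k : Fin 3, (2 * π) ^ 2 * ξ.ofLp k ^ 2 * ‖(𝓕 (toS hg hs)) ξ‖ ^ 2 := by
    intro ξ
    rw [disp, ← re_fourier_toS hg hs, ← Finset.sum_mul, ← Finset.mul_sum]
    gcongr _ * ?_
    rw [← sq_abs]
    exact pow_le_pow_left₀ (abs_nonneg _) (Complex.abs_re_le_norm _) _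
  have hI : Integrable fun ξ : E3 => disp ξ.ofLp * ft g ξ.ofLp ^ 2 := by
    refine (integrable_finsetSum Finset.univ fun k _ => hik k).mono' ?_
      (ae_of_all _ fun ξ => ?_)
    · have h1 := continuous_disp
      have h2 : Continuous (ft g) :=
        continuous_ft (hg.continuous.integrable_of_hasCompactSupport hs)
      exact Continuous.aestronglyMeasurable (by fun_prop)
    · rw [Real.norm_of_nonneg (mul_nonneg (disp_nonneg _) (sq_nonneg _))]
      exact hle ξ
  refine ⟨integrable_ofLp.1 hI, ?_⟩
  rw [← integral_ofLp, integral_finsetSum _ fun k _ => hd k]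
  simp_rw [← hk]
  rw [← integral_finsetSum _ fun k _ => hik k]
  exact integral_mono hI (integrable_finsetSum _ fun k _ => hik k) hle

end fourier

section
lemma norm_sq_le_disp (ξ : Vec 3) : ‖ξ‖ ^ 2 ≤ disp ξ := by
  have h1 : ‖ξ‖ ^ 2 ≤ ∑ j, ξ j ^ 2 := by
    have : ‖ξ‖ ≤ √(∑ j, ξ j ^ 2) := by
      refine (pi_norm_le_iff_of_nonneg (Real.sqrt_nonneg _)).2 fun j => ?_
      rw [Real.norm_eq_abs, ← Real.sqrt_sq_eq_abs]
      exact Real.sqrt_le_sqrt (Finset.single_le_sum (f := fun j => ξ j ^ 2)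
        (fun i _ => sq_nonneg _) (Finset.mem_univ j))
    calc ‖ξ‖ ^ 2 ≤ √(∑ j, ξ j ^ 2) ^ 2 := by gcongr
      _ = _ := Real.sq_sqrt (Finset.sum_nonneg fun i _ => sq_nonneg _)
  have h2 : 1 ≤ (2 * π) ^ 2 := by nlinarith [Real.pi_gt_three]
  have h3 : 0 ≤ ∑ j, ξ j ^ 2 := Finset.sum_nonneg fun i _ => sq_nonneg _
  unfold disp
  nlinarith

lemma disp_pos {ξ : Vec 3} (h : ξ ≠ 0) : 0 < disp ξ :=
  lt_of_lt_of_le (by positivity) (norm_sq_le_disp ξ)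

lemma measurableSet_low : MeasurableSet {ξ : Vec 3 | disp ξ ≤ 1} :=
  (isClosed_le continuous_disp continuous_const).measurableSet

lemma integrableOn_disp_inv : IntegrableOn (fun ξ : Vec 3 => (disp ξ)⁻¹) {ξ | disp ξ ≤ 1} := by
  have h0 : IntegrableOn (fun ξ : Vec 3 => (‖ξ‖ ^ 2)⁻¹) (Metric.ball 0 2) := by
    rw [integrableOn_fun_norm_addHaar (μ := volume) (f := fun r : ℝ => (r ^ 2)⁻¹)]
    have : IntegrableOn (fun _ : ℝ => (1 : ℝ)) (Set.Ioo 0 2) := by simp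
    refine this.congr_fun (fun y hy => ?_) measurableSet_Ioo
    have : y ≠ 0 := hy.1.ne'
    simp [this]
  have h1 : {ξ : Vec 3 | disp ξ ≤ 1} ⊆ Metric.ball 0 2 := by
    intro ξ hξ
    have := (norm_sq_le_disp ξ).trans hξ
    rw [mem_ball_zero_iff]
    nlinarith [norm_nonneg ξ]
  refine (h0.mono_set h1).mono' ?_ ?_
  · exact (continuous_disp.measurable.inv).aestronglyMeasurable
  · refine ae_restrict_of_ae ?_
    filter_upwards [ae_ne_zero_vec] with ξ hξ
    rw [Real.norm_of_nonneg (inv_nonneg.2 (disp_nonneg _))]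
    have : 0 < ‖ξ‖ := norm_pos_iff.2 hξ
    exact inv_anti₀ (by positivity) (norm_sq_le_disp ξ)

/-- The low-momentum integral of the inverse dispersion. -/
def lowInt : ℝ := ∫ ξ : Vec 3 in {ξ | disp ξ ≤ 1}, (disp ξ)⁻¹

lemma lowInt_nonneg : 0 ≤ lowInt := integral_nonneg fun ξ => inv_nonneg.2 (disp_nonneg ξ)

lemma integrable_div_disp {φ : Vec 3 → ℝ} {B : ℝ} (hi : Integrable φ) (hB : ∀ ξ, |φ ξ| ≤ B) :
    Integrable (fun ξ => φ ξ / disp ξ) ∧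
      ∫ ξ, |φ ξ / disp ξ| ≤ B * lowInt + ∫ ξ, |φ ξ| := by
  have hB0 : 0 ≤ B := (abs_nonneg _).trans (hB 0)
  have hle : ∀ ξ, |φ ξ / disp ξ| ≤
      Set.indicator {ξ | disp ξ ≤ 1} (fun ξ => B * (disp ξ)⁻¹) ξ + |φ ξ| := by
    intro ξ
    rw [abs_div, abs_of_nonneg (disp_nonneg ξ)]
    by_cases h : disp ξ ≤ 1
    · rw [Set.indicator_of_mem (by exact h), div_eq_mul_inv]
      have := mul_le_mul_of_nonneg_right (hB ξ) (inv_nonneg.2 (disp_nonneg ξ))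
      linarith [abs_nonneg (φ ξ)]
    · rw [Set.indicator_of_notMem (by exact h), zero_add]
      exact div_le_self (abs_nonneg _) (not_le.1 h).le
  have hI : Integrable (Set.indicator {ξ : Vec 3 | disp ξ ≤ 1} (fun ξ => B * (disp ξ)⁻¹)) :=
    (integrable_indicator_iff measurableSet_low).2 (integrableOn_disp_inv.const_mul B)
  have hQ : Integrable (fun ξ => φ ξ / disp ξ) := by
    refine (hI.add hi.abs).mono' ?_ (ae_of_all _ hle)
    exact (hi.aestronglyMeasurable.aemeasurable.div
      continuous_disp.measurable.aemeasurable).aestronglyMeasurable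
  refine ⟨hQ, (integral_mono hQ.abs (hI.add hi.abs) hle).trans_eq ?_⟩
  rw [integral_add' hI hi.abs, integral_indicator measurableSet_low, integral_const_mul]
  rfl

lemma abs_ft_le {h : Vec 3 → ℝ} (hi : Integrable h) (x : Vec 3) : |ft h x| ≤ ∫ ξ, |h ξ| := by
  refine (abs_integral_le_integral_abs).trans (integral_mono_of_nonneg
    (ae_of_all _ fun ξ => abs_nonneg _) hi.abs (ae_of_all _ fun ξ => ?_))
  simp only [abs_mul]
  exact mul_le_of_le_one_right (abs_nonneg _) (abs_cos_le_one _)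

lemma integrable_mul_cos {h : Vec 3 → ℝ} (hi : Integrable h) (x : Vec 3) :
    Integrable fun ξ => h ξ * cos (2 * π * ∑ j, ξ j * x j) := by
  refine hi.abs.mono' (hi.aestronglyMeasurable.mul
    (by fun_prop : Continuous fun ξ : Vec 3 => cos (2 * π * ∑ j, ξ j * x j)).aestronglyMeasurable)
    (ae_of_all _ fun ξ => ?_)
  rw [Real.norm_eq_abs, abs_mul]
  exact mul_le_of_le_one_right (abs_nonneg _) (abs_cos_le_one _)

lemma ft_sub {h k : Vec 3 → ℝ} (hh : Integrable h) (hk : Integrable k) (x : Vec 3) :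
    ft (fun ξ => h ξ - k ξ) x = ft h x - ft k x := by
  simp only [ft, sub_mul]
  exact integral_sub (integrable_mul_cos hh x) (integrable_mul_cos hk x)

lemma ft_const_mul (c : ℝ) (h : Vec 3 → ℝ) (x : Vec 3) :
    ft (fun ξ => c * h ξ) x = c * ft h x := by
  simp only [ft, mul_assoc, integral_const_mul]

lemma ft_zero_arg (h : Vec 3 → ℝ) : ft h 0 = ∫ ξ, h ξ := by simp [ft]

lemma integrable_prod_cos {h k : Vec 3 → ℝ} (hh : Integrable h) (hk : Integrable k) :
    Integrable (fun z : Vec 3 × Vec 3 => h z.1 * k z.2 * cos (2 * π * ∑ j, z.1 j * z.2 j))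
      (volume.prod volume) := by
  have := hh.mul_prod hk
  refine this.abs.mono' (this.aestronglyMeasurable.mul
    (by fun_prop : Continuous fun z : Vec 3 × Vec 3 =>
      cos (2 * π * ∑ j, z.1 j * z.2 j)).aestronglyMeasurable) (ae_of_all _ fun ξ => ?_)
  rw [Real.norm_eq_abs, abs_mul]
  exact mul_le_of_le_one_right (abs_nonneg _) (abs_cos_le_one _)

/-- Fubini's theorem for the cosine transform. -/
lemma integral_mul_ft {h k : Vec 3 → ℝ} (hh : Integrable h) (hk : Integrable k) :
    ∫ ξ, h ξ * ft k ξ = ∫ x, ft h x * k x := by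
  have := integral_integral_swap (f := fun x y : Vec 3 => h x * k y * cos (2 * π * ∑ j, x j * y j))
    (integrable_prod_cos hh hk)
  simp only [ft, ← integral_const_mul, ← integral_mul_const]
  refine Eq.trans ?_ (this.trans ?_)
  · refine integral_congr_ae (ae_of_all _ fun x => integral_congr_ae (ae_of_all _ fun y => ?_))
    simp only [mul_comm (x _) (y _)]
    ring
  · refine integral_congr_ae (ae_of_all _ fun x => integral_congr_ae (ae_of_all _ fun y => ?_))
    simp only
    ring

lemma integrable_mul_ft {h k : Vec 3 → ℝ} (hh : Integrable h) (hk : Integrable k) :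
    Integrable fun ξ => h ξ * ft k ξ := by
  have hc := continuous_ft hk
  refine (hh.abs.mul_const (∫ ξ, |k ξ|)).mono' (hh.aestronglyMeasurable.mul
    hc.aestronglyMeasurable) (ae_of_all _ fun ξ => ?_)
  rw [Real.norm_eq_abs, abs_mul]
  exact mul_le_mul_of_nonneg_left (abs_ft_le hk ξ) (abs_nonneg _)

/-- The cosine transform of a product as a symmetrized convolution. -/
lemma ft_mul_ft {v μ : Vec 3 → ℝ} (hv : Integrable v) (hμ : Integrable μ) (ξ : Vec 3) :
    ft (fun x => v x * ft μ x) ξ = ∫ η, (ft v (ξ - η) + ft v (ξ + η)) / 2 * μ η := by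
  have h1 : ft (fun x => v x * ft μ x) ξ =
      ∫ x, (v x * cos (2 * π * ∑ j, x j * ξ j)) * ft μ x := by
    unfold ft
    congr 1; ext x; ring
  rw [h1, integral_mul_ft (integrable_mul_cos hv ξ) hμ]
  congr 1; ext η
  congr 1
  have h2 : ft v (ξ - η) + ft v (ξ + η) = 2 * ft (fun x => v x * cos (2 * π * ∑ j, x j * ξ j)) η := by
    unfold ft
    rw [← integral_add (integrable_mul_cos hv _) (integrable_mul_cos hv _), ← integral_const_mul]
    congr 1; ext x
    have e1 : 2 * π * ∑ j, x j * (ξ - η) j = 2 * π * ∑ j, x j * ξ j - 2 * π * ∑ j, x j * η j := by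
      simp only [Pi.sub_apply, mul_sub, Finset.sum_sub_distrib]
    have e2 : 2 * π * ∑ j, x j * (ξ + η) j = 2 * π * ∑ j, x j * ξ j + 2 * π * ∑ j, x j * η j := by
      simp only [Pi.add_apply, mul_add, Finset.sum_add_distrib]
    rw [e1, e2, cos_sub, cos_add]
    ring
  linarith

lemma integral_abs_ft_mul_ft_le {v μ : Vec 3 → ℝ} (hv : Integrable v) (hvh : Integrable (ft v))
    (hμ : Integrable μ) :
    Integrable (ft (fun x => v x * ft μ x)) ∧
      ∫ ξ, |ft (fun x => v x * ft μ x) ξ| ≤ (∫ ξ, |ft v ξ|) * ∫ η, |μ η| := by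
  set F : Vec 3 × Vec 3 → ℝ := fun z => (ft v (z.2 - z.1) + ft v (z.2 + z.1)) / 2 * μ z.1
  have hc := continuous_ft hv
  have hi1 : Integrable (fun z : Vec 3 × Vec 3 => μ z.1 * ft v (z.2 - z.1)) (volume.prod volume) := by
    have := (hμ.mul_prod hvh)
    have h2 := (measurePreserving_prod_neg_add (volume : Measure (Vec 3)) volume).integrable_comp_of_integrable this
    refine h2.congr (ae_of_all _ fun z => ?_)
    simp [sub_eq_neg_add]
  have hi2 : Integrable (fun z : Vec 3 × Vec 3 => μ z.1 * ft v (z.2 + z.1)) (volume.prod volume) := by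
    have := (hμ.mul_prod hvh)
    have h2 := (measurePreserving_prod_add (volume : Measure (Vec 3)) volume).integrable_comp_of_integrable this
    refine h2.congr (ae_of_all _ fun z => ?_)
    simp [add_comm]
  have hF : Integrable F (volume.prod volume) := by
    refine ((hi1.add hi2).div_const 2).congr (ae_of_all _ fun z => ?_)
    simp only [F, Pi.add_apply]; ring
  have hFi : Integrable (ft (fun x => v x * ft μ x)) := by
    refine hF.integral_prod_right.congr (ae_of_all _ fun ξ => ?_)
    simp only [F]
    rw [ft_mul_ft hv hμ]
  refine ⟨hFi, ?_⟩
  have hA : ∫ ξ, |ft (fun x => v x * ft μ x) ξ| ≤ ∫ ξ, ∫ η, |F (η, ξ)| := by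
    refine integral_mono hFi.abs hF.abs.integral_prod_right fun ξ => ?_
    simp only
    rw [ft_mul_ft hv hμ]
    exact abs_integral_le_integral_abs
  refine hA.trans ?_
  rw [← integral_integral_swap (f := fun η ξ => |F (η, ξ)|) hF.abs, ← integral_const_mul]
  refine integral_mono hF.abs.integral_prod_left (hμ.abs.const_mul _) fun η => ?_
  simp only
  have j1 : Integrable fun ξ => |ft v (ξ - η)| := (hvh.abs).comp_sub_right η
  have j2 : Integrable fun ξ => |ft v (ξ + η)| := (hvh.abs).comp_add_right η
  calc ∫ ξ, |F (η, ξ)| ≤ ∫ ξ, (|ft v (ξ - η)| + |ft v (ξ + η)|) / 2 * |μ η| := by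
        refine integral_mono_of_nonneg (ae_of_all _ fun ξ => abs_nonneg _)
          (((j1.add j2).div_const 2).mul_const _) (ae_of_all _ fun ξ => ?_)
        simp only [F, abs_mul]
        gcongr
        rw [abs_div, abs_two]
        gcongr
        exact abs_add_le _ _
    _ = (∫ ξ, |ft v ξ|) * |μ η| := by
        rw [integral_mul_const, integral_div, integral_add j1 j2,
          integral_sub_right_eq_self (fun ξ => |ft v ξ|),
          integral_add_right_eq_self (fun ξ => |ft v ξ|)]
        ring

end

section
lemma ft_congr {h k : Vec 3 → ℝ} (e : h =ᵐ[volume] k) : ft h = ft k := by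
  ext x
  refine integral_congr_ae ?_
  filter_upwards [e] with ξ hξ
  rw [hξ]

/-- The coupling parameter controlling the scattering equation. -/
def coupling (v : Vec 3 → ℝ) : ℝ := (∫ x, v x) * lowInt + ∫ ξ, |ft v ξ|

lemma coupling_const_mul (c : ℝ) (hc : 0 ≤ c) (v : Vec 3 → ℝ) :
    coupling (fun x => c * v x) = c * coupling v := by
  unfold coupling
  simp_rw [ft_const_mul, integral_const_mul, abs_mul, abs_of_nonneg hc, integral_const_mul]
  ring

variable {v : Vec 3 → ℝ}

lemma coupling_nonneg (hv0 : ∀ x, 0 ≤ v x) : 0 ≤ coupling v :=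
  add_nonneg (mul_nonneg (integral_nonneg hv0) lowInt_nonneg)
    (integral_nonneg fun _ => abs_nonneg _)

lemma integrable_scat_op (hv0 : ∀ x, 0 ≤ v x) (hv : Integrable v) (hvh : Integrable (ft v))
    {μ : Vec 3 → ℝ} (hμ : Integrable μ) :
    Integrable (fun ξ => ft (fun x => v x * ft μ x) ξ / disp ξ) ∧
      ∫ ξ, |ft (fun x => v x * ft μ x) ξ / disp ξ| ≤ coupling v * ∫ ξ, |μ ξ| := by
  obtain ⟨h1, h2⟩ := integral_abs_ft_mul_ft_le hv hvh hμ
  have hB : ∀ ξ, |ft (fun x => v x * ft μ x) ξ| ≤ (∫ x, v x) * ∫ ξ, |μ ξ| := by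
    intro ξ
    refine (abs_ft_le (integrable_mul_ft hv hμ) ξ).trans ?_
    rw [← integral_mul_const]
    refine integral_mono (integrable_mul_ft hv hμ).abs (hv.mul_const _) fun x => ?_
    simp only
    rw [abs_mul, abs_of_nonneg (hv0 x)]
    exact mul_le_mul_of_nonneg_left (abs_ft_le hμ x) (hv0 x)
  obtain ⟨h3, h4⟩ := integrable_div_disp h1 hB
  refine ⟨h3, h4.trans ?_⟩
  unfold coupling
  nlinarith

lemma integrable_scat_src (hv0 : ∀ x, 0 ≤ v x) (hv : Integrable v) (hvh : Integrable (ft v)) :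
    Integrable (fun ξ => ft v ξ / disp ξ) ∧ ∫ ξ, |ft v ξ / disp ξ| ≤ coupling v := by
  refine integrable_div_disp hvh fun ξ => (abs_ft_le hv ξ).trans_eq ?_
  simp_rw [abs_of_nonneg (hv0 _)]

/-- Solvability of the zero-energy scattering equation in momentum space for weak coupling. -/
lemma exists_fixed_point (hv0 : ∀ x, 0 ≤ v x) (hv : Integrable v) (hvh : Integrable (ft v))
    (hA : coupling v ≤ 1) :
    ∃ μ : Vec 3 → ℝ, Integrable μ ∧ (∫ ξ, |μ ξ|) ≤ coupling v ∧
      μ =ᵐ[volume] fun ξ => (ft v ξ - ft (fun x => v x * ft μ x) ξ) / 2 / disp ξ := by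
  have hA0 := coupling_nonneg hv0
  obtain ⟨hs, hs'⟩ := integrable_scat_src hv0 hv hvh
  have hop := fun (μ : Vec 3 → ℝ) (hμ : Integrable μ) => integrable_scat_op hv0 hv hvh hμ
  have hintg : ∀ μ : Vec 3 → ℝ, Integrable μ →
      Integrable fun ξ => (ft v ξ - ft (fun x => v x * ft μ x) ξ) / 2 / disp ξ := by
    intro μ hμ
    refine ((hs.sub (hop μ hμ).1).div_const 2).congr (ae_of_all _ fun ξ => ?_)
    simp only [Pi.sub_apply]
    ring
  let Φ : Lp ℝ 1 (volume : Measure (Vec 3)) → Lp ℝ 1 (volume : Measure (Vec 3)) :=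
    fun μ => (hintg μ (L1.integrable_coeFn μ)).toL1 _
  have hΦ : ContractingWith (1 / 2) Φ := by
    refine ⟨by norm_num, LipschitzWith.of_dist_le_mul fun μ ν => ?_⟩
    have hμ := L1.integrable_coeFn μ
    have hν := L1.integrable_coeFn ν
    rw [dist_eq_norm, dist_eq_norm, L1.norm_eq_integral_norm, L1.norm_eq_integral_norm]
    have e1 : ∫ ξ, ‖(Φ μ - Φ ν) ξ‖ =
        ∫ ξ, (1 / 2) * |ft (fun x => v x * ft (fun ξ => μ ξ - ν ξ) x) ξ / disp ξ| := by
      refine integral_congr_ae ?_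
      filter_upwards [Lp.coeFn_sub (Φ μ) (Φ ν), (hintg μ hμ).coeFn_toL1, (hintg ν hν).coeFn_toL1]
        with ξ h1 h2 h3
      rw [h1, Pi.sub_apply]
      simp only [Φ]
      rw [h2, h3]
      have : ft (fun x => v x * ft (fun ξ => μ ξ - ν ξ) x) ξ =
          ft (fun x => v x * ft μ x) ξ - ft (fun x => v x * ft ν x) ξ := by
        simp_rw [ft_sub hμ hν, mul_sub]
        exact ft_sub (integrable_mul_ft hv hμ) (integrable_mul_ft hv hν) ξ
      have e : (1 / 2 : ℝ) = |1 / 2| := (abs_of_pos (by norm_num)).symm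
      rw [this, Real.norm_eq_abs, e, ← abs_mul, abs_sub_comm]
      congr 1
      ring
    rw [e1, integral_const_mul]
    have e2 : ∫ ξ, ‖(μ - ν) ξ‖ = ∫ ξ, |μ ξ - ν ξ| := by
      refine integral_congr_ae ?_
      filter_upwards [Lp.coeFn_sub μ ν] with ξ h1
      rw [h1]; rfl
    rw [e2]
    have := (hop (fun ξ => μ ξ - ν ξ) (hμ.sub hν)).2
    have h3 : coupling v * ∫ ξ, |μ ξ - ν ξ| ≤ 1 * ∫ ξ, |μ ξ - ν ξ| :=
      mul_le_mul_of_nonneg_right hA (integral_nonneg fun _ => abs_nonneg _)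
    have h4 : ((1 / 2 : ℝ≥0) : ℝ) = 1 / 2 := by norm_num
    rw [h4]
    linarith
  set μ := hΦ.fixedPoint Φ
  have hμ := L1.integrable_coeFn μ
  have hfix : (μ : Vec 3 → ℝ) =ᵐ[volume]
      fun ξ => (ft v ξ - ft (fun x => v x * ft μ x) ξ) / 2 / disp ξ := by
    have h1 : Φ μ = μ := hΦ.fixedPoint_isFixedPt
    have h2 := (hintg μ hμ).coeFn_toL1
    have h3 : (Φ μ : Vec 3 → ℝ) =ᵐ[volume]
        fun ξ => (ft v ξ - ft (fun x => v x * ft μ x) ξ) / 2 / disp ξ := h2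
    rwa [h1] at h3
  refine ⟨μ, hμ, ?_, hfix⟩
  have h5 : ∫ ξ, |μ ξ| ≤ 1 / 2 * (coupling v + coupling v * ∫ ξ, |μ ξ|) := by
    calc ∫ ξ, |μ ξ| = ∫ ξ, |(ft v ξ - ft (fun x => v x * ft μ x) ξ) / 2 / disp ξ| := by
          refine integral_congr_ae ?_
          filter_upwards [hfix] with ξ h1
          rw [← h1]
      _ ≤ ∫ ξ, 1 / 2 * (|ft v ξ / disp ξ| + |ft (fun x => v x * ft μ x) ξ / disp ξ|) := by
          refine integral_mono (hintg μ hμ).abs ((hs.abs.add (hop μ hμ).1.abs).const_mul _)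
            fun ξ => ?_
          simp only
          have : (ft v ξ - ft (fun x => v x * ft μ x) ξ) / 2 / disp ξ =
            1 / 2 * (ft v ξ / disp ξ - ft (fun x => v x * ft μ x) ξ / disp ξ) := by ring
          rw [this, abs_mul, abs_of_pos (by norm_num : (0 : ℝ) < 1 / 2)]
          gcongr
          exact abs_sub _ _
      _ ≤ _ := by
          rw [integral_const_mul, integral_add hs.abs (hop μ hμ).1.abs]
          have := (hop μ hμ).2
          linarith
  have h6 : 0 ≤ ∫ ξ, |μ ξ| := integral_nonneg fun _ => abs_nonneg _
  nlinarith

/-- Data of the zero-energy scattering problem for `v` in momentum space. -/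
structure IsScat (v s : Vec 3 → ℝ) : Prop where
  cont : Continuous s
  even : ∀ ξ, s (-ξ) = s ξ
  int : Integrable fun ξ => s ξ / disp ξ
  small : ∀ x, |ft (fun ξ => s ξ / disp ξ) x| ≤ coupling v
  eqn : ∀ ξ, s ξ = ft (fun x => v x * (1 - ft (fun ξ => s ξ / disp ξ) x)) ξ / 2

lemma exists_isScat (hv0 : ∀ x, 0 ≤ v x) (hv : Integrable v) (hvh : Integrable (ft v))
    (hA : coupling v ≤ 1) : ∃ s, IsScat v s := by
  obtain ⟨μ, hμ, hμ1, hfix⟩ := exists_fixed_point hv0 hv hvh hA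
  set s : Vec 3 → ℝ := fun ξ => (ft v ξ - ft (fun x => v x * ft μ x) ξ) / 2
  have hvm := integrable_mul_ft hv hμ
  have hft : ft (fun ξ => s ξ / disp ξ) = ft μ := ft_congr hfix.symm
  refine ⟨s, ?_, fun ξ => ?_, hμ.congr hfix, fun x => ?_, fun ξ => ?_⟩
  · have h1 := continuous_ft hv
    have h2 := continuous_ft hvm
    simp only [s]
    fun_prop
  · simp only [s, ft_neg]
  · rw [hft]
    exact (abs_ft_le hμ x).trans hμ1
  · rw [hft]
    simp only [s, mul_sub, mul_one]
    rw [ft_sub hv hvm]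

end

section
/-- The zero-energy scattering function `1 - w`. -/
def scatFun (s : Vec 3 → ℝ) (x : Vec 3) : ℝ := 1 - ft (fun ξ => s ξ / disp ξ) x

namespace IsScat

variable {v s : Vec 3 → ℝ}

lemma continuous_scatFun (h : IsScat v s) : Continuous (scatFun s) :=
  continuous_const.sub (continuous_ft h.int)

lemma scatFun_ge (h : IsScat v s) (x : Vec 3) : 1 - coupling v ≤ scatFun s x := by
  have := (abs_le.1 (h.small x)).2
  unfold scatFun
  linarith

lemma abs_scatFun_le (h : IsScat v s) (x : Vec 3) : |scatFun s x| ≤ 1 + coupling v := by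
  have := abs_le.1 (h.small x)
  unfold scatFun
  rw [abs_le]
  constructor <;> linarith [(abs_nonneg _).trans (h.small x)]

lemma integrable_mul_scatFun (h : IsScat v s) (hv : Integrable v) :
    Integrable fun x => v x * scatFun s x := by
  refine (hv.abs.mul_const (1 + coupling v)).mono' (hv.aestronglyMeasurable.mul
    h.continuous_scatFun.aestronglyMeasurable) (ae_of_all _ fun x => ?_)
  rw [Real.norm_eq_abs, abs_mul]
  exact mul_le_mul_of_nonneg_left (h.abs_scatFun_le x) (abs_nonneg _)

lemma two_mul_eq (h : IsScat v s) (ξ : Vec 3) : ft (fun x => v x * scatFun s x) ξ = 2 * s ξ := by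
  have := h.eqn ξ
  unfold scatFun
  linarith

lemma zero_eq (h : IsScat v s) : s 0 = (∫ x, v x * scatFun s x) / 2 := by
  rw [← ft_zero_arg, h.two_mul_eq]
  ring

lemma abs_le_zero (h : IsScat v s) (hv : Integrable v) (hv0 : ∀ x, 0 ≤ v x)
    (hc : coupling v ≤ 1) (ξ : Vec 3) : |s ξ| ≤ s 0 := by
  have h1 := abs_ft_le (h.integrable_mul_scatFun hv) ξ
  rw [h.two_mul_eq, abs_mul, abs_two] at h1
  have h2 : ∀ x, |v x * scatFun s x| = v x * scatFun s x := fun x =>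
    abs_of_nonneg (mul_nonneg (hv0 x) (by linarith [h.scatFun_ge x]))
  simp_rw [h2] at h1
  rw [h.zero_eq]
  linarith

lemma integral_le_zero (h : IsScat v s) (hv : Integrable v) (hv0 : ∀ x, 0 ≤ v x) :
    (1 - coupling v) * ((∫ x, v x) / 2) ≤ s 0 := by
  rw [h.zero_eq]
  have : (∫ x, v x) * (1 - coupling v) ≤ ∫ x, v x * scatFun s x := by
    rw [← integral_mul_const]
    exact integral_mono (hv.mul_const _) (h.integrable_mul_scatFun hv)
      fun x => mul_le_mul_of_nonneg_left (h.scatFun_ge x) (hv0 x)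
  linarith

lemma integral_mul (h : IsScat v s) (hv : Integrable v) {k : Vec 3 → ℝ} (hk : Integrable k) :
    ∫ ξ, s ξ * k ξ = (∫ x, v x * scatFun s x * ft k x) / 2 := by
  rw [integral_mul_ft (h.integrable_mul_scatFun hv) hk]
  simp_rw [h.two_mul_eq, mul_assoc, integral_const_mul]
  ring

lemma integrable_mul (h : IsScat v s) (hv : Integrable v) (hv0 : ∀ x, 0 ≤ v x)
    (hc : coupling v ≤ 1) {k : Vec 3 → ℝ} (hk : Integrable k) :
    Integrable fun ξ => s ξ * k ξ := by
  refine (hk.abs.const_mul (s 0)).mono' (h.cont.aestronglyMeasurable.mul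
    hk.aestronglyMeasurable) (ae_of_all _ fun ξ => ?_)
  rw [Real.norm_eq_abs, abs_mul]
  exact mul_le_mul_of_nonneg_right (h.abs_le_zero hv hv0 hc ξ) (abs_nonneg _)

lemma integrable_mul_sq {u : Vec 3 → ℝ} (hv : Integrable v) (hu : Continuous u) {B : ℝ}
    (hB : ∀ x, |u x| ≤ B) : Integrable fun x => v x * u x ^ 2 := by
  refine (hv.abs.mul_const (B ^ 2)).mono' (hv.aestronglyMeasurable.mul
    (hu.pow 2).aestronglyMeasurable) (ae_of_all _ fun x => ?_)
  rw [Real.norm_eq_abs, abs_mul, abs_pow]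
  exact mul_le_mul_of_nonneg_left (pow_le_pow_left₀ (abs_nonneg _) (hB x) 2) (abs_nonneg _)

lemma integrable_mul_scatFun_mul_ft (h : IsScat v s) (hv : Integrable v) {k : Vec 3 → ℝ}
    (hk : Integrable k) : Integrable fun x => v x * scatFun s x * ft k x :=
  integrable_mul_ft (h.integrable_mul_scatFun hv) hk

lemma integral_scatFun_sq (h : IsScat v s) (hv : Integrable v) :
    (∫ x, v x * scatFun s x ^ 2) / 2 = s 0 - ∫ ξ, s ξ * (s ξ / disp ξ) := by
  rw [h.integral_mul hv h.int, h.zero_eq, ← sub_div,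
    ← integral_sub (h.integrable_mul_scatFun hv) (h.integrable_mul_scatFun_mul_ft hv h.int)]
  congr 2
  ext x
  unfold scatFun
  ring

/-- Completing the square around the scattering solution. -/
lemma integral_sq (h : IsScat v s) (hv : Integrable v) (r : ℝ) {β : Vec 3 → ℝ}
    (hβ : Integrable β) :
    (∫ x, v x * (r * scatFun s x - ft β x) ^ 2) / 2 =
      r ^ 2 * s 0 - r ^ 2 * (∫ ξ, s ξ * (s ξ / disp ξ)) - 2 * r * (∫ ξ, s ξ * β ξ) +
        (∫ x, v x * ft β x ^ 2) / 2 := by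
  have i1 := integrable_mul_sq hv h.continuous_scatFun h.abs_scatFun_le
  have i2 := h.integrable_mul_scatFun_mul_ft hv hβ
  have i3 := integrable_mul_sq hv (continuous_ft hβ) (abs_ft_le hβ)
  have e : ∀ x, v x * (r * scatFun s x - ft β x) ^ 2 = r ^ 2 * (v x * scatFun s x ^ 2) -
      2 * r * (v x * scatFun s x * ft β x) + v x * ft β x ^ 2 := fun x => by ring
  simp_rw [e]
  have i4 : Integrable fun x => r ^ 2 * (v x * scatFun s x ^ 2) -
      2 * r * (v x * scatFun s x * ft β x) := (i1.const_mul _).sub (i2.const_mul _)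
  rw [integral_add i4 i3, integral_sub (i1.const_mul _) (i2.const_mul _),
    integral_const_mul, integral_const_mul, h.integral_mul hv hβ]
  have := h.integral_scatFun_sq hv
  linear_combination r ^ 2 * this

/-- The value of the scattering energy is a lower bound for all trial functions. -/
lemma le_energy (h : IsScat v s) (hv : Continuous v) (hvs : HasCompactSupport v)
    (hv0 : ∀ x, 0 ≤ v x) (hev : ∀ x, v (-x) = v x) (hc : coupling v ≤ 1)
    {g : Vec 3 → ℝ} (hg : ContDiff ℝ (⊤ : ℕ∞) g) (hs : HasCompactSupport g) :
    s 0 ≤ (∫ x, ∑ k, (fderiv ℝ g x (Pi.single k 1)) ^ 2) + (∫ x, v x * (1 - g x) ^ 2) / 2 := by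
  have hvi : Integrable v := hv.integrable_of_hasCompactSupport hvs
  have hP := integrable_ft hg hs
  obtain ⟨d1, d2⟩ := integrable_disp_sq_ft hg hs
  have hgb : ∃ B, ∀ x, |g x| ≤ B := hs.exists_bound_of_continuous hg.continuous
  obtain ⟨B, hB⟩ := hgb
  have m1 := h.integrable_mul hvi hv0 hc hP
  have m2 := h.integrable_mul hvi hv0 hc h.int
  have h1 : 2 * (∫ ξ, s ξ * ft g ξ) - ∫ ξ, s ξ * (s ξ / disp ξ) ≤ ∫ ξ, disp ξ * ft g ξ ^ 2 := by
    rw [← integral_const_mul, ← integral_sub (m1.const_mul 2) m2]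
    refine integral_mono_ae ((m1.const_mul 2).sub m2) d1 ?_
    filter_upwards [ae_ne_zero_vec] with ξ hξ
    have hd := disp_pos hξ
    have : 0 ≤ (disp ξ * ft g ξ - s ξ) ^ 2 / disp ξ := by positivity
    have e : (disp ξ * ft g ξ - s ξ) ^ 2 / disp ξ =
        disp ξ * ft g ξ ^ 2 - (2 * (s ξ * ft g ξ) - s ξ * (s ξ / disp ξ)) := by
      field_simp
      ring
    linarith
  have hfe : ∀ x, scatFun s (-x) = scatFun s x := fun x => by unfold scatFun; rw [ft_neg]
  have ig : Integrable fun x => v x * scatFun s x * g x := by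
    refine ((h.integrable_mul_scatFun hvi).abs.mul_const B).mono'
      ((h.integrable_mul_scatFun hvi).aestronglyMeasurable.mul
        hg.continuous.aestronglyMeasurable) (ae_of_all _ fun x => ?_)
    rw [Real.norm_eq_abs, abs_mul]
    exact mul_le_mul_of_nonneg_left (hB x) (abs_nonneg _)
  have ig' : Integrable fun x => v x * scatFun s x * g (-x) := by
    refine ig.comp_neg.congr (ae_of_all _ fun x => ?_)
    simp only [hev, hfe]
  have h2 : ∫ ξ, s ξ * ft g ξ = (∫ x, v x * scatFun s x * g x) / 2 := by
    rw [h.integral_mul hvi hP]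
    simp_rw [ft_ft hg hs]
    have e : ∀ x, v x * scatFun s x * ((g x + g (-x)) / 2) =
      (v x * scatFun s x * g x + v x * scatFun s x * g (-x)) / 2 := fun x => by ring
    have e2 : ∫ x, v x * scatFun s x * g (-x) = ∫ x, v x * scatFun s x * g x := by
      rw [← integral_neg_eq_self (fun x => v x * scatFun s x * g x)]
      simp only [hev, hfe]
    simp_rw [e, integral_div]
    rw [integral_add ig ig', e2]
    ring
  have i1 := integrable_mul_sq hvi h.continuous_scatFun h.abs_scatFun_le
  have hc1 : Continuous fun x => 1 - g x := continuous_const.sub hg.continuous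
  have i2 : Integrable fun x => v x * (1 - g x) ^ 2 := integrable_mul_sq hvi hc1 (B := 1 + B)
    fun x => (abs_sub _ _).trans (by rw [abs_one]; linarith [hB x])
  have h3 : 0 ≤ ∫ x, v x * (1 - g x - scatFun s x) ^ 2 :=
    integral_nonneg fun x => mul_nonneg (hv0 x) (sq_nonneg _)
  have e3 : ∀ x, v x * (1 - g x - scatFun s x) ^ 2 = v x * (1 - g x) ^ 2 +
      2 * (v x * scatFun s x * g x) - 2 * (v x * scatFun s x) + v x * scatFun s x ^ 2 :=
    fun x => by ring
  simp_rw [e3] at h3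
  have iA : Integrable fun x => v x * (1 - g x) ^ 2 + 2 * (v x * scatFun s x * g x) :=
    i2.add (ig.const_mul 2)
  have iB : Integrable fun x => v x * (1 - g x) ^ 2 + 2 * (v x * scatFun s x * g x) -
      2 * (v x * scatFun s x) := iA.sub ((h.integrable_mul_scatFun hvi).const_mul 2)
  rw [integral_add iB i1, integral_sub iA ((h.integrable_mul_scatFun hvi).const_mul 2),
    integral_add i2 (ig.const_mul 2), integral_const_mul, integral_const_mul] at h3
  have h4 := h.integral_scatFun_sq hvi
  have h5 := h.zero_eq
  linarith

lemma le_sInf (h : IsScat v s) (hv : Continuous v) (hvs : HasCompactSupport v)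
    (hv0 : ∀ x, 0 ≤ v x) (hev : ∀ x, v (-x) = v x) (hc : coupling v ≤ 1) :
    ENNReal.ofReal (s 0) ≤ sInf (scatSet3 fun x => ENNReal.ofReal (v x)) := by
  refine _root_.le_sInf ?_
  rintro E ⟨f, hf, hfs, rfl⟩
  set g : Vec 3 → ℝ := fun x => 1 - f x
  have hg : ContDiff ℝ (⊤ : ℕ∞) g := contDiff_const.sub hf
  have hs : HasCompactSupport g := by
    have : g = -(fun x => f x - 1) := by ext x; simp [g]
    rw [this]; exact hfs.neg
  have hd : ∀ x, fderiv ℝ g x = - fderiv ℝ f x := fun x => by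
    simp only [g]; rw [fderiv_const_sub]
  refine (ENNReal.ofReal_le_ofReal (h.le_energy hv hvs hv0 hev hc hg hs)).trans_eq ?_
  have hcd : Continuous (fderiv ℝ g) := hg.continuous_fderiv (by simp)
  have iD : Integrable fun x => ∑ k, (fderiv ℝ g x (Pi.single k 1)) ^ 2 := by
    refine Continuous.integrable_of_hasCompactSupport (by fun_prop) ?_
    exact (hs.fderiv (𝕜 := ℝ)).comp_left
      (g := fun L : Vec 3 →L[ℝ] ℝ => ∑ k, (L (Pi.single k 1)) ^ 2) (by simp)
  have iV : Integrable fun x => v x * (1 - g x) ^ 2 := by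
    have := hg.continuous
    exact Continuous.integrable_of_hasCompactSupport (by fun_prop) hvs.mul_right
  have iS : Integrable fun x => (∑ k, (fderiv ℝ g x (Pi.single k 1)) ^ 2) +
    v x * (1 - g x) ^ 2 / 2 := iD.add (iV.div_const 2)
  rw [← integral_div, ← integral_add iD (iV.div_const 2),
    ofReal_integral_eq_lintegral_ofReal iS
      (ae_of_all _ fun x => add_nonneg (Finset.sum_nonneg fun _ _ => sq_nonneg _)
        (div_nonneg (mul_nonneg (hv0 x) (sq_nonneg _)) zero_le_two))]
  refine lintegral_congr fun x => ?_
  have e1 : ∀ t : ℝ, (‖t‖₊ : ℝ≥0∞) ^ 2 = ENNReal.ofReal (t ^ 2) := fun t => by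
    rw [← enorm_eq_nnnorm, Real.enorm_eq_ofReal_abs, ← ENNReal.ofReal_pow (abs_nonneg _), sq_abs]
  rw [ENNReal.ofReal_add (Finset.sum_nonneg fun _ _ => sq_nonneg _)
    (div_nonneg (mul_nonneg (hv0 x) (sq_nonneg _)) zero_le_two),
    ENNReal.ofReal_sum_of_nonneg fun _ _ => sq_nonneg _]
  congr 1
  · refine Finset.sum_congr rfl fun k _ => ?_
    rw [e1, hd]; simp
  · rw [e1, ENNReal.ofReal_div_of_pos two_pos, ENNReal.ofReal_mul (hv0 x)]
    simp [g]

end IsScat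

end

section
lemma integrable_disp_add_sq_inv : Integrable fun ξ : Vec 3 => (disp ξ + disp ξ ^ 2)⁻¹ := by
  have h1 : Integrable fun ξ : Vec 3 => (1 + ‖ξ‖) ^ (-4 : ℝ) :=
    integrable_one_add_norm (by simp; norm_num)
  have h2 : Integrable (Set.indicator {ξ : Vec 3 | disp ξ ≤ 1} (fun ξ => (disp ξ)⁻¹)) :=
    (integrable_indicator_iff measurableSet_low).2 integrableOn_disp_inv
  refine (h2.add (h1.const_mul 8)).mono' ?_ ?_
  · have := continuous_disp
    exact (by fun_prop : Measurable fun ξ : Vec 3 => (disp ξ + disp ξ ^ 2)⁻¹).aestronglyMeasurable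
  · filter_upwards [ae_ne_zero_vec] with ξ hξ
    have hd := disp_pos hξ
    rw [Real.norm_of_nonneg (by positivity), Pi.add_apply]
    have h0 : (0 : ℝ) ≤ (1 + ‖ξ‖) ^ (-4 : ℝ) := by positivity
    by_cases h : disp ξ ≤ 1
    · rw [Set.indicator_of_mem (by exact h)]
      have : (disp ξ + disp ξ ^ 2)⁻¹ ≤ (disp ξ)⁻¹ := by gcongr; nlinarith
      linarith
    · rw [Set.indicator_of_notMem (by exact h), zero_add]
      have e : (1 + ‖ξ‖) ^ (-4 : ℝ) = ((1 + ‖ξ‖) ^ 4)⁻¹ := by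
        rw [Real.rpow_neg (by positivity)]; norm_cast
      rw [e, ← div_eq_mul_inv, inv_eq_one_div, div_le_div_iff₀ (by positivity) (by positivity)]
      have h3 := norm_sq_le_disp ξ
      have h4 : (1 + ‖ξ‖) ^ 2 ≤ 2 * (1 + disp ξ) := by nlinarith [sq_nonneg (1 - ‖ξ‖)]
      have h5 : ((1 + ‖ξ‖) ^ 2) ^ 2 ≤ (2 * (1 + disp ξ)) ^ 2 := by gcongr
      have h6 : 1 < disp ξ := not_le.1 h
      nlinarith

/-- Bogoliubov pair amplitude as a function of the dispersion, in natural units. -/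
def amp (d : ℝ) : ℝ := 1 / (2 * √(d ^ 2 + 2 * d))

/-- Free pair amplitude as a function of the dispersion, in natural units. -/
def amp0 (d : ℝ) : ℝ := 1 / (2 * d)

lemma amp_sq {d : ℝ} (hd : 0 < d) : amp d ^ 2 = 1 / (4 * (d ^ 2 + 2 * d)) := by
  rw [amp, div_pow, mul_pow, Real.sq_sqrt (by positivity)]
  norm_num

lemma amp_nonneg (d : ℝ) : 0 ≤ amp d := by unfold amp; positivity

lemma amp_le_amp0 {d : ℝ} (hd : 0 < d) : amp d ≤ amp0 d := by
  unfold amp amp0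
  gcongr
  exact Real.le_sqrt_of_sq_le (by nlinarith)

lemma amp0_sub_amp_le {d : ℝ} (hd : 0 < d) : amp0 d - amp d ≤ (d + d ^ 2)⁻¹ := by
  have h1 : 1 / (2 * (d + 2)) ≤ amp d := by
    unfold amp
    gcongr
    exact (Real.sqrt_le_left (by positivity)).2 (by nlinarith)
  have h2 : amp0 d - 1 / (2 * (d + 2)) = 1 / (d * (d + 2)) := by
    unfold amp0; field_simp; ring
  have h3 : 1 / (d * (d + 2)) ≤ (d + d ^ 2)⁻¹ := by
    rw [one_div]
    gcongr
    nlinarith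
  linarith

lemma gam_mul_amp_le {d x : ℝ} (hd : 0 < d) (hx : |x| ≤ 1) :
    gam (x * amp d) ≤ 1 / (4 * (d ^ 2 + 2 * d)) := by
  refine (gam_le_sq _).trans ?_
  rw [mul_pow, amp_sq hd]
  have : x ^ 2 ≤ 1 := (sq_le_one_iff_abs_le_one x).2 hx
  exact mul_le_of_le_one_left (by positivity) this

/-- Energy density of the quadratic part, in natural units. -/
def quadDens (x d : ℝ) : ℝ := d * (x ^ 2 * (amp0 d - amp d) ^ 2 - gam (x * amp d) ^ 2)

lemma gam_mul_amp_le' {d x : ℝ} (hd : 0 < d) (hx : |x| ≤ 1) :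
    gam (x * amp d) ≤ (d + d ^ 2)⁻¹ := by
  refine (gam_mul_amp_le hd hx).trans ?_
  rw [one_div]
  gcongr
  nlinarith

lemma abs_quadDens_le {d x : ℝ} (hd : 0 < d) (hx : |x| ≤ 1) :
    |quadDens x d| ≤ 2 * (d + d ^ 2)⁻¹ := by
  have h1 : x ^ 2 ≤ 1 := (sq_le_one_iff_abs_le_one x).2 hx
  have h2 := amp0_sub_amp_le hd
  have h3 : 0 ≤ amp0 d - amp d := sub_nonneg.2 (amp_le_amp0 hd)
  have h4 : d * (amp0 d - amp d) ^ 2 ≤ (d + d ^ 2)⁻¹ := by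
    have e : amp0 d - amp d ≤ 1 / (2 * d) := by
      have := amp_nonneg d
      unfold amp0; linarith
    calc d * (amp0 d - amp d) ^ 2 = (d * (amp0 d - amp d)) * (amp0 d - amp d) := by ring
      _ ≤ (d * (1 / (2 * d))) * (d + d ^ 2)⁻¹ := by gcongr
      _ = 1 / 2 * (d + d ^ 2)⁻¹ := by field_simp
      _ ≤ _ := by
        have : 0 ≤ (d + d ^ 2)⁻¹ := by positivity
        linarith
  have h5 : d * gam (x * amp d) ^ 2 ≤ (d + d ^ 2)⁻¹ := by
    have g0 := gam_nonneg (x * amp d)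
    have g1 := gam_mul_amp_le hd hx
    have g2 := gam_mul_amp_le' hd hx
    calc d * gam (x * amp d) ^ 2 = (d * gam (x * amp d)) * gam (x * amp d) := by ring
      _ ≤ (d * (1 / (4 * (d ^ 2 + 2 * d)))) * (d + d ^ 2)⁻¹ := by gcongr
      _ ≤ 1 * (d + d ^ 2)⁻¹ := by
        gcongr
        rw [mul_one_div, div_le_one (by positivity)]
        nlinarith
      _ = _ := one_mul _
  have h6 : x ^ 2 * (d * (amp0 d - amp d) ^ 2) ≤ (d + d ^ 2)⁻¹ :=
    (mul_le_of_le_one_left (by positivity) h1).trans h4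
  have h7 : 0 ≤ d * gam (x * amp d) ^ 2 := by positivity
  have h8 : 0 ≤ x ^ 2 * (d * (amp0 d - amp d) ^ 2) := by positivity
  have e : quadDens x d = x ^ 2 * (d * (amp0 d - amp d) ^ 2) - d * gam (x * amp d) ^ 2 := by
    unfold quadDens; ring
  rw [e, abs_le]
  constructor <;> linarith

lemma measurable_amp_disp : Measurable fun η : Vec 3 => amp (disp η) := by
  have := continuous_disp
  unfold amp
  fun_prop

lemma measurable_amp0_disp : Measurable fun η : Vec 3 => amp0 (disp η) := by
  have := continuous_disp
  unfold amp0
  fun_prop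

variable {χ : Vec 3 → ℝ}

lemma aesm_gam_amp (hχ : Continuous χ) :
    AEStronglyMeasurable (fun η => gam (χ η * amp (disp η))) volume :=
  (continuous_gam.measurable.comp (hχ.measurable.mul measurable_amp_disp)).aestronglyMeasurable

lemma aesm_quadDens (hχ : Continuous χ) :
    AEStronglyMeasurable (fun η => quadDens (χ η) (disp η)) volume := by
  have h1 := continuous_disp.measurable
  have h2 := hχ.measurable
  have h3 := measurable_amp_disp
  have h4 := measurable_amp0_disp
  have h5 : Measurable fun η => gam (χ η * amp (disp η)) :=
    continuous_gam.measurable.comp (h2.mul h3)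
  unfold quadDens
  exact (by fun_prop : Measurable fun η => disp η * (χ η ^ 2 * (amp0 (disp η) - amp (disp η)) ^ 2 -
    gam (χ η * amp (disp η)) ^ 2)).aestronglyMeasurable

lemma integrable_gam_amp (hχ : Continuous χ) (hχ1 : ∀ η, |χ η| ≤ 1) :
    Integrable fun η => gam (χ η * amp (disp η)) := by
  refine integrable_disp_add_sq_inv.mono' (aesm_gam_amp hχ) ?_
  filter_upwards [ae_ne_zero_vec] with η hη
  rw [Real.norm_of_nonneg (gam_nonneg _)]
  exact gam_mul_amp_le' (disp_pos hη) (hχ1 η)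

lemma integrable_quadDens (hχ : Continuous χ) (hχ1 : ∀ η, |χ η| ≤ 1) :
    Integrable fun η => quadDens (χ η) (disp η) := by
  refine (integrable_disp_add_sq_inv.const_mul 2).mono' (aesm_quadDens hχ) ?_
  filter_upwards [ae_ne_zero_vec] with η hη
  exact abs_quadDens_le (disp_pos hη) (hχ1 η)

lemma integrable_amp0_sub_amp : Integrable fun η => amp0 (disp η) - amp (disp η) := by
  refine integrable_disp_add_sq_inv.mono'
    (measurable_amp0_disp.sub measurable_amp_disp).aestronglyMeasurable ?_
  filter_upwards [ae_ne_zero_vec] with η hη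
  rw [Real.norm_of_nonneg (sub_nonneg.2 (amp_le_amp0 (disp_pos hη)))]
  exact amp0_sub_amp_le (disp_pos hη)

/-- Depletion integral, in natural units. -/
def depl (χ : Vec 3 → ℝ) : ℝ := ∫ η, gam (χ η * amp (disp η))

/-- Quadratic energy integral, in natural units. -/
def quadInt (χ : Vec 3 → ℝ) : ℝ := ∫ η, quadDens (χ η) (disp η)

lemma tendsto_smul_arg {χ : Vec 3 → ℝ} (hχ : Continuous χ) {ι : Type*} {l : Filter ι} {t : ι → ℝ}
    (ht : Tendsto t l (𝓝 0)) (η : Vec 3) : Tendsto (fun i => χ (t i • η)) l (𝓝 (χ 0)) := by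
  have : Tendsto (fun i => t i • η) l (𝓝 ((0 : ℝ) • η)) := ht.smul_const η
  rw [zero_smul] at this
  exact (hχ.tendsto 0).comp this

lemma tendsto_depl (hχ : Continuous χ) (hχ1 : ∀ η, |χ η| ≤ 1) (h0 : χ 0 = 1) {ι : Type*}
    {l : Filter ι} [l.IsCountablyGenerated] {t : ι → ℝ} (ht : Tendsto t l (𝓝 0)) :
    Tendsto (fun i => depl fun η => χ (t i • η)) l (𝓝 (depl fun _ => 1)) := by
  refine tendsto_integral_filter_of_dominated_convergence (fun ξ => (disp ξ + disp ξ ^ 2)⁻¹)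
    (Eventually.of_forall fun i => aesm_gam_amp (by fun_prop)) (Eventually.of_forall fun i => ?_)
    integrable_disp_add_sq_inv (ae_of_all _ fun η => ?_)
  · filter_upwards [ae_ne_zero_vec] with η hη
    rw [Real.norm_of_nonneg (gam_nonneg _)]
    exact gam_mul_amp_le' (disp_pos hη) (hχ1 _)
  · have := tendsto_smul_arg hχ ht η
    rw [h0] at this
    exact (continuous_gam.tendsto _).comp (this.mul_const _)

lemma tendsto_quadInt (hχ : Continuous χ) (hχ1 : ∀ η, |χ η| ≤ 1) (h0 : χ 0 = 1) {ι : Type*}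
    {l : Filter ι} [l.IsCountablyGenerated] {t : ι → ℝ} (ht : Tendsto t l (𝓝 0)) :
    Tendsto (fun i => quadInt fun η => χ (t i • η)) l (𝓝 (quadInt fun _ => 1)) := by
  refine tendsto_integral_filter_of_dominated_convergence (fun ξ => 2 * (disp ξ + disp ξ ^ 2)⁻¹)
    (Eventually.of_forall fun i => aesm_quadDens (by fun_prop)) (Eventually.of_forall fun i => ?_)
    (integrable_disp_add_sq_inv.const_mul 2) (ae_of_all _ fun η => ?_)
  · filter_upwards [ae_ne_zero_vec] with η hη
    exact abs_quadDens_le (disp_pos hη) (hχ1 _)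
  · have := tendsto_smul_arg hχ ht η
    rw [h0] at this
    have hc : Continuous fun x : ℝ => quadDens x (disp η) := by
      have := continuous_gam
      unfold quadDens
      fun_prop
    exact (hc.tendsto _).comp this

end

section
lemma integral_eq_scale (F : Vec 3 → ℝ) {t : ℝ} (ht : 0 < t) :
    ∫ ξ, F ξ = t ^ 3 * ∫ η, F (t • η) := by
  rw [Measure.integral_comp_smul, abs_of_pos (by positivity), smul_eq_mul]
  simp only [Module.finrank_fintype_fun_eq_card, Fintype.card_fin]
  field_simp

lemma disp_smul (t : ℝ) (η : Vec 3) : disp (t • η) = t ^ 2 * disp η := by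
  simp only [disp, Pi.smul_apply, smul_eq_mul, mul_pow, ← Finset.mul_sum]
  ring

/-- The Bogoliubov pair amplitude at momentum scale `t` with profile `χ`. -/
def bog (χ : Vec 3 → ℝ) (t : ℝ) (ξ : Vec 3) : ℝ := χ ξ * amp (disp ξ / t ^ 2)

lemma bog_smul (χ : Vec 3 → ℝ) {t : ℝ} (ht : 0 < t) (η : Vec 3) :
    bog χ t (t • η) = χ (t • η) * amp (disp η) := by
  rw [bog, disp_smul, mul_div_cancel_left₀ _ (by positivity)]

lemma integral_gam_bog (χ : Vec 3 → ℝ) {t : ℝ} (ht : 0 < t) :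
    ∫ ξ, gam (bog χ t ξ) = t ^ 3 * depl fun η => χ (t • η) := by
  rw [integral_eq_scale _ ht]
  simp_rw [bog_smul χ ht]
  rfl

lemma bog_neg {χ : Vec 3 → ℝ} (hev : ∀ ξ, χ (-ξ) = χ ξ) (t : ℝ) (ξ : Vec 3) :
    bog χ t (-ξ) = bog χ t ξ := by
  simp [bog, hev, disp]

lemma continuousOn_bog {χ : Vec 3 → ℝ} (hχ : Continuous χ) {t : ℝ} (ht : 0 < t) :
    ContinuousOn (bog χ t) {0}ᶜ := by
  unfold bog amp
  have h1 := continuous_disp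
  refine hχ.continuousOn.mul (ContinuousOn.div (by fun_prop) (by fun_prop) fun ξ hξ => ?_)
  have := disp_pos (ξ := ξ) (by simpa using hξ)
  positivity

lemma aesm_bog {χ : Vec 3 → ℝ} (hχ : Continuous χ) (t : ℝ) :
    AEStronglyMeasurable (bog χ t) volume := by
  have h1 := continuous_disp.measurable
  have h2 := hχ.measurable
  unfold bog amp
  exact (by fun_prop : Measurable fun ξ => χ ξ * (1 / (2 * √((disp ξ / t ^ 2) ^ 2 +
    2 * (disp ξ / t ^ 2))))).aestronglyMeasurable

lemma abs_bog_le {χ : Vec 3 → ℝ} {t : ℝ} (ht : 0 < t) {ξ : Vec 3} (hξ : ξ ≠ 0) :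
    |bog χ t ξ| ≤ |χ ξ| * (t ^ 2 / 2) / disp ξ := by
  have hd := disp_pos hξ
  rw [bog, abs_mul, abs_of_nonneg (amp_nonneg _), mul_div_assoc]
  refine mul_le_mul_of_nonneg_left ((amp_le_amp0 (by positivity)).trans_eq ?_) (abs_nonneg _)
  unfold amp0
  field_simp

variable {v s : Vec 3 → ℝ}

namespace IsScat

lemma integrable_bog (h : IsScat v s) (hs0 : 0 < s 0) {t : ℝ} (ht : 0 < t) :
    Integrable (bog (fun ξ => s ξ / s 0) t) := by
  refine (h.int.abs.const_mul (t ^ 2 / (2 * s 0))).mono' (aesm_bog (h.cont.div_const _) t) ?_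
  filter_upwards [ae_ne_zero_vec] with ξ hξ
  refine (abs_bog_le ht hξ).trans_eq ?_
  have hd := disp_pos hξ
  rw [abs_div, abs_div, abs_of_pos hs0, abs_of_pos hd]
  field_simp

lemma integrable_disp_bog_sq (h : IsScat v s) (hv : Integrable v) (hv0 : ∀ x, 0 ≤ v x)
    (hc : coupling v ≤ 1) (hs0 : 0 < s 0) {t : ℝ} (ht : 0 < t) :
    Integrable fun ξ => disp ξ * bog (fun ξ => s ξ / s 0) t ξ ^ 2 := by
  have hb := h.integrable_bog hs0 ht
  refine (hb.abs.const_mul (t ^ 2 / 2)).mono' (continuous_disp.aestronglyMeasurable.mul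
    (hb.aestronglyMeasurable.pow 2)) ?_
  filter_upwards [ae_ne_zero_vec] with ξ hξ
  have hd := disp_pos hξ
  have h1 := abs_bog_le (χ := fun ξ => s ξ / s 0) ht hξ
  have h2 : |s ξ / s 0| ≤ 1 := by
    rw [abs_div, abs_of_pos hs0, div_le_one hs0]
    exact h.abs_le_zero hv hv0 hc ξ
  rw [Real.norm_of_nonneg (by positivity), ← sq_abs]
  calc disp ξ * |bog (fun ξ => s ξ / s 0) t ξ| ^ 2
      = (disp ξ * |bog (fun ξ => s ξ / s 0) t ξ|) * |bog (fun ξ => s ξ / s 0) t ξ| := by ring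
    _ ≤ (disp ξ * (1 * (t ^ 2 / 2) / disp ξ)) * |bog (fun ξ => s ξ / s 0) t ξ| := by
        gcongr
        exact h1.trans (by gcongr)
    _ = _ := by field_simp

/-- Upper bound on the energy density of the Bogoliubov trial state. -/
theorem enDens_bog_le (h : IsScat v s) (hv : Integrable v) (hv0 : ∀ x, 0 ≤ v x)
    (hc : coupling v ≤ 1) (hs0 : 0 < s 0) {r t : ℝ} (hr : 0 ≤ r) (ht : 0 < t)
    (hrt : t ^ 2 = 2 * r * s 0) :
    enDens v r (bog (fun ξ => s ξ / s 0) t) ≤ s 0 * r ^ 2 +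
      t ^ 5 * quadInt (fun η => s (t • η) / s 0) +
      (∫ x, v x) / 2 * (4 * r * (t ^ 3 * depl fun η => s (t • η) / s 0) +
        2 * (t ^ 3 * depl fun η => s (t • η) / s 0) ^ 2 +
        (t ^ 3 * ∫ η, (amp0 (disp η) - amp (disp η))) ^ 2) := by
  set χ : Vec 3 → ℝ := fun ξ => s ξ / s 0 with hχdef
  set α := bog χ t
  have hr0 : r ≠ 0 := by
    rintro rfl
    have : 0 < t ^ 2 := by positivity
    rw [hrt] at this
    simp at this
  have hχ1 : ∀ ξ, |χ ξ| ≤ 1 := fun ξ => by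
    rw [hχdef, abs_div, abs_of_pos hs0, div_le_one hs0]
    exact h.abs_le_zero hv hv0 hc ξ
  have hχc : Continuous χ := h.cont.div_const _
  have hα : Integrable α := h.integrable_bog hs0 ht
  have hα2 := h.integrable_disp_bog_sq hv hv0 hc hs0 ht
  have hα0 : Integrable fun ξ => r * (s ξ / disp ξ) := h.int.const_mul r
  set β : Vec 3 → ℝ := fun ξ => α ξ - r * (s ξ / disp ξ)
  have hβ : Integrable β := hα.sub hα0
  have hγ : Integrable fun ξ => gam (α ξ) := hα.abs.mono'
    (continuous_gam.comp_aestronglyMeasurable hα.aestronglyMeasurable)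
    (ae_of_all _ fun ξ => by rw [Real.norm_of_nonneg (gam_nonneg _)]; exact gam_le_abs _)
  have hdγ : Integrable fun ξ => disp ξ * gam (α ξ) := hα2.mono'
    (continuous_disp.aestronglyMeasurable.mul hγ.aestronglyMeasurable)
    (ae_of_all _ fun ξ => by
      rw [Real.norm_of_nonneg (mul_nonneg (disp_nonneg _) (gam_nonneg _))]
      exact mul_le_mul_of_nonneg_left (gam_le_sq _) (disp_nonneg _))
  have hγ0 : ∫ ξ, gam (α ξ) = t ^ 3 * depl fun η => χ (t • η) := integral_gam_bog χ ht
  set γ := t ^ 3 * depl fun η => χ (t • η)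
  have hft0 : ft (fun ξ => gam (α ξ)) 0 = γ := by rw [ft_zero_arg, hγ0]
  have hftγ : ∀ x, |ft (fun ξ => gam (α ξ)) x| ≤ γ := fun x => by
    refine (abs_ft_le hγ x).trans_eq ?_
    simp_rw [abs_of_nonneg (gam_nonneg _)]
    exact hγ0
  have hftα : ∀ x, r - ft α x = r * scatFun s x - ft β x := fun x => by
    have : ft β x = ft α x - r * ft (fun ξ => s ξ / disp ξ) x := by
      rw [← ft_const_mul]; exact ft_sub hα hα0 x
    rw [this, scatFun]; ring
  have hp : ∫ x, v x * pairDens r (ft α x) (ft (fun ξ => gam (α ξ)) x)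
      (ft (fun ξ => gam (α ξ)) 0) ≤
      (∫ x, v x * (r * scatFun s x - ft β x) ^ 2) + (∫ x, v x) * (4 * r * γ + 2 * γ ^ 2) := by
    have hu : Continuous fun x => r * scatFun s x - ft β x :=
      (h.continuous_scatFun.const_mul r).sub (continuous_ft hβ)
    have i1 : Integrable fun x => v x * (r * scatFun s x - ft β x) ^ 2 :=
      integrable_mul_sq hv hu (B := r * (1 + coupling v) + ∫ ξ, |β ξ|) fun x => by
        refine (abs_sub _ _).trans (add_le_add ?_ (abs_ft_le hβ x))
        rw [abs_mul, abs_of_nonneg hr]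
        exact mul_le_mul_of_nonneg_left (h.abs_scatFun_le x) hr
    rw [← integral_mul_const, ← integral_add i1 (hv.mul_const _)]
    refine integral_mono_of_nonneg (ae_of_all _ fun x => ?_) (i1.add (hv.mul_const _))
      (ae_of_all _ fun x => ?_)
    · exact mul_nonneg (hv0 x) (by
        have := hftγ 0
        rw [hft0] at this ⊢
        have h0 : 0 ≤ γ := (abs_nonneg _).trans this
        have h1 := hftγ x
        have h2 := (abs_le.1 h1).1
        unfold pairDens
        nlinarith [sq_nonneg (r - ft α x), sq_nonneg (ft (fun ξ => gam (α ξ)) x), mul_nonneg hr h0,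
          mul_le_mul_of_nonneg_left h2 hr, sq_nonneg γ])
    · simp only
      rw [← mul_add, hft0, ← hftα]
      refine mul_le_mul_of_nonneg_left ?_ (hv0 x)
      have h1 := abs_le.1 (hftγ x)
      have h2 := pow_le_pow_left₀ (abs_nonneg _) (hftγ x) 2
      rw [sq_abs] at h2
      unfold pairDens
      nlinarith [mul_le_mul_of_nonneg_left h1.2 hr]
  have hβ1 : ∫ ξ, |β ξ| ≤ t ^ 3 * ∫ η, (amp0 (disp η) - amp (disp η)) := by
    rw [integral_eq_scale _ ht]
    refine mul_le_mul_of_nonneg_left ?_ (by positivity)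
    refine integral_mono_of_nonneg (ae_of_all _ fun η => abs_nonneg _) integrable_amp0_sub_amp ?_
    filter_upwards [ae_ne_zero_vec] with η hη
    have hd := disp_pos hη
    have e : β (t • η) = χ (t • η) * (amp (disp η) - amp0 (disp η)) := by
      have ea : α (t • η) = χ (t • η) * amp (disp η) := bog_smul χ ht η
      simp only [β, ea, disp_smul, amp0, hχdef, hrt]
      field_simp
    have hle := amp_le_amp0 hd
    rw [e, abs_mul, abs_sub_comm, abs_of_nonneg (sub_nonneg.2 hle)]
    exact mul_le_of_le_one_left (sub_nonneg.2 hle) (hχ1 _)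
  have hβ2 : (∫ x, v x * ft β x ^ 2) ≤
      (∫ x, v x) * (t ^ 3 * ∫ η, (amp0 (disp η) - amp (disp η))) ^ 2 := by
    rw [← integral_mul_const]
    refine integral_mono (integrable_mul_sq hv (continuous_ft hβ) (abs_ft_le hβ))
      (hv.mul_const _) fun x => mul_le_mul_of_nonneg_left ?_ (hv0 x)
    rw [← sq_abs]
    exact pow_le_pow_left₀ (abs_nonneg _) ((abs_ft_le hβ x).trans hβ1) 2
  have j1 := h.integrable_mul hv hv0 hc h.int
  have j2 := h.integrable_mul hv hv0 hc hβ
  have hq : (∫ ξ, disp ξ * gam (α ξ)) - r ^ 2 * (∫ ξ, s ξ * (s ξ / disp ξ)) -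
      2 * r * (∫ ξ, s ξ * β ξ) = t ^ 5 * quadInt fun η => χ (t • η) := by
    rw [← integral_const_mul, ← integral_const_mul, ← integral_sub hdγ (j1.const_mul _)]
    have j3 : Integrable fun ξ => disp ξ * gam (α ξ) - r ^ 2 * (s ξ * (s ξ / disp ξ)) :=
      hdγ.sub (j1.const_mul _)
    rw [← integral_sub j3 (j2.const_mul _), integral_eq_scale _ ht, quadInt]
    have e5 : t ^ 5 = t ^ 3 * t ^ 2 := by ring
    rw [e5, mul_assoc, ← integral_const_mul (t ^ 2)]
    congr 1
    refine integral_congr_ae ?_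
    filter_upwards [ae_ne_zero_vec] with η hη
    have hd := disp_pos hη
    have hg := gam_sq_add (χ (t • η) * amp (disp η))
    have es : r * s (t • η) = χ (t • η) * t ^ 2 / 2 := by
      simp only [hχdef, hrt]; field_simp
    have eb : β (t • η) = χ (t • η) * (amp (disp η) - amp0 (disp η)) := by
      have ea : α (t • η) = χ (t • η) * amp (disp η) := bog_smul χ ht η
      simp only [β, ea, disp_smul, amp0, hχdef, hrt]
      field_simp
    have e1 : r ^ 2 * (s (t • η) * (s (t • η) / disp (t • η))) =
        t ^ 2 * (disp η * (χ (t • η) * amp0 (disp η)) ^ 2) := by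
      rw [disp_smul]
      have : r ^ 2 * (s (t • η) * (s (t • η) / (t ^ 2 * disp η))) =
        (r * s (t • η)) ^ 2 / (t ^ 2 * disp η) := by ring
      rw [this, es, amp0]
      field_simp
    have e2 : 2 * r * (s (t • η) * β (t • η)) = t ^ 2 * (2 * disp η * amp0 (disp η)) *
        (χ (t • η) * β (t • η)) := by
      have h1 : 2 * disp η * amp0 (disp η) = 1 := by unfold amp0; field_simp
      rw [h1]
      linear_combination 2 * β (t • η) * es
    have ea : α (t • η) = χ (t • η) * amp (disp η) := bog_smul χ ht η
    rw [e1, e2, eb, disp_smul, ea]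
    unfold quadDens
    linear_combination (t ^ 2 * disp η) * hg
  have hI := h.integral_sq hv r hβ
  have : enDens v r α = (∫ ξ, disp ξ * gam (α ξ)) + 1 / 2 * ∫ x, v x * pairDens r (ft α x)
      (ft (fun ξ => gam (α ξ)) x) (ft (fun ξ => gam (α ξ)) 0) := rfl
  rw [this]
  linarith

end IsScat

end

section
lemma integral_disp (F : ℝ → ℝ) :
    ∫ ξ : Vec 3, F (disp ξ) = 1 / (2 * π ^ 2) * ∫ y in Set.Ioi (0 : ℝ), y ^ 2 * F (y ^ 2) := by
  have hp := Real.pi_pos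
  rw [integral_eq_scale _ (t := 1 / (2 * π)) (by positivity)]
  have e : ∀ η : Vec 3, F (disp ((1 / (2 * π)) • η)) = F (∑ j, η j ^ 2) := fun η => by
    rw [disp_smul, disp]; congr 1; field_simp
  simp_rw [e]
  rw [← integral_ofLp (fun η : Vec 3 => F (∑ j, η j ^ 2))]
  have e2 : ∀ x : EuclideanSpace ℝ (Fin 3), F (∑ j, x.ofLp j ^ 2) = (fun y => F (y ^ 2)) ‖x‖ :=
    fun x => by
      simp only [EuclideanSpace.norm_sq_eq, Real.norm_eq_abs, sq_abs]
  simp_rw [e2]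
  rw [integral_fun_norm_addHaar volume (fun y => F (y ^ 2)), Measure.real, EuclideanSpace.volume_ball_fin_three]
  simp only [finrank_euclideanSpace, Fintype.card_fin, smul_eq_mul, nsmul_eq_mul]
  norm_num
  rw [ENNReal.toReal_ofReal (by positivity)]
  field_simp
  norm_num

/-- The primitive variable `√(q² + 2) - q`. -/
def lhyU (q : ℝ) : ℝ := √(q ^ 2 + 2) - q

lemma hasDerivAt_lhyU (q : ℝ) : HasDerivAt lhyU (-(lhyU q / √(q ^ 2 + 2))) q := by
  have hS : 0 < √(q ^ 2 + 2) := Real.sqrt_pos.2 (by positivity)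
  have h1 : HasDerivAt (fun q : ℝ => q ^ 2 + 2) (2 * q) q := by
    simpa using (hasDerivAt_pow 2 q).add_const 2
  have h2 := (h1.sqrt (by positivity)).sub (hasDerivAt_id q)
  refine h2.congr_deriv ?_
  unfold lhyU
  field_simp
  ring

lemma lhyU_pos (q : ℝ) : 0 < lhyU q := by
  unfold lhyU
  have : |q| < √(q ^ 2 + 2) := by
    rw [← Real.sqrt_sq_eq_abs]; exact Real.sqrt_lt_sqrt (sq_nonneg _) (by linarith)
  linarith [le_abs_self q]

lemma lhyU_eq (q : ℝ) : q * lhyU q = (2 - lhyU q ^ 2) / 2 := by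
  have h := Real.sq_sqrt (by positivity : (0 : ℝ) ≤ q ^ 2 + 2)
  unfold lhyU
  linear_combination (1 / 2) * h

lemma tendsto_lhyU : Tendsto lhyU atTop (𝓝 0) := by
  have h1 : Tendsto (fun q : ℝ => 1 / q) atTop (𝓝 0) := by
    simpa using tendsto_inv_atTop_zero (𝕜 := ℝ)
  refine squeeze_zero' (Eventually.of_forall fun q => (lhyU_pos q).le) ?_ h1
  filter_upwards [eventually_gt_atTop 0] with q hq
  rw [le_div_iff₀ hq, mul_comm, lhyU_eq]
  nlinarith [sq_nonneg (lhyU q)]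

/-- The Lee-Huang-Yang energy density in the dispersion variable. -/
def lhyF (d : ℝ) : ℝ := (√(d ^ 2 + 2 * d) - d - 1 + 1 / (2 * d)) / 2

lemma gam_amp_add_quadDens {d : ℝ} (hd : 0 < d) : gam (1 * amp d) + quadDens 1 d = lhyF d := by
  set E := √(d ^ 2 + 2 * d)
  have hE : 0 < E := Real.sqrt_pos.2 (by positivity)
  have hE2 : E ^ 2 = d ^ 2 + 2 * d := Real.sq_sqrt (by positivity)
  have hg : gam (1 * amp d) = ((d + 1) / E - 1) / 2 := by
    unfold gam
    have : (1 * amp d) ^ 2 + 1 / 4 = ((d + 1) / (2 * E)) ^ 2 := by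
      rw [one_mul, amp_sq hd, div_pow, mul_pow, hE2]
      field_simp
      ring
    rw [this, Real.sqrt_sq (by positivity)]
    field_simp
  have h2 := gam_sq_add (1 * amp d)
  have ha : amp d = 1 / (2 * E) := rfl
  have h3 : quadDens 1 d = d * (amp0 d ^ 2 - 2 * amp0 d * amp d + gam (1 * amp d)) := by
    unfold quadDens
    linear_combination (-d) * h2
  rw [h3, hg, ha, amp0, lhyF]
  change _ = (E - d - 1 + 1 / (2 * d)) / 2
  field_simp
  linear_combination (-2 * d) * hE2

lemma integral_lhyF : ∫ ξ : Vec 3, lhyF (disp ξ) = 2 * √2 / (15 * π ^ 2) := by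
  have hp := Real.pi_pos
  rw [integral_disp]
  set g : ℝ → ℝ := fun q => (-(lhyU q) / 2 - lhyU q ^ 3 / 24 + lhyU q ^ 5 / 80) / 2
  have hd : ∀ q ∈ Set.Ici (0 : ℝ), HasDerivAt g
      ((1 / 2 + lhyU q ^ 2 / 8 - lhyU q ^ 4 / 16) * (lhyU q / √(q ^ 2 + 2)) / 2) q := by
    intro q _
    have h := hasDerivAt_lhyU q
    refine (((h.neg.div_const 2).sub ((h.pow 3).div_const 24)).add
      ((h.pow 5).div_const 80)).div_const 2 |>.congr_deriv ?_
    push_cast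
    ring
  have hu2 : ∀ q ∈ Set.Ioi (0 : ℝ), lhyU q ^ 2 ≤ 2 := fun q hq => by
    have h1 := lhyU_eq q
    have h2 : 0 < q * lhyU q := mul_pos hq (lhyU_pos q)
    linarith
  have hpos : ∀ q ∈ Set.Ioi (0 : ℝ), 0 ≤
      (1 / 2 + lhyU q ^ 2 / 8 - lhyU q ^ 4 / 16) * (lhyU q / √(q ^ 2 + 2)) / 2 := by
    intro q hq
    have h1 := hu2 q hq
    have h2 := lhyU_pos q
    have h3 : 0 ≤ 1 / 2 + lhyU q ^ 2 / 8 - lhyU q ^ 4 / 16 := by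
      nlinarith [sq_nonneg (lhyU q)]
    positivity
  have hlim : Tendsto g atTop (𝓝 0) := by
    have hu := tendsto_lhyU
    have := (((hu.neg.div_const 2).sub ((hu.pow 3).div_const 24)).add
      ((hu.pow 5).div_const 80)).div_const 2
    simpa [g] using this
  have hI := integral_Ioi_of_hasDerivAt_of_nonneg' hd hpos hlim
  have he : ∫ y in Set.Ioi (0 : ℝ), y ^ 2 * lhyF (y ^ 2) = ∫ q in Set.Ioi (0 : ℝ),
      (1 / 2 + lhyU q ^ 2 / 8 - lhyU q ^ 4 / 16) * (lhyU q / √(q ^ 2 + 2)) / 2 := by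
    refine setIntegral_congr_fun measurableSet_Ioi fun q hq => ?_
    have hq : 0 < q := hq
    have hS : 0 < √(q ^ 2 + 2) := Real.sqrt_pos.2 (by positivity)
    have hSu : √(q ^ 2 + 2) = lhyU q + q := by unfold lhyU; ring
    have hE : √((q ^ 2) ^ 2 + 2 * q ^ 2) = q * √(q ^ 2 + 2) := by
      have : (q ^ 2) ^ 2 + 2 * q ^ 2 = q ^ 2 * (q ^ 2 + 2) := by ring
      rw [this, Real.sqrt_mul (sq_nonneg _), Real.sqrt_sq hq.le]
    have hm := lhyU_eq q
    have h1 : q ^ 3 * lhyU q - q ^ 2 + 1 / 2 = (1 - ((2 - lhyU q ^ 2) / 2) ^ 2) / 2 := by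
      rw [← hm]
      linear_combination q ^ 2 * hm
    have h2 : q ^ 2 * lhyF (q ^ 2) = (q ^ 3 * lhyU q - q ^ 2 + 1 / 2) / 2 := by
      rw [lhyF, hE, hSu]
      field_simp
      ring
    rw [h2, h1, hSu]
    have hne : lhyU q + q ≠ 0 := by rw [← hSu]; exact hS.ne'
    have h3 : (1 - ((2 - lhyU q ^ 2) / 2) ^ 2) / 2 * (lhyU q + q) =
        (1 / 2 + lhyU q ^ 2 / 8 - lhyU q ^ 4 / 16) * lhyU q := by
      linear_combination ((lhyU q - lhyU q ^ 3 / 4) / 2) * hm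
    rw [← mul_div_assoc, ← h3, mul_div_cancel_right₀ _ hne]
  have h20 : lhyU 0 = √2 := by simp [lhyU]
  have h22 : √2 ^ 2 = 2 := Real.sq_sqrt (by norm_num)
  have e3 : √2 ^ 3 = 2 * √2 := by rw [pow_succ, h22]
  have e5 : √2 ^ 5 = 4 * √2 := by
    have : √2 ^ 5 = (√2 ^ 2) ^ 2 * √2 := by ring
    rw [this, h22]; norm_num
  rw [he, hI]
  simp only [g, h20, e3, e5]
  field_simp
  ring

lemma depl_add_quadInt : depl (fun _ => 1) + quadInt (fun _ => 1) = 2 * √2 / (15 * π ^ 2) := by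
  rw [← integral_lhyF, depl, quadInt, ← integral_add
    (integrable_gam_amp continuous_const (by simp)) (integrable_quadDens continuous_const (by simp))]
  refine integral_congr_ae ?_
  filter_upwards [ae_ne_zero_vec] with η hη
  exact gam_amp_add_quadDens (disp_pos hη)

lemma depl_nonneg (χ : Vec 3 → ℝ) : 0 ≤ depl χ := integral_nonneg fun _ => gam_nonneg _

end

section
lemma limsup_le_of_tendsto {ι : Type*} {l : Filter ι} {u R : ι → ℝ} {R0 B : ℝ}
    (hu : ∀ᶠ i in l, u i ≤ R i) (hR : Tendsto R l (𝓝 R0)) (hB : R0 ≤ B) (hB0 : 0 ≤ B) :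
    limsup u l ≤ B := by
  rw [limsup_eq]
  by_cases hS : BddBelow {x | ∀ᶠ i in l, u i ≤ x}
  · refine le_of_forall_pos_le_add fun ε hε => csInf_le hS ?_
    filter_upwards [hu, hR.eventually_lt_const (show R0 < B + ε by linarith)] with i h1 h2
    exact h1.trans h2.le
  · rw [Real.sInf_of_not_bddBelow hS]
    exact hB0

variable {v s : Vec 3 → ℝ}

lemma IsScat.ePlus_le (h : IsScat v s) (hv : Continuous v) (hvs : HasCompactSupport v)
    (hv0 : ∀ x, 0 ≤ v x) (hc : coupling v ≤ 1) (hs0 : 0 < s 0) {r t ρ : ℝ} (hr : 0 ≤ r)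
    (ht : 0 < t) (hrt : t ^ 2 = 2 * r * s 0) (hρ : 0 < ρ)
    (hlt : ρ < r + t ^ 3 * depl fun η => s (t • η) / s 0) :
    ePlus 3 (fun x => ENNReal.ofReal (v x)) ρ ≤ s 0 * r ^ 2 +
      t ^ 5 * quadInt (fun η => s (t • η) / s 0) +
      (∫ x, v x) / 2 * (4 * r * (t ^ 3 * depl fun η => s (t • η) / s 0) +
        2 * (t ^ 3 * depl fun η => s (t • η) / s 0) ^ 2 +
        (t ^ 3 * ∫ η, (amp0 (disp η) - amp (disp η))) ^ 2) := by
  have hvi : Integrable v := hv.integrable_of_hasCompactSupport hvs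
  refine (LHY.ePlus_le (α := bog (fun ξ => s ξ / s 0) t) hv hv0 hvs
    (continuousOn_bog (h.cont.div_const _) ht) (bog_neg (fun ξ => by simp only [h.even]) t)
    (h.integrable_bog hs0 ht) (h.integrable_disp_bog_sq hvi hv0 hc hs0 ht) hr hρ ?_).trans
    (h.enDens_bog_le hvi hv0 hc hs0 hr ht hrt)
  rwa [integral_gam_bog _ ht]

/-- Second-order expansion of the upper bound at low density. -/
lemma IsScat.exists_expansion (h : IsScat v s) (hv : Continuous v) (hvs : HasCompactSupport v)
    (hv0 : ∀ x, 0 ≤ v x) (hc : coupling v ≤ 1) (hs0 : 0 < s 0) {δ : ℝ} (hδ : 0 < δ) :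
    ∃ R : ℝ → ℝ, (∀ᶠ ρ in 𝓝[>] 0, ePlus 3 (fun x => ENNReal.ofReal (v x)) ρ ≤
        s 0 * ρ ^ 2 + √ρ ^ 5 * R ρ) ∧
      Tendsto R (𝓝[>] 0) (𝓝 (√(2 * s 0) ^ 5 * (quadInt (fun _ => 1) - depl (fun _ => 1) + δ) +
        2 * (∫ x, v x) * √(2 * s 0) ^ 3 * depl fun _ => 1)) := by
  set σ := √(2 * s 0)
  have hσ : 0 < σ := Real.sqrt_pos.2 (by positivity)
  have hσ2 : σ ^ 2 = 2 * s 0 := Real.sq_sqrt (by positivity)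
  set J := depl fun _ => 1
  set K := quadInt fun _ => 1
  set b := (∫ x, v x) / 2
  set c3 := ∫ η, (amp0 (disp η) - amp (disp η))
  set θ := σ ^ 3 * (J - δ)
  set m : ℝ → ℝ := fun ρ => √(1 - θ * √ρ)
  set t : ℝ → ℝ := fun ρ => σ * √ρ * m ρ
  set D : ℝ → ℝ := fun ρ => depl fun η => s (t ρ • η) / s 0
  set Q : ℝ → ℝ := fun ρ => quadInt fun η => s (t ρ • η) / s 0
  have hvi : Integrable v := hv.integrable_of_hasCompactSupport hvs
  have hχ1 : ∀ ξ, |s ξ / s 0| ≤ 1 := fun ξ => by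
    rw [abs_div, abs_of_pos hs0, div_le_one hs0]
    exact h.abs_le_zero hvi hv0 hc ξ
  have hτ : Tendsto (fun ρ : ℝ => √ρ) (𝓝[>] 0) (𝓝 0) := by
    have := (Real.continuous_sqrt.tendsto 0).mono_left (nhdsWithin_le_nhds (s := Set.Ioi 0))
    rwa [Real.sqrt_zero] at this
  have hm1 : Tendsto (fun ρ : ℝ => 1 - θ * √ρ) (𝓝[>] 0) (𝓝 1) := by
    simpa using (hτ.const_mul θ).const_sub 1
  have hm : Tendsto m (𝓝[>] 0) (𝓝 1) := by
    have := (Real.continuous_sqrt.tendsto 1).comp hm1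
    rwa [Real.sqrt_one] at this
  have ht : Tendsto t (𝓝[>] 0) (𝓝 0) := by
    simpa using (hτ.const_mul σ).mul hm
  have hD : Tendsto D (𝓝[>] 0) (𝓝 J) :=
    tendsto_depl (χ := fun ξ => s ξ / s 0) (h.cont.div_const _) hχ1 (div_self hs0.ne') ht
  have hQ : Tendsto Q (𝓝[>] 0) (𝓝 K) :=
    tendsto_quadInt (χ := fun ξ => s ξ / s 0) (h.cont.div_const _) hχ1 (div_self hs0.ne') ht
  refine ⟨fun ρ => s 0 * (-2 * θ + θ ^ 2 * √ρ) + σ ^ 5 * m ρ ^ 5 * Q ρ +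
    b * (4 * σ ^ 3 * m ρ ^ 5 * D ρ + √ρ * (2 * σ ^ 6 * m ρ ^ 6 * D ρ ^ 2 +
      σ ^ 6 * m ρ ^ 6 * c3 ^ 2)), ?_, ?_⟩
  · have hcond : ∀ᶠ ρ in 𝓝[>] (0 : ℝ), θ < σ ^ 3 * m ρ ^ 3 * D ρ := by
      have : Tendsto (fun ρ => σ ^ 3 * m ρ ^ 3 * D ρ) (𝓝[>] 0) (𝓝 (σ ^ 3 * 1 ^ 3 * J)) :=
        ((hm.pow 3).const_mul _).mul hD
      refine this.eventually_const_lt ?_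
      have : 0 < σ ^ 3 * δ := by positivity
      simp only [θ]
      linarith
    filter_upwards [hcond, hm1.eventually_const_lt (zero_lt_one), self_mem_nhdsWithin]
      with ρ h1 h2 h3
    have hρ : 0 < ρ := h3
    have hτ0 : 0 < √ρ := Real.sqrt_pos.2 hρ
    have hτ2 : √ρ ^ 2 = ρ := Real.sq_sqrt hρ.le
    have hmp : 0 < m ρ := Real.sqrt_pos.2 h2
    have hm2 : m ρ ^ 2 = 1 - θ * √ρ := Real.sq_sqrt h2.le
    set τ := √ρ
    have htp : 0 < t ρ := by positivity
    have key := h.ePlus_le hv hvs hv0 hc hs0 (r := τ ^ 2 * m ρ ^ 2) (t := t ρ) (ρ := ρ)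
      (by positivity) htp (by simp only [t]; linear_combination (τ ^ 2 * m ρ ^ 2) * hσ2) hρ (by
        have : 0 < τ ^ 3 * (σ ^ 3 * m ρ ^ 3 * D ρ - θ) := by
          have := sub_pos.2 h1
          positivity
        have e : τ ^ 2 * m ρ ^ 2 + t ρ ^ 3 * D ρ - ρ = τ ^ 3 * (σ ^ 3 * m ρ ^ 3 * D ρ - θ) := by
          simp only [t]
          linear_combination τ ^ 2 * hm2 + hτ2
        change ρ < τ ^ 2 * m ρ ^ 2 + t ρ ^ 3 * D ρ
        linarith)
    refine key.trans_eq ?_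
    change s 0 * (τ ^ 2 * m ρ ^ 2) ^ 2 + t ρ ^ 5 * Q ρ + b * (4 * (τ ^ 2 * m ρ ^ 2) *
      (t ρ ^ 3 * D ρ) + 2 * (t ρ ^ 3 * D ρ) ^ 2 + (t ρ ^ 3 * c3) ^ 2) = _
    have e1 : (τ ^ 2 * m ρ ^ 2) ^ 2 = ρ ^ 2 + τ ^ 5 * (-2 * θ + θ ^ 2 * τ) := by
      rw [hm2, ← hτ2]; ring
    rw [e1]
    simp only [t]
    ring
  · have lim : Tendsto (fun ρ => s 0 * (-2 * θ + θ ^ 2 * √ρ) + σ ^ 5 * m ρ ^ 5 * Q ρ +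
      b * (4 * σ ^ 3 * m ρ ^ 5 * D ρ + √ρ * (2 * σ ^ 6 * m ρ ^ 6 * D ρ ^ 2 +
      σ ^ 6 * m ρ ^ 6 * c3 ^ 2))) (𝓝[>] 0) (𝓝 (s 0 * (-2 * θ + θ ^ 2 * 0) + σ ^ 5 * 1 ^ 5 * K +
      b * (4 * σ ^ 3 * 1 ^ 5 * J + 0 * (2 * σ ^ 6 * 1 ^ 6 * J ^ 2 +
      σ ^ 6 * 1 ^ 6 * c3 ^ 2)))) :=
      ((((hτ.const_mul _).const_add _).const_mul _).add (((hm.pow 5).const_mul _).mul hQ)).add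
        ((((((hm.pow 5).const_mul _).mul hD)).add (hτ.mul ((((hm.pow 6).const_mul _).mul
          (hD.pow 2)).add (((hm.pow 6).const_mul _).mul_const _)))).const_mul _)
    convert lim using 2
    simp only [θ, b]
    linear_combination (-σ ^ 3 * (J - δ)) * hσ2

lemma lhy_const {a : ℝ} (ha : 0 < a) :
    √(2 * (4 * π * a)) ^ 5 * (2 * √2 / (15 * π ^ 2)) / (4 * π * a * √(a ^ 3)) =
      128 / (15 * √π) := by
  have hp := Real.pi_pos
  have e1 : √(2 * (4 * π * a)) = 2 * √2 * √π * √a := by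
    have : 2 * (4 * π * a) = 2 ^ 2 * (2 * (π * a)) := by ring
    rw [this, Real.sqrt_mul (by positivity), Real.sqrt_sq (by norm_num),
      Real.sqrt_mul (by norm_num), Real.sqrt_mul hp.le]
    ring
  have e2 : √(a ^ 3) = √a ^ 3 := by
    rw [← Real.sqrt_sq (by positivity : 0 ≤ √a ^ 3)]
    congr 1
    rw [← pow_mul, mul_comm, pow_mul, Real.sq_sqrt ha.le]
  have h2 : √2 ^ 2 = 2 := Real.sq_sqrt (by norm_num)
  have hπ : √π ^ 2 = π := Real.sq_sqrt hp.le
  have hA : √a ^ 2 = a := Real.sq_sqrt ha.le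
  have p2 : 0 < √2 := Real.sqrt_pos.2 (by norm_num)
  have pπ : 0 < √π := Real.sqrt_pos.2 hp
  have pa : 0 < √a := Real.sqrt_pos.2 ha
  rw [e1, e2]
  have h6 : √2 ^ 6 = 8 := by
    have : √2 ^ 6 = (√2 ^ 2) ^ 3 := by ring
    rw [this, h2]; norm_num
  set x := √a
  set p := √π
  set w := √2
  rw [← hA, ← hπ]
  have e3 : (2 * w * p * x) ^ 5 * (2 * w / (15 * (p ^ 2) ^ 2)) =
    64 * w ^ 6 * p * x ^ 5 / 15 := by
    field_simp
    ring
  rw [e3, h6]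
  field_simp
  norm_num

end

end LHY

/-- **Upper bound with almost optimal second order constant for weak coupling
(Erdős–Schlein–Yau).** For a smooth, radial, compactly supported, nonzero
`Ṽ ≥ 0` there are `C > 0` and `λ₀ > 0` such that for all `0 < λ < λ₀`, denoting
by `a` the scattering length of `λṼ`, one has
`limsup_{ρ→0⁺} (e₃⁺(ρ;λṼ) − 4πaρ²)/(4πaρ²√(ρa³)) ≤ (1+Cλ)·128/(15√π)`. -/
theorem esy_upper_bound
    (W : Vec 3 → ℝ) (hWsm : ContDiff ℝ (⊤ : ℕ∞) W) (hWpos : ∀ x, 0 ≤ W x)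
    (hWrad : ∀ x y : Vec 3, ∑ k, (x k) ^ 2 = ∑ k, (y k) ^ 2 → W x = W y)
    (hWsupp : HasCompactSupport W) (hWne : ∃ x, W x ≠ 0) :
    ∃ C > (0 : ℝ), ∃ lam₀ > (0 : ℝ), ∀ lam : ℝ, 0 < lam → lam < lam₀ →
      ∀ a : ℝ, 0 < a →
        sInf (scatSet3 (fun x => ENNReal.ofReal (lam * W x))) = ENNReal.ofReal (4 * π * a) →
        limsup (fun ρ : ℝ =>
            (ePlus 3 (fun x => ENNReal.ofReal (lam * W x)) ρ - 4 * π * a * ρ ^ 2) /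
              (4 * π * a * ρ ^ 2 * Real.sqrt (ρ * a ^ 3)))
          (nhdsWithin 0 (Set.Ioi 0)) ≤ (1 + C * lam) * (128 / (15 * Real.sqrt π)) := by
  have hp := Real.pi_pos
  set A := LHY.coupling W
  have hA : 0 ≤ A := LHY.coupling_nonneg hWpos
  set J := LHY.depl fun _ => 1
  have hJ : 0 ≤ J := LHY.depl_nonneg _
  set L : ℝ := 2 * √2 / (15 * π ^ 2)
  have hL : 0 < L := by positivity
  refine ⟨(1 + 4 * A * J) / L, by positivity, 1 / (2 * (A + 1)), by positivity, ?_⟩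
  intro lam hlam hlt a ha hscat
  set v : Vec 3 → ℝ := fun x => lam * W x
  have hvsm : ContDiff ℝ (⊤ : ℕ∞) v := contDiff_const.mul hWsm
  have hvs : HasCompactSupport v := hWsupp.mul_left
  have hv0 : ∀ x, 0 ≤ v x := fun x => mul_nonneg hlam.le (hWpos x)
  have hvc : Continuous v := hvsm.continuous
  have hvi : Integrable v := hvc.integrable_of_hasCompactSupport hvs
  have hev : ∀ x, v (-x) = v x := fun x => by
    simp only [v]; rw [hWrad (-x) x (by simp)]
  have hcA : LHY.coupling v = lam * A := LHY.coupling_const_mul lam hlam.le W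
  have hc : LHY.coupling v ≤ 1 / 2 := by
    rw [hcA]
    rw [lt_div_iff₀ (by positivity)] at hlt
    nlinarith
  obtain ⟨s, h⟩ := LHY.exists_isScat hv0 hvi (LHY.integrable_ft hvsm hvs) (by linarith)
  have hbpos : 0 < ∫ x, v x := by
    obtain ⟨x, hx⟩ := hWne
    exact hvc.integral_pos_of_hasCompactSupport_nonneg_nonzero hvs hv0
      (mul_ne_zero hlam.ne' hx : v x ≠ 0)
  have hb := h.integral_le_zero hvi hv0
  have hs0 : 0 < s 0 := by nlinarith
  have hb2 : (∫ x, v x) ≤ 2 * s 0 * (1 + 2 * (lam * A)) := by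
    rw [hcA] at hb hc
    have hcn : 0 ≤ lam * A := by positivity
    have h1 : 1 ≤ (1 - lam * A) * (1 + 2 * (lam * A)) := by nlinarith
    have h2 := mul_le_mul_of_nonneg_right h1 hbpos.le
    have h3 := mul_le_mul_of_nonneg_right hb (by positivity : 0 ≤ 2 * (1 + 2 * (lam * A)))
    linarith
  have hsa : s 0 ≤ 4 * π * a := by
    have := h.le_sInf hvc hvs hv0 hev (by linarith)
    rw [hscat] at this
    exact (ENNReal.ofReal_le_ofReal_iff (by positivity)).1 this
  obtain ⟨R, hR1, hR2⟩ := h.exists_expansion hvc hvs hv0 (by linarith) hs0 hlam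
  have hden : 0 < 4 * π * a * √(a ^ 3) := by positivity
  refine LHY.limsup_le_of_tendsto (R := fun ρ => R ρ / (4 * π * a * √(a ^ 3))) ?_
    (hR2.div_const _) ?_ (by positivity)
  · filter_upwards [hR1, self_mem_nhdsWithin] with ρ h1 h2
    have hρ : 0 < ρ := h2
    have hτ : 0 < √ρ := Real.sqrt_pos.2 hρ
    have e4 : √ρ ^ 4 = ρ ^ 2 := by
      have : √ρ ^ 4 = (√ρ ^ 2) ^ 2 := by ring
      rw [this, Real.sq_sqrt hρ.le]
    rw [Real.sqrt_mul hρ.le, div_le_div_iff₀ (by positivity) hden]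
    have h3 : ePlus 3 (fun x => ENNReal.ofReal (v x)) ρ - 4 * π * a * ρ ^ 2 ≤ √ρ ^ 5 * R ρ := by
      have := mul_le_mul_of_nonneg_right hsa (sq_nonneg ρ)
      linarith
    refine (mul_le_mul_of_nonneg_right h3 hden.le).trans_eq ?_
    rw [← e4]
    ring
  · rw [div_le_iff₀ hden]
    set K := LHY.quadInt fun _ => 1
    have hJK : J + K = L := LHY.depl_add_quadInt
    set σ := √(2 * s 0)
    have hσ : 0 < σ := Real.sqrt_pos.2 (by positivity)
    have hσ2 : σ ^ 2 = 2 * s 0 := Real.sq_sqrt (by positivity)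
    have h1 : 2 * (∫ x, v x) * σ ^ 3 * J ≤ 2 * (2 * s 0 * (1 + 2 * (lam * A))) * σ ^ 3 * J := by
      gcongr
    have h2 : σ ^ 5 * (K - J + lam) + 2 * (2 * s 0 * (1 + 2 * (lam * A))) * σ ^ 3 * J =
        σ ^ 5 * L * (1 + (1 + 4 * A * J) / L * lam) := by
      have : L * (1 + (1 + 4 * A * J) / L * lam) = L + (1 + 4 * A * J) * lam := by
        field_simp
      rw [mul_assoc (σ ^ 5) L, this, ← hJK, ← hσ2]
      ring
    have h3 : σ ^ 5 ≤ √(2 * (4 * π * a)) ^ 5 := by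
      gcongr
      exact Real.sqrt_le_sqrt (by linarith)
    have h4 := LHY.lhy_const ha
    rw [div_eq_iff hden.ne'] at h4
    calc σ ^ 5 * (K - J + lam) + 2 * (∫ x, v x) * σ ^ 3 * J
        ≤ σ ^ 5 * L * (1 + (1 + 4 * A * J) / L * lam) := by linarith
      _ ≤ √(2 * (4 * π * a)) ^ 5 * L * (1 + (1 + 4 * A * J) / L * lam) := by gcongr
      _ = _ := by
        rw [h4]; ring
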